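/- arXiv:math/0109093 — 2 statements merged into one kernel-verified Lean document; each statement's English description precedes it below -/
import Mathlib

section
/- Let μ be a partition of k and fix w_μ ∈ S_k of cycle type μ. Then for all integers p, q, Σ_{λ ⊢ k} H_λ · s_λ(1^p) · s_λ(1^{−q}) · χ^λ(μ) = Σ_{(u,v) ∈ S_k × S_k, uv = w_μ} p^{κ(u)} (−q)^{κ(v)}, where the right-hand sum is over all k! pairs (u,v) of permutations in S_k with uv = w_μ. -/
open MvPolynomial

/-- The Vandermonde product `∏_{i<j} (x_i - x_j)`. -/
noncomputable def vandermondeMv (r : ℕ) : MvPolynomial (Fin r) ℤ :=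
  ∏ p ∈ Finset.univ.filter (fun p : Fin r × Fin r => p.1 < p.2), (X p.1 - X p.2)

/-- The power sum `x_1^a + ⋯ + x_r^a`. -/
noncomputable def powerSumMv (r : ℕ) (a : ℕ) : MvPolynomial (Fin r) ℤ :=
  ∑ i : Fin r, X i ^ a

/-- Frobenius character formula definition of the irreducible symmetric group character
`χ^λ(μ)`, where `L` lists the parts of `λ` (weakly decreasing, zeros allowed). -/
noncomputable def symChar (L : List ℕ) (μ : Multiset ℕ) : ℤ :=
  MvPolynomial.coeff
    (Finsupp.equivFunOnFinite.symm
      (fun i : Fin L.length => L.get i + (L.length - 1 - (i : ℕ))))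
    (vandermondeMv L.length * (μ.map (powerSumMv L.length)).prod)

/-- The `j`-th part (0-indexed) of the conjugate of the partition listed by `L`. -/
def conjPart (L : List ℕ) (j : ℕ) : ℕ :=
  ((List.range L.length).filter (fun i => j < L.getD i 0)).length

/-- The hook length of the (0-indexed) cell `(i,j)` of the partition listed by `L`. -/
def hookLen (L : List ℕ) (i j : ℕ) : ℤ :=
  (L.getD i 0 : ℤ) + (conjPart L j : ℤ) - (i : ℤ) - (j : ℤ) - 1

/-- `H_λ`: the product of all hook lengths of the partition listed by `L`. -/
def hookProd (L : List ℕ) : ℚ :=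
  ∏ i ∈ Finset.range L.length, ∏ j ∈ Finset.range (L.getD i 0), (hookLen L i j : ℚ)

/-- The principal specialization `s_λ(1^t) = ∏_{u ∈ λ} (t + c(u))/h(u)`. -/
def schurSpec (L : List ℕ) (t : ℚ) : ℚ :=
  ∏ i ∈ Finset.range L.length, ∏ j ∈ Finset.range (L.getD i 0),
    (t + ((j : ℚ) - (i : ℚ))) / (hookLen L i j : ℚ)

/-- The parts of a partition as a weakly decreasing list. -/
noncomputable def partList {n : ℕ} (P : Nat.Partition n) : List ℕ := P.parts.sort (· ≥ ·)

/-- The number of cycles `κ(w)` of a permutation (fixed points included). -/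
def cyclesCount {k : ℕ} (w : Equiv.Perm (Fin k)) : ℕ := w.partition.parts.card


section

open Equiv Equiv.Perm

/-- Sum of `x^f` over all `w`-invariant functions. -/
noncomputable def invPoly (r : ℕ) {k : ℕ} (w : Equiv.Perm (Fin k)) : MvPolynomial (Fin r) ℤ :=
  ∑ f : Fin k → Fin r, if (∀ d, f (w d) = f d) then ∏ d, X (f d) else 0

open Classical in
theorem prod_orbits_eq {k : ℕ} {M : Type*} [CommMonoid M] (w : Equiv.Perm (Fin k)) (g : ℕ → M) :
    ∏ q : Quotient (SameCycle.setoid w),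
      g ((Finset.univ.filter (fun d => Quotient.mk (SameCycle.setoid w) d = q)).card)
      = (w.partition.parts.map g).prod := by
  rw [parts_partition, Multiset.map_add, Multiset.prod_add, Multiset.map_replicate,
    Multiset.prod_replicate, cycleType_def, Multiset.map_map]
  rw [← Finset.prod_filter_mul_prod_filter_not Finset.univ
    (fun q : Quotient (SameCycle.setoid w) => ∃ x, w x ≠ x ∧ Quotient.mk _ x = q)]
  have hcl : ∀ x y : Fin k, Quotient.mk (SameCycle.setoid w) x = Quotient.mk _ y ↔ SameCycle w x y :=
    fun x y => Quotient.eq (r := SameCycle.setoid w)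
  congr 1
  · symm
    have hne : ∀ c ∈ w.cycleFactorsFinset, ∃ x, x ∈ c.support := fun c hc =>
      (mem_cycleFactorsFinset_iff.mp hc).1.nonempty_support
    choose s hs using hne
    have hcyc : ∀ c, ∀ hc : c ∈ w.cycleFactorsFinset, c = w.cycleOf (s c hc) := fun c hc =>
      cycle_is_cycleOf (hs c hc) hc
    have hsup : ∀ c, ∀ hc : c ∈ w.cycleFactorsFinset, s c hc ∈ w.support := fun c hc =>
      mem_cycleFactorsFinset_support_le hc (hs c hc)
    change ∏ c ∈ w.cycleFactorsFinset, g (c.support.card) = _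
    refine Finset.prod_bij (fun c hc => Quotient.mk (SameCycle.setoid w) (s c hc)) ?_ ?_ ?_ ?_
    · intro c hc
      simp only [Finset.mem_filter, Finset.mem_univ, true_and]
      exact ⟨s c hc, mem_support.mp (hsup c hc), rfl⟩
    · intro c hc c' hc' h
      rw [hcl] at h
      rw [hcyc c hc, hcyc c' hc']
      exact h.cycleOf_eq
    · intro q hq
      simp only [Finset.mem_filter, Finset.mem_univ, true_and] at hq
      obtain ⟨x, hx, rfl⟩ := hq
      have hm : w.cycleOf x ∈ w.cycleFactorsFinset :=
        cycleOf_mem_cycleFactorsFinset_iff.mpr (mem_support.mpr hx)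
      refine ⟨w.cycleOf x, hm, ?_⟩
      rw [hcl]
      have := hs _ hm
      rw [mem_support_cycleOf_iff] at this
      exact this.1.symm
    · intro c hc
      congr 2
      ext y
      simp only [Finset.mem_filter, Finset.mem_univ, true_and]
      rw [hcl, sameCycle_comm]
      conv_lhs => rw [hcyc c hc]
      rw [mem_support_cycleOf_iff]
      exact ⟨fun h => h.1, fun h => ⟨h, hsup c hc⟩⟩
  · have hfix : ∀ x y, w x = x → SameCycle w x y → y = x := by
      intro x y hx h
      obtain ⟨n, hn⟩ := h
      rw [← hn]
      exact zpow_apply_eq_self_of_apply_eq_self hx n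
    have hcard : Fintype.card (Fin k) - w.support.card
        = (Finset.univ.filter (fun x => w x = x)).card := by
      have := Finset.card_filter_add_card_filter_not (s := (Finset.univ : Finset (Fin k))) (fun x => w x = x)
      have h2 : w.support = Finset.univ.filter (fun x => ¬ w x = x) := by ext; simp
      rw [h2, ← Finset.card_univ]
      omega
    rw [hcard, ← Finset.prod_const]
    symm
    refine Finset.prod_bij (fun x _ => Quotient.mk (SameCycle.setoid w) x) ?_ ?_ ?_ ?_
    · intro x hx
      simp only [Finset.mem_filter, Finset.mem_univ, true_and] at hx ⊢
      rintro ⟨y, hy, h⟩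
      rw [hcl] at h
      have := hfix x y hx h.symm
      subst this
      exact hy hx
    · intro x hx y hy h
      simp only [Finset.mem_filter, Finset.mem_univ, true_and] at hx
      rw [hcl] at h
      exact (hfix x y hx h).symm
    · intro q hq
      induction q using Quotient.inductionOn with
      | h x =>
        simp only [Finset.mem_filter, Finset.mem_univ, true_and] at hq
        refine ⟨x, ?_, rfl⟩
        simp only [Finset.mem_filter, Finset.mem_univ, true_and]
        by_contra hx
        exact hq ⟨x, hx, rfl⟩
    · intro x hx
      simp only [Finset.mem_filter, Finset.mem_univ, true_and] at hx
      congr 1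
      symm
      rw [Finset.card_eq_one]
      refine ⟨x, ?_⟩
      ext y
      simp only [Finset.mem_filter, Finset.mem_univ, true_and, Finset.mem_singleton]
      rw [hcl]
      exact ⟨fun h => hfix x y hx h.symm, fun h => h ▸ SameCycle.refl _ _⟩

open Classical in
theorem invPoly_eq (r : ℕ) {k : ℕ} (w : Equiv.Perm (Fin k)) :
    invPoly r w = (w.partition.parts.map (powerSumMv r)).prod := by
  rw [← prod_orbits_eq]
  unfold powerSumMv
  rw [Finset.prod_univ_sum, Fintype.piFinset_univ]
  unfold invPoly
  rw [← Finset.sum_filter]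
  symm
  refine Finset.sum_bij (fun F _ => fun d => F (Quotient.mk (SameCycle.setoid w) d)) ?_ ?_ ?_ ?_
  · intro F _
    simp only [Finset.mem_filter, Finset.mem_univ, true_and]
    intro d
    congr 1
    apply Quotient.sound
    exact (sameCycle_apply_left.mpr (SameCycle.refl _ _) : SameCycle w (w d) d)
  · intro F _ G _ h
    funext q
    induction q using Quotient.inductionOn with
    | h x => exact congrFun h x
  · intro f hf
    simp only [Finset.mem_filter, Finset.mem_univ, true_and] at hf
    have hz : ∀ (n : ℕ) d, f ((w ^ n) d) = f d := by
      intro n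
      induction n with
      | zero => intro d; simp
      | succ n ih => intro d; rw [pow_succ, Perm.mul_apply, ih, hf]
    refine ⟨fun q => Quotient.lift f ?_ q, Finset.mem_univ _, ?_⟩
    · intro a b (hab : SameCycle w a b)
      obtain ⟨n, hn⟩ := hab.exists_nat_pow_eq
      rw [← hn, hz]
    · rfl
  · intro F _
    rw [← Finset.prod_fiberwise (s := Finset.univ) (g := fun d => Quotient.mk (SameCycle.setoid w) d)]
    refine Finset.prod_congr rfl fun q _ => ?_
    rw [← Finset.prod_const]
    refine Finset.prod_congr rfl fun d hd => ?_
    simp only [Finset.mem_filter, Finset.mem_univ, true_and] at hd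
    rw [← hd]

/-- The embedding `S_k → S_{k+1}` fixing `0`. -/
def iotaPerm {k : ℕ} (e : Equiv.Perm (Fin k)) : Equiv.Perm (Fin (k + 1)) := decomposeFin.symm (0, e)

/-- The transposition `(0 a+1)`. -/
def swz {k : ℕ} (a : Fin k) : Equiv.Perm (Fin (k + 1)) := Equiv.swap 0 a.succ

@[simp] theorem iotaPerm_zero {k : ℕ} (e : Equiv.Perm (Fin k)) : iotaPerm e 0 = 0 := by
  simp [iotaPerm]

@[simp] theorem iotaPerm_succ {k : ℕ} (e : Equiv.Perm (Fin k)) (x : Fin k) :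
    iotaPerm e x.succ = (e x).succ := by
  simp [iotaPerm]

theorem iotaPerm_mul {k : ℕ} (e f : Equiv.Perm (Fin k)) :
    iotaPerm (e * f) = iotaPerm e * iotaPerm f := by
  ext x
  refine Fin.cases ?_ (fun x => ?_) x <;> simp

theorem iotaPerm_one {k : ℕ} : iotaPerm (1 : Equiv.Perm (Fin k)) = 1 := by
  ext x
  refine Fin.cases ?_ (fun x => ?_) x <;> simp

theorem iotaPerm_swap {k : ℕ} (a b : Fin k) :
    iotaPerm (Equiv.swap a b) = Equiv.swap a.succ b.succ := by
  ext x
  refine Fin.cases ?_ (fun x => ?_) x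
  · rw [iotaPerm_zero, Equiv.swap_apply_of_ne_of_ne (Fin.succ_ne_zero _).symm (Fin.succ_ne_zero _).symm]
  · rw [iotaPerm_succ, Equiv.swap_apply_def, Equiv.swap_apply_def]
    split_ifs <;> simp_all

theorem decomposeFin_symm_eq {k : ℕ} (p : Fin (k + 1)) (e : Equiv.Perm (Fin k)) :
    decomposeFin.symm (p, e) = Equiv.swap 0 p * iotaPerm e := by
  ext x
  refine Fin.cases ?_ (fun x => ?_) x <;> simp

theorem swz_comm {k : ℕ} (e : Equiv.Perm (Fin k)) (a : Fin k) :
    swz (e a) * iotaPerm e = iotaPerm e * swz a := by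
  unfold swz
  rw [Equiv.mul_swap_eq_swap_mul]
  simp

theorem swz_mul_swz {k : ℕ} (a : Fin k) : swz a * swz a = 1 := by
  simp [swz]

theorem sum_swz_comm {k : ℕ} {M : Type*} [AddCommMonoid M] (e : Equiv.Perm (Fin k))
    (Ψ : Equiv.Perm (Fin (k + 1)) → M) :
    ∑ a, Ψ (swz a * iotaPerm e) = ∑ a, Ψ (iotaPerm e * swz a) := by
  rw [← Equiv.sum_comp e]
  simp only [swz_comm]

theorem invPoly_conj (r : ℕ) {k : ℕ} (g w : Equiv.Perm (Fin k)) :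
    invPoly r (g * w * g⁻¹) = invPoly r w := by
  rw [invPoly_eq, invPoly_eq]
  have : (g * w * g⁻¹).partition = w.partition :=
    (partition_eq_of_isConj.mp (isConj_iff.mpr ⟨g, rfl⟩)).symm
  rw [this]

theorem cyclesCount_conj {k : ℕ} (g w : Equiv.Perm (Fin k)) :
    cyclesCount (g * w * g⁻¹) = cyclesCount w := by
  have : (g * w * g⁻¹).partition = w.partition :=
    (partition_eq_of_isConj.mp (isConj_iff.mpr ⟨g, rfl⟩)).symm
  unfold cyclesCount
  rw [this]

theorem cyclesCount_inv {k : ℕ} (w : Equiv.Perm (Fin k)) :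
    cyclesCount (w⁻¹) = cyclesCount w := by
  unfold cyclesCount
  rw [parts_partition, parts_partition, cycleType_inv, support_inv]

theorem invPoly_iota (r : ℕ) {k : ℕ} (e : Equiv.Perm (Fin k)) :
    invPoly r (iotaPerm e) = (∑ i, X i) * invPoly r e := by
  unfold invPoly
  rw [← Equiv.sum_comp (Fin.consEquiv (fun _ : Fin (k + 1) => Fin r)), Fintype.sum_prod_type,
    Finset.sum_mul_sum]
  refine Finset.sum_congr rfl fun i _ => Finset.sum_congr rfl fun f _ => ?_
  simp [Fin.consEquiv, Fin.forall_fin_succ, Fin.prod_univ_succ]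

theorem card_inv_eq (r : ℕ) {k : ℕ} (w : Equiv.Perm (Fin k)) :
    (Finset.univ.filter (fun f : Fin k → Fin r => ∀ d, f (w d) = f d)).card = r ^ cyclesCount w := by
  have h := congrArg (MvPolynomial.eval (fun _ : Fin r => (1 : ℤ))) (invPoly_eq r w)
  have h1 : MvPolynomial.eval (fun _ : Fin r => (1 : ℤ)) (invPoly r w)
      = (Finset.univ.filter (fun f : Fin k → Fin r => ∀ d, f (w d) = f d)).card := by
    unfold invPoly
    rw [map_sum, Finset.card_filter, Nat.cast_sum]
    refine Finset.sum_congr rfl fun f _ => ?_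
    split_ifs <;> simp
  have h2 : MvPolynomial.eval (fun _ : Fin r => (1 : ℤ))
      ((w.partition.parts.map (powerSumMv r)).prod) = (r : ℤ) ^ cyclesCount w := by
    rw [map_multiset_prod, Multiset.map_map]
    have : (MvPolynomial.eval (fun _ : Fin r => (1 : ℤ))) ∘ (powerSumMv r) = fun _ => (r : ℤ) := by
      funext a
      simp [powerSumMv]
    rw [this]
    simp [cyclesCount]
  rw [h1, h2] at h
  exact_mod_cast h

theorem cyclesCount_iota {k : ℕ} (e : Equiv.Perm (Fin k)) :
    cyclesCount (iotaPerm e) = cyclesCount e + 1 := by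
  apply Nat.pow_right_injective (le_refl 2)
  change 2 ^ _ = 2 ^ _
  rw [← card_inv_eq 2, pow_succ, ← card_inv_eq 2, Finset.card_filter, Finset.card_filter,
    ← Equiv.sum_comp (Fin.consEquiv (fun _ : Fin (k + 1) => Fin 2)), Fintype.sum_prod_type]
  simp [Fin.consEquiv, Fin.forall_fin_succ]
  ring

theorem cyclesCount_swz {k : ℕ} (e : Equiv.Perm (Fin k)) (a : Fin k) :
    cyclesCount (swz a * iotaPerm e) = cyclesCount e := by
  apply Nat.pow_right_injective (le_refl 2)
  change 2 ^ _ = 2 ^ _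
  rw [← card_inv_eq 2, ← card_inv_eq 2]
  refine Finset.card_bij' (fun f _ => fun x => f x.succ) (fun f _ => Fin.cons (f a) f) ?_ ?_ ?_ ?_
  · intro f hf
    simp only [Finset.mem_filter, Finset.mem_univ, true_and] at hf ⊢
    have h0 : f a.succ = f 0 := by
      have := hf 0
      simpa [swz] using this
    intro d
    have := hf d.succ
    rw [Perm.mul_apply, iotaPerm_succ] at this
    by_cases h : e d = a
    · rw [h] at this ⊢
      simp only [swz, Equiv.swap_apply_right] at this
      rw [h0, this]
    · rw [swz, Equiv.swap_apply_of_ne_of_ne (Fin.succ_ne_zero _)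
        (fun hh => h (Fin.succ_injective _ hh))] at this
      exact this
  · intro f hf
    simp only [Finset.mem_filter, Finset.mem_univ, true_and] at hf ⊢
    intro d
    refine Fin.cases ?_ (fun d => ?_) d
    · simp [swz]
    · rw [Perm.mul_apply, iotaPerm_succ]
      by_cases h : e d = a
      · rw [h]
        simp only [swz, Equiv.swap_apply_right]
        rw [Fin.cons_zero, Fin.cons_succ, ← hf d, h]
      · rw [swz, Equiv.swap_apply_of_ne_of_ne (Fin.succ_ne_zero _)
          (fun hh => h (Fin.succ_injective _ hh))]
        simp [hf]
  · intro f hf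
    simp only [Finset.mem_filter, Finset.mem_univ, true_and] at hf
    have h0 : f a.succ = f 0 := by
      have := hf 0
      simpa [swz] using this
    funext x
    refine Fin.cases ?_ (fun x => ?_) x
    · simp [h0]
    · simp
  · intro f hf
    funext x
    simp

theorem sum_cycles_succ {k : ℕ} {M : Type*} [AddCommGroup M] (t : ℤ)
    (Ψ : Equiv.Perm (Fin (k + 1)) → M) :
    ∑ u, t ^ cyclesCount u • Ψ u
      = ∑ e : Equiv.Perm (Fin k), t ^ cyclesCount e •
          (t • Ψ (iotaPerm e) + ∑ a, Ψ (iotaPerm e * swz a)) := by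
  rw [← Equiv.sum_comp (decomposeFin (n := k)).symm, Fintype.sum_prod_type, Finset.sum_comm]
  refine Finset.sum_congr rfl fun e _ => ?_
  rw [Fin.sum_univ_succ, smul_add, ← sum_swz_comm, Finset.smul_sum]
  congr 1
  · change t ^ cyclesCount (iotaPerm e) • Ψ (iotaPerm e) = _
    rw [cyclesCount_iota, pow_succ, mul_smul]
  · refine Finset.sum_congr rfl fun a _ => ?_
    rw [decomposeFin_symm_eq]
    change t ^ cyclesCount (swz a * iotaPerm e) • Ψ (swz a * iotaPerm e) = _
    rw [cyclesCount_swz]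

open Classical in
theorem class_vanish {k : ℕ} {M : Type*} [AddCommGroup M]
    (htf : ∀ (n : ℕ) (x : M), n ≠ 0 → n • x = 0 → x = 0)
    (Ψ : Equiv.Perm (Fin (k + 1)) → M) (hconj : ∀ g w, Ψ (g * w * g⁻¹) = Ψ w)
    (h0 : ∀ e, Ψ (iotaPerm e) = 0) (h1 : ∀ e, ∑ a, Ψ (iotaPerm e * swz a) = 0) :
    ∀ w, Ψ w = 0 := by
  have key : ∀ n : ℕ, ∀ w : Equiv.Perm (Fin (k + 1)), ∀ S : Finset (Fin (k + 1)), S.Nonempty →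
      S.card ≤ n → (∀ x ∈ S, w x ∈ S) → Ψ w = 0 := by
    intro n
    induction n with
    | zero =>
      intro w S hS hc
      have := hS.card_pos
      omega
    | succ n ih =>
      have main : ∀ w : Equiv.Perm (Fin (k + 1)), ∀ S : Finset (Fin (k + 1)), 0 ∈ S →
          S.card ≤ n + 1 → (∀ x ∈ S, w x ∈ S) → Ψ w = 0 := by
        intro w S hS hc hinv
        obtain ⟨⟨p, e⟩, rfl⟩ := (decomposeFin (n := k)).symm.surjective w
        rw [decomposeFin_symm_eq] at hinv ⊢
        induction p using Fin.cases with
        | zero =>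
          rw [Equiv.swap_self]
          exact h0 e
        | succ a =>
          change ∀ x ∈ S, (swz a * iotaPerm e) x ∈ S at hinv
          change Ψ (swz a * iotaPerm e) = 0
          have ha : a.succ ∈ S := by
            have := hinv 0 hS
            simpa [swz] using this
          have hstep : ∀ x : Fin k, x.succ ∈ S → (e x).succ ∈ S := by
            intro x hx
            by_cases h : e x = a
            · rw [h]; exact ha
            · have := hinv _ hx
              rwa [Perm.mul_apply, iotaPerm_succ, swz, Equiv.swap_apply_of_ne_of_ne
                (Fin.succ_ne_zero _) (fun hh => h (Fin.succ_injective _ hh))] at this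
          have hpow : ∀ m : ℕ, ((e ^ m) a).succ ∈ S := by
            intro m
            induction m with
            | zero => simpa using ha
            | succ m ihm => rw [pow_succ', Perm.mul_apply]; exact hstep _ ihm
          set S' : Finset (Fin k) := Finset.univ.filter (fun x => SameCycle e a x) with hS'
          have hsub : S'.image Fin.succ ⊆ S.erase 0 := by
            intro y hy
            rw [Finset.mem_image] at hy
            obtain ⟨x, hx, rfl⟩ := hy
            rw [hS', Finset.mem_filter] at hx
            obtain ⟨m, hm⟩ := hx.2.exists_nat_pow_eq
            rw [Finset.mem_erase, ← hm]
            exact ⟨Fin.succ_ne_zero _, hpow m⟩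
          have hcard : (S'.image Fin.succ).card ≤ n := by
            have := Finset.card_le_card hsub
            rw [Finset.card_erase_of_mem hS] at this
            omega
          have haS : a ∈ S' := by
            rw [hS', Finset.mem_filter]
            exact ⟨Finset.mem_univ _, SameCycle.refl _ _⟩
          have hval : ∀ b, Ψ (swz b * iotaPerm e)
              = if b ∈ S' then Ψ (swz a * iotaPerm e) else 0 := by
            intro b
            split_ifs with hb
            · rw [hS', Finset.mem_filter] at hb
              obtain ⟨m, rfl⟩ := hb.2.exists_nat_pow_eq
              rw [← hconj (iotaPerm (e ^ m)) (swz a * iotaPerm e)]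
              congr 1
              rw [eq_mul_inv_iff_mul_eq, mul_assoc, ← iotaPerm_mul, ← mul_assoc, ← swz_comm,
                mul_assoc, ← iotaPerm_mul]
              congr 2
              rw [← pow_succ, ← pow_succ']
            · refine ih _ (S'.image Fin.succ) ⟨a.succ, Finset.mem_image_of_mem _ haS⟩ hcard ?_
              intro y hy
              rw [Finset.mem_image] at hy
              obtain ⟨x, hx, rfl⟩ := hy
              have hex : e x ∈ S' := by
                rw [hS', Finset.mem_filter] at hx ⊢
                exact ⟨Finset.mem_univ _, sameCycle_apply_right.mpr hx.2⟩
              rw [Perm.mul_apply, iotaPerm_succ, swz, Equiv.swap_apply_of_ne_of_ne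
                (Fin.succ_ne_zero _)]
              · exact Finset.mem_image_of_mem _ hex
              · intro hh
                exact hb (Fin.succ_injective _ hh ▸ hex)
          have hsum := h1 e
          rw [← sum_swz_comm, Finset.sum_congr rfl (fun b _ => hval b), ← Finset.sum_filter,
            Finset.sum_const] at hsum
          refine htf _ _ ?_ hsum
          rw [Finset.card_ne_zero]
          exact ⟨a, by simpa using haS⟩
      intro w S hS hc hinv
      obtain ⟨x, hx⟩ := hS
      rw [← hconj (Equiv.swap 0 x) w]
      refine main _ (S.image (Equiv.swap 0 x)) ?_ ?_ ?_
      · rw [Finset.mem_image]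
        exact ⟨x, hx, by simp⟩
      · exact Finset.card_image_le.trans hc
      · intro y hy
        rw [Finset.mem_image] at hy
        obtain ⟨z, hz, rfl⟩ := hy
        simp only [Perm.mul_apply, Equiv.swap_inv, Equiv.swap_apply_self]
        exact Finset.mem_image_of_mem _ (hinv z hz)
  intro w
  exact key (k + 1) w Finset.univ ⟨0, Finset.mem_univ _⟩ (by simp) (fun x _ => Finset.mem_univ _)

theorem cut_count {k r : ℕ} (w : Equiv.Perm (Fin k)) (i j : Fin r) (hij : i ≠ j) (c : Fin k)
    (f g : Fin k → Fin r) (hfc : f c = j) (hgc : g c = i) (hg : ∀ d, d ≠ c → g d = f d) :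
    (∑ b, if (f (w⁻¹ c) = i ∧ f b = j ∧ ∀ d, f (w d) = f (Equiv.swap (w⁻¹ c) b d)) then 1 else 0)
      + (if (∀ d, f (w d) = f d) then 1 else 0)
    = (∑ b, if (g b = j ∧ ∀ d, g (w d) = g (Equiv.swap c b d)) then 1 else 0)
      + (if (∀ d, g (w d) = g d) then (1 : ℤ) else 0) := by
  obtain ⟨a, ha⟩ : ∃ a, w⁻¹ c = a := ⟨_, rfl⟩
  have hwa : w a = c := by rw [← ha]; simp
  have hw : ∀ d, w d = c → d = a := fun d hd => w.injective (hd.trans hwa.symm)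
  rw [ha]
  by_cases hac : a = c
  · subst hac
    have e1 : ∀ b, ¬ (f a = i ∧ f b = j ∧ ∀ d, f (w d) = f (Equiv.swap a b d)) := by
      rintro b ⟨h, -⟩
      exact hij (h.symm.trans hfc)
    have e2 : ∀ b, ¬ (g b = j ∧ ∀ d, g (w d) = g (Equiv.swap a b d)) := by
      rintro b ⟨h, h2⟩
      have := h2 a
      rw [hwa, Equiv.swap_apply_left, h, hgc] at this
      exact hij this
    simp only [e1, e2, if_false, Finset.sum_const_zero, zero_add]
    refine if_congr ⟨fun h d => ?_, fun h d => ?_⟩ rfl rfl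
    · by_cases hd : d = a
      · rw [hd, hwa]
      · rw [hg _ hd, hg _ (fun hh => hd (hw _ hh)), h]
    · by_cases hd : d = a
      · rw [hd, hwa]
      · rw [← hg _ hd, ← hg _ (fun hh => hd (hw _ hh)), h]
  · have key : ∀ b, (if (f a = i ∧ f b = j ∧ ∀ d, f (w d) = f (Equiv.swap a b d)) then (1 : ℤ) else 0)
        + (if b = a then (if (∀ d, f (w d) = f d) then 1 else 0) else 0)
        = (if (g b = j ∧ ∀ d, g (w d) = g (Equiv.swap c b d)) then 1 else 0)
        + (if b = c then (if (∀ d, g (w d) = g d) then (1 : ℤ) else 0) else 0) := by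
      intro b
      by_cases hba : b = a
      · subst hba
        rw [if_neg (by rintro ⟨h1, h2, -⟩; exact hij (h1.symm.trans h2)), if_pos rfl, if_neg hac,
          zero_add, add_zero]
        refine if_congr ⟨fun h => ⟨?_, fun d => ?_⟩, fun h d => ?_⟩ rfl rfl
        · grind
        · have := h d
          have := h c
          have := h b
          grind
        · have := h.1
          have := h.2 d
          have := h.2 c
          have := h.2 b
          grind
      · by_cases hbc : b = c
        · subst hbc
          rw [if_neg hba, if_pos rfl, add_zero, if_neg (c := g b = j ∧ _)
            (by rintro ⟨h1, -⟩; exact hij (hgc.symm.trans h1)), zero_add]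
          refine if_congr ⟨fun h d => ?_, fun h => ⟨?_, ?_, fun d => ?_⟩⟩ rfl rfl
          · have := h.1
            have := h.2.1
            have := h.2.2 d
            have := h.2.2 a
            have := h.2.2 b
            grind
          · grind
          · grind
          · have := h d
            have := h a
            have := h b
            grind
        · rw [if_neg hba, if_neg hbc, add_zero, add_zero]
          refine if_congr ⟨fun h => ⟨?_, fun d => ?_⟩, fun h => ⟨?_, ?_, fun d => ?_⟩⟩ rfl rfl
          · grind
          · have := h.1
            have := h.2.1
            have := h.2.2 d
            have := h.2.2 a
            have := h.2.2 b
            have := h.2.2 c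
            grind
          · have := h.2 a
            grind
          · grind
          · have := h.1
            have := h.2 d
            have := h.2 a
            have := h.2 b
            have := h.2 c
            grind
    have := Finset.sum_congr (rfl : (Finset.univ : Finset (Fin k)) = _) (fun b _ => key b)
    rw [Finset.sum_add_distrib, Finset.sum_add_distrib, Finset.sum_ite_eq' , Finset.sum_ite_eq',
      if_pos (Finset.mem_univ _), if_pos (Finset.mem_univ _)] at this
    exact this

/-- The diagonal operator `x^m ↦ g(m) x^m`. -/
noncomputable def diagOp {r : ℕ} (g : (Fin r →₀ ℕ) → ℤ) :
    MvPolynomial (Fin r) ℤ →ₗ[ℤ] MvPolynomial (Fin r) ℤ :=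
  (MvPolynomial.basisMonomials (Fin r) ℤ).constr ℤ (fun m => monomial m (g m))

theorem diagOp_monomial {r : ℕ} (g : (Fin r →₀ ℕ) → ℤ) (m : Fin r →₀ ℕ) (c : ℤ) :
    diagOp g (monomial m c) = monomial m (g m * c) := by
  have h : (monomial m c : MvPolynomial (Fin r) ℤ)
      = c • (MvPolynomial.basisMonomials (Fin r) ℤ) m := by
    rw [MvPolynomial.coe_basisMonomials, smul_monomial, smul_eq_mul, mul_one]
  rw [h, map_smul, diagOp, Module.Basis.constr_basis, smul_monomial, smul_eq_mul, mul_comm]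

theorem coeff_diagOp {r : ℕ} (g : (Fin r →₀ ℕ) → ℤ) (m : Fin r →₀ ℕ) (F : MvPolynomial (Fin r) ℤ) :
    coeff m (diagOp g F) = g m * coeff m F := by
  induction F using MvPolynomial.induction_on' with
  | monomial u a =>
    rw [diagOp_monomial, coeff_monomial, coeff_monomial]
    split_ifs with h
    · rw [h]
    · rw [mul_zero]
  | add p q hp hq => rw [map_add, coeff_add, coeff_add, hp, hq, mul_add]

theorem diagOp_X_mul {r : ℕ} (g : (Fin r →₀ ℕ) → ℤ) (i : Fin r) (F : MvPolynomial (Fin r) ℤ) :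
    diagOp g (X i * F) = X i * diagOp (fun m => g (m + Finsupp.single i 1)) F := by
  induction F using MvPolynomial.induction_on' with
  | monomial u a =>
    rw [diagOp_monomial, X, monomial_mul, monomial_mul, diagOp_monomial, add_comm u, one_mul,
      one_mul]
  | add p q hp hq => rw [mul_add, map_add, map_add, mul_add, hp, hq]

theorem diagOp_diagOp {r : ℕ} (g h : (Fin r →₀ ℕ) → ℤ) (F : MvPolynomial (Fin r) ℤ) :
    diagOp g (diagOp h F) = diagOp (fun m => g m * h m) F := by
  ext m
  rw [coeff_diagOp, coeff_diagOp, coeff_diagOp, mul_assoc]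

theorem diagOp_theta {r : ℕ} (i : Fin r) (F : MvPolynomial (Fin r) ℤ) :
    diagOp (fun m => (m i : ℤ)) F = X i * pderiv i F := by
  induction F using MvPolynomial.induction_on' with
  | monomial u a =>
    rw [diagOp_monomial, X_mul_pderiv_monomial, ← nsmul_eq_mul]
    exact (map_nsmul (monomial u) _ _)
  | add p q hp hq => rw [map_add, map_add, mul_add, hp, hq]

theorem theta_prod {r k : ℕ} (i : Fin r) (f : Fin k → Fin r) :
    X i * pderiv i (∏ d, (X (f d) : MvPolynomial (Fin r) ℤ))
      = (∑ c, if f c = i then (1 : ℤ) else 0) • ∏ d, X (f d) := by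
  have h : (∏ d, (X (f d) : MvPolynomial (Fin r) ℤ))
      = monomial (∑ d, Finsupp.single (f d) 1) 1 := by
    rw [monomial_sum_one]
    rfl
  rw [← diagOp_theta, h, diagOp_monomial, smul_monomial]
  congr 1
  rw [Finsupp.finsetSum_apply, smul_eq_mul, Nat.cast_sum]
  congr 1
  refine Finset.sum_congr rfl fun c _ => ?_
  rw [Finsupp.single_apply]
  push_cast
  rfl

theorem theta_invPoly (r : ℕ) {k : ℕ} (w : Equiv.Perm (Fin k)) (i : Fin r) :
    X i * pderiv i (invPoly r w)
      = ∑ c, ∑ f : Fin k → Fin r,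
        (if f c = i then if (∀ d, f (w d) = f d) then (1 : ℤ) else 0 else 0) • ∏ d, X (f d) := by
  unfold invPoly
  rw [Finset.sum_comm, map_sum, Finset.mul_sum]
  refine Finset.sum_congr rfl fun f _ => ?_
  split_ifs with h
  · rw [theta_prod, Finset.sum_smul]
  · simp

/-- The contribution of cuts and joins between colors `i` and `j`. -/
noncomputable def cutPoly (r : ℕ) {k : ℕ} (w : Equiv.Perm (Fin k)) (i j : Fin r) :
    MvPolynomial (Fin r) ℤ :=
  ∑ a, ∑ f : Fin k → Fin r, (∑ b, if (f a = i ∧ f b = j ∧ ∀ d, f (w d) = f (Equiv.swap a b d))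
    then (1 : ℤ) else 0) • ∏ d, X (f d)

theorem cutPoly_eq (r : ℕ) {k : ℕ} (w : Equiv.Perm (Fin k)) (i j : Fin r) (hij : i ≠ j) :
    X i * cutPoly r w i j + X i * (X j * pderiv j (invPoly r w))
      = X j * cutPoly r w i j + X j * (X i * pderiv i (invPoly r w)) := by
  rw [← mul_add, ← mul_add, theta_invPoly, theta_invPoly]
  conv_lhs => rw [cutPoly, ← Equiv.sum_comp w⁻¹]
  rw [cutPoly, ← Finset.sum_add_distrib, ← Finset.sum_add_distrib, Finset.mul_sum, Finset.mul_sum]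
  refine Finset.sum_congr rfl fun c _ => ?_
  rw [← Finset.sum_add_distrib, ← Finset.sum_add_distrib, Finset.mul_sum, Finset.mul_sum]
  simp only [← add_smul]
  have hL : ∀ f : Fin k → Fin r, ¬ f c = j → X i * (((∑ b, if (f (w⁻¹ c) = i ∧ f b = j ∧
      ∀ d, f (w d) = f (Equiv.swap (w⁻¹ c) b d)) then (1 : ℤ) else 0) +
      (if f c = j then if (∀ d, f (w d) = f d) then (1 : ℤ) else 0 else 0)) •
      ∏ d, (X (f d) : MvPolynomial (Fin r) ℤ)) = 0 := by
    intro f hf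
    rw [if_neg hf, Finset.sum_eq_zero, add_zero, zero_smul, mul_zero]
    intro b _
    rw [if_neg]
    rintro ⟨h1, h2, h3⟩
    have := h3 (w⁻¹ c)
    rw [Equiv.swap_apply_left, h2] at this
    simp at this
    exact hf this
  have hR : ∀ f : Fin k → Fin r, ¬ f c = i → X j * (((∑ b, if (f c = i ∧ f b = j ∧
      ∀ d, f (w d) = f (Equiv.swap c b d)) then (1 : ℤ) else 0) +
      (if f c = i then if (∀ d, f (w d) = f d) then (1 : ℤ) else 0 else 0)) •
      ∏ d, (X (f d) : MvPolynomial (Fin r) ℤ)) = 0 := by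
    intro f hf
    rw [if_neg hf, Finset.sum_eq_zero, add_zero, zero_smul, mul_zero]
    intro b _
    rw [if_neg]
    rintro ⟨h1, -⟩
    exact hf h1
  rw [← Finset.sum_filter_add_sum_filter_not Finset.univ (fun f : Fin k → Fin r => f c = j),
    Finset.sum_eq_zero (s := Finset.univ.filter (fun f : Fin k → Fin r => ¬ f c = j))
      (fun f hf => hL f (Finset.mem_filter.mp hf).2), add_zero]
  conv_rhs =>
    rw [← Finset.sum_filter_add_sum_filter_not Finset.univ (fun f : Fin k → Fin r => f c = i),
      Finset.sum_eq_zero (s := Finset.univ.filter (fun f : Fin k → Fin r => ¬ f c = i))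
      (fun f hf => hR f (Finset.mem_filter.mp hf).2), add_zero]
  refine Finset.sum_bij' (fun f _ => Function.update f c i) (fun f _ => Function.update f c j)
    ?_ ?_ ?_ ?_ ?_
  · intro f hf
    simp
  · intro f hf
    simp
  · intro f hf
    rw [Finset.mem_filter] at hf
    rw [Function.update_idem, ← hf.2, Function.update_eq_self]
  · intro f hf
    rw [Finset.mem_filter] at hf
    rw [Function.update_idem, ← hf.2, Function.update_eq_self]
  · intro f hf
    rw [Finset.mem_filter] at hf
    have hfc := hf.2
    have hc := cut_count w i j hij c f (Function.update f c i) hfc (by simp)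
      (fun d hd => by simp [hd])
    have hx : X i * ∏ d, (X (f d) : MvPolynomial (Fin r) ℤ)
        = X j * ∏ d, X (Function.update f c i d) := by
      rw [← Finset.mul_prod_erase Finset.univ _ (Finset.mem_univ c),
        ← Finset.mul_prod_erase Finset.univ (fun d => X (Function.update f c i d)) (Finset.mem_univ c),
        hfc, Function.update_self, mul_left_comm]
      congr 2
      refine Finset.prod_congr rfl fun d hd => ?_
      rw [Function.update_of_ne (Finset.ne_of_mem_erase hd)]
    rw [mul_smul_comm, mul_smul_comm, hx, if_pos hfc, hc, if_pos (Function.update_self c i f)]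
    simp only [Function.update_self, true_and]

theorem sum_rot3 {α β γ M : Type*} [Fintype α] [Fintype β] [Fintype γ] [AddCommMonoid M]
    (G : α → β → γ → M) : ∑ i, ∑ j, ∑ a, G i j a = ∑ a, ∑ i, ∑ j, G i j a := by
  have h : ∀ i, ∑ j, ∑ a, G i j a = ∑ a, ∑ j, G i j a := fun i => Finset.sum_comm
  simp only [h]
  exact Finset.sum_comm

theorem sum_swap_invPoly (r : ℕ) {k : ℕ} (w : Equiv.Perm (Fin k)) :
    ∑ a, ∑ b, invPoly r (w * Equiv.swap a b) = ∑ i, ∑ j, cutPoly r w i j := by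
  have h1 : ∀ a b, invPoly r (w * Equiv.swap a b) = ∑ f : Fin k → Fin r,
      if (∀ d, f (w d) = f (Equiv.swap a b d)) then ∏ d, X (f d) else 0 := by
    intro a b
    unfold invPoly
    refine Finset.sum_congr rfl fun f _ => if_congr ⟨fun h d => ?_, fun h d => ?_⟩ rfl rfl
    · have := h (Equiv.swap a b d)
      simpa using this
    · have := h (Equiv.swap a b d)
      simpa using this
  simp only [h1, cutPoly]
  refine Eq.trans ?_ (sum_rot3 _).symm
  refine Finset.sum_congr rfl fun a _ => ?_
  refine Eq.trans ?_ (sum_rot3 _).symm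
  rw [Finset.sum_comm]
  refine Finset.sum_congr rfl fun f _ => ?_
  simp only [Finset.sum_smul]
  refine Eq.trans ?_ (sum_rot3 _).symm
  refine Finset.sum_congr rfl fun b _ => ?_
  rw [Finset.sum_eq_single (f a), Finset.sum_eq_single (f b)]
  · simp
  · intro j _ hj
    rw [if_neg (fun h => hj h.2.1.symm), zero_smul]
  · simp
  · intro i _ hi
    refine Finset.sum_eq_zero fun j _ => ?_
    rw [if_neg (fun h => hi h.1.symm), zero_smul]
  · simp

theorem cutPoly_self (r : ℕ) {k : ℕ} (w : Equiv.Perm (Fin k)) (i : Fin r) :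
    cutPoly r w i i = X i * pderiv i (X i * pderiv i (invPoly r w)) := by
  have h : ∀ f : Fin k → Fin r, ∀ a b, f a = i → f b = i → ∀ d, f (Equiv.swap a b d) = f d := by
    intro f a b ha hb d
    rw [Equiv.swap_apply_def]
    split_ifs with h1 h2
    · rw [h1, ha, hb]
    · rw [h2, ha, hb]
    · rfl
  rw [theta_invPoly, map_sum, Finset.mul_sum, cutPoly]
  refine Finset.sum_congr rfl fun a _ => ?_
  rw [map_sum, Finset.mul_sum]
  refine Finset.sum_congr rfl fun f _ => ?_
  rw [map_zsmul, mul_smul_comm, theta_prod, smul_smul]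
  congr 1
  rw [Finset.mul_sum]
  refine Finset.sum_congr rfl fun b _ => ?_
  by_cases ha : f a = i
  · by_cases hb : f b = i
    · simp [ha, hb, h f a b ha hb]
    · simp [hb]
  · simp [ha]

/-- The exponent vector `i ↦ σ i`. -/
noncomputable def permExp {r : ℕ} (σ : Equiv.Perm (Fin r)) : Fin r →₀ ℕ :=
  Finsupp.equivFunOnFinite.symm (fun i => (σ i : ℕ))

theorem vandermondeMv_eq (r : ℕ) : ∃ ε : ℤ, vandermondeMv r
    = ε • ∑ σ : Equiv.Perm (Fin r), (Equiv.Perm.sign σ : ℤ) • monomial (permExp σ) (1 : ℤ) := by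
  have h1 : ∑ σ : Equiv.Perm (Fin r), (Equiv.Perm.sign σ : ℤ) • monomial (permExp σ) (1 : ℤ)
      = (Matrix.vandermonde (fun i : Fin r => (X i : MvPolynomial (Fin r) ℤ))).det := by
    rw [← Matrix.det_transpose, Matrix.det_apply]
    refine Finset.sum_congr rfl fun σ _ => ?_
    rw [Units.smul_def]
    congr 1
    rw [monomial_eq, Finsupp.prod_fintype _ _ (fun i => by simp)]
    simp [permExp, Matrix.vandermonde]
  rw [h1, Matrix.det_vandermonde, Finset.prod_sigma']
  refine ⟨∏ p ∈ Finset.univ.filter (fun p : Fin r × Fin r => p.1 < p.2), (-1), ?_⟩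
  unfold vandermondeMv
  have h2 : ∏ p ∈ Finset.univ.sigma (fun i : Fin r => Finset.Ioi i),
      ((X p.2 : MvPolynomial (Fin r) ℤ) - X p.1)
      = ∏ p ∈ Finset.univ.filter (fun p : Fin r × Fin r => p.1 < p.2), (X p.2 - X p.1) := by
    refine Finset.prod_bij' (fun p _ => (p.1, p.2)) (fun p _ => ⟨p.1, p.2⟩) ?_ ?_ ?_ ?_ ?_ <;> simp
  rw [h2, zsmul_eq_mul, Int.cast_prod, ← Finset.prod_mul_distrib]
  refine Finset.prod_congr rfl fun p _ => ?_
  push_cast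
  ring

theorem diagOp_vandermonde {r : ℕ} (g : (Fin r →₀ ℕ) → ℤ) (c : ℤ)
    (hg : ∀ σ : Equiv.Perm (Fin r), g (permExp σ) = c) :
    diagOp g (vandermondeMv r) = c • vandermondeMv r := by
  obtain ⟨ε, h⟩ := vandermondeMv_eq r
  rw [h, map_zsmul, map_sum, smul_comm, Finset.smul_sum (r := c)]
  congr 1
  refine Finset.sum_congr rfl fun σ _ => ?_
  rw [map_zsmul, diagOp_monomial, hg, smul_comm c, smul_monomial, smul_monomial, smul_monomial]
  rfl

theorem derivation_prod {R A ι : Type*} [CommRing R] [CommRing A] [Algebra R A] [DecidableEq ι]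
    (D : Derivation R A A) (T : Finset ι) (f : ι → A) :
    D (∏ q ∈ T, f q) = ∑ p ∈ T, (∏ q ∈ T.erase p, f q) * D (f p) := by
  induction T using Finset.induction_on with
  | empty => simp
  | insert a T ha ih =>
    rw [Finset.prod_insert ha, Derivation.leibniz, ih, Finset.sum_insert ha,
      Finset.erase_insert ha, smul_eq_mul, smul_eq_mul, Finset.mul_sum, add_comm]
    congr 1
    refine Finset.sum_congr rfl fun p hp => ?_
    have hpa : p ≠ a := fun h => ha (h ▸ hp)
    rw [Finset.erase_insert_of_ne hpa.symm,
      Finset.prod_insert (fun h => ha (Finset.mem_of_mem_erase h)), mul_assoc]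

theorem vandermonde_deriv (r : ℕ) : ∃ B : Fin r → Fin r → MvPolynomial (Fin r) ℤ,
    (∀ i j, i ≠ j → vandermondeMv r = (X i - X j) * B i j) ∧ (∀ i j, B j i = - B i j) ∧
    (∀ i, B i i = 0) ∧
    (∀ i, pderiv i (vandermondeMv r) = ∑ j, B i j) := by
  set S := Finset.univ.filter (fun p : Fin r × Fin r => p.1 < p.2) with hS
  let E : Fin r × Fin r → MvPolynomial (Fin r) ℤ := fun p => ∏ q ∈ S.erase p, (X q.1 - X q.2)
  let B : Fin r → Fin r → MvPolynomial (Fin r) ℤ :=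
    fun i j => if i < j then E (i, j) else if j < i then - E (j, i) else 0
  have hE : ∀ p ∈ S, vandermondeMv r = (X p.1 - X p.2) * E p := fun p hp =>
    (Finset.mul_prod_erase S (fun q => (X q.1 - X q.2 : MvPolynomial (Fin r) ℤ)) hp).symm
  refine ⟨B, ?_, ?_, ?_, ?_⟩
  · intro i j hij
    rcases lt_or_gt_of_ne hij with h | h
    · simp only [B, if_pos h]
      exact hE (i, j) (by simp [hS, h])
    · simp only [B, if_pos h, if_neg (not_lt_of_gt h)]
      rw [hE (j, i) (by simp [hS, h])]
      ring
  · intro i j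
    rcases lt_trichotomy i j with h | h | h
    · simp only [B, if_pos h, if_neg (not_lt_of_gt h)]
    · subst h; simp [B]
    · simp only [B, if_pos h, if_neg (not_lt_of_gt h), neg_neg]
  · intro i
    simp [B]
  · intro i
    have h1 : pderiv i (vandermondeMv r) = ∑ p ∈ S, E p * pderiv i (X p.1 - X p.2) := by
      exact derivation_prod (pderiv i) S _
    rw [h1, hS, Finset.sum_filter, ← Finset.univ_product_univ, Finset.sum_product]
    simp only [map_sub, pderiv_X]
    have h2 : ∀ a b : Fin r, (if a < b then E (a, b) * ((Pi.single i 1 : Fin r → MvPolynomial (Fin r) ℤ) a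
        - (Pi.single i 1 : Fin r → MvPolynomial (Fin r) ℤ) b) else 0)
        = (if a = i then (if a < b then E (a, b) else 0) else 0)
          + (if b = i then (if a < b then - E (a, b) else 0) else 0) := by
      intro a b
      simp only [Pi.single_apply]
      split_ifs <;> simp
    simp only [h2, Finset.sum_add_distrib]
    rw [Finset.sum_comm]
    simp only [Finset.sum_ite_eq', Finset.mem_univ, if_true]
    rw [← Finset.sum_add_distrib]
    refine Finset.sum_congr rfl fun j _ => ?_
    rcases lt_trichotomy i j with h | h | h
    · simp only [B, if_pos h, if_neg (not_lt_of_gt h), add_zero]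
    · subst h; simp [B]
    · simp only [B, if_pos h, if_neg (not_lt_of_gt h), zero_add]

/-- The eigenvalue of the sum of transpositions. -/
noncomputable def tauFn {r : ℕ} (m : Fin r →₀ ℕ) : ℤ :=
  ∑ i, ((m i : ℤ) * (m i : ℤ) - 2 * ((r : ℤ) - 1) * (m i : ℤ))
    - ∑ i : Fin r, (((i : ℕ) : ℤ) * ((i : ℕ) : ℤ) - 2 * ((r : ℤ) - 1) * ((i : ℕ) : ℤ))

theorem tauFn_permExp {r : ℕ} (σ : Equiv.Perm (Fin r)) : tauFn (permExp σ) = 0 := by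
  unfold tauFn permExp
  rw [sub_eq_zero]
  exact Equiv.sum_comp σ
    (fun i : Fin r => (((i : ℕ) : ℤ) * ((i : ℕ) : ℤ) - 2 * ((r : ℤ) - 1) * ((i : ℕ) : ℤ)))

theorem diagOp_tau {r : ℕ} (F : MvPolynomial (Fin r) ℤ) : diagOp tauFn F
    = ∑ i, (X i * pderiv i (X i * pderiv i F) - (2 * ((r : MvPolynomial (Fin r) ℤ) - 1)) * (X i * pderiv i F))
    - (∑ i : Fin r, (((i : ℕ) : ℤ) * ((i : ℕ) : ℤ) - 2 * ((r : ℤ) - 1) * ((i : ℕ) : ℤ))) • F := by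
  ext m
  have e : ∀ i, coeff m ((2 * ((r : MvPolynomial (Fin r) ℤ) - 1)) * (X i * pderiv i F))
      = 2 * ((r : ℤ) - 1) * (m i * coeff m F) := by
    intro i
    have : (2 * ((r : MvPolynomial (Fin r) ℤ) - 1)) = C (2 * ((r : ℤ) - 1)) := by simp
    rw [this, coeff_C_mul, ← diagOp_theta, coeff_diagOp]
  rw [coeff_diagOp, coeff_sub, coeff_smul, coeff_sum]
  simp only [coeff_sub, e]
  simp only [← diagOp_theta, coeff_diagOp, tauFn, sub_mul, Finset.sum_mul, smul_eq_mul]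
  congr 1
  refine Finset.sum_congr rfl fun i _ => ?_
  ring

theorem theta_mul {r : ℕ} (i : Fin r) (F G : MvPolynomial (Fin r) ℤ) :
    X i * pderiv i (F * G) = F * (X i * pderiv i G) + G * (X i * pderiv i F) := by
  rw [Derivation.leibniz, smul_eq_mul, smul_eq_mul]; ring

theorem transp_sum (r : ℕ) {k : ℕ} (w : Equiv.Perm (Fin k)) :
    vandermondeMv r * ∑ a, ∑ b, invPoly r (w * Equiv.swap a b)
      = diagOp tauFn (vandermondeMv r * invPoly r w) := by
  obtain ⟨B, hB, hBa, hB0, hBd⟩ := vandermonde_deriv r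
  have hV0 : diagOp tauFn (vandermondeMv r) = 0 := by
    rw [diagOp_vandermonde _ 0 tauFn_permExp, zero_smul]
  set V := vandermondeMv r with hV
  rw [sum_swap_invPoly, diagOp_tau]
  rw [diagOp_tau] at hV0
  set c := (∑ i : Fin r, (((i : ℕ) : ℤ) * ((i : ℕ) : ℤ) - 2 * ((r : ℤ) - 1) * ((i : ℕ) : ℤ))) with hc
  set P := invPoly r w with hP
  have h1 : ∀ i, X i * pderiv i (X i * pderiv i (V * P)) = P * (X i * pderiv i (X i * pderiv i V))
      + 2 * (X i * pderiv i V) * (X i * pderiv i P) + V * (X i * pderiv i (X i * pderiv i P)) := by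
    intro i
    rw [theta_mul i V P, map_add, mul_add, theta_mul i V, theta_mul i P]
    ring
  have hcut : ∀ i j, V * cutPoly r w i j = B i j * (X j * (X i * pderiv i P)) - B i j * (X i * (X j * pderiv j P))
      + (if i = j then V * (X i * pderiv i (X i * pderiv i P)) else 0) := by
    intro i j
    by_cases h : i = j
    · subst h
      rw [cutPoly_self, hB0, ← hP, if_pos rfl]; ring
    · rw [if_neg h]
      have := cutPoly_eq r w i j h
      rw [hB i j h]
      linear_combination (B i j) * this
  have hsym : ∑ i, ∑ j, B i j * (X i * (X j * pderiv j P)) = - ∑ i, ∑ j, B i j * (X j * (X i * pderiv i P)) := by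
    rw [Finset.sum_comm, ← Finset.sum_neg_distrib]
    refine Finset.sum_congr rfl fun i _ => ?_
    rw [← Finset.sum_neg_distrib]
    refine Finset.sum_congr rfl fun j _ => ?_
    rw [hBa i j]; ring
  have hL : V * ∑ i, ∑ j, cutPoly r w i j = ∑ i, (2 * ∑ j, B i j * (X j * (X i * pderiv i P))
      + V * (X i * pderiv i (X i * pderiv i P))) := by
    rw [Finset.mul_sum]
    simp only [Finset.mul_sum, hcut]
    simp only [Finset.sum_add_distrib, Finset.sum_sub_distrib]
    rw [hsym]
    simp only [Finset.sum_ite_eq, Finset.mem_univ, if_true, ← Finset.mul_sum]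
    ring
  have hrow : ∀ i, ∑ j, B i j * (X j * (X i * pderiv i P))
      = (X i * pderiv i V) * (X i * pderiv i P) - ((r : MvPolynomial (Fin r) ℤ) - 1) * V * (X i * pderiv i P) := by
    intro i
    have h2 : ∑ j, B i j * X j = X i * pderiv i V - ((r : MvPolynomial (Fin r) ℤ) - 1) * V := by
      have h3 : ∀ j, B i j * X j = X i * B i j - V + (if j = i then V else 0) := by
        intro j
        by_cases h : j = i
        · subst h; rw [hB0]; simp
        · rw [if_neg h]
          have := hB i j (Ne.symm h)
          linear_combination this
      simp only [h3, Finset.sum_add_distrib, Finset.sum_sub_distrib]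
      rw [hBd, Finset.mul_sum]
      simp
      ring
    rw [← sub_mul, ← h2, Finset.sum_mul]
    refine Finset.sum_congr rfl fun j _ => ?_
    ring
  have h4 : ∀ i, X i * pderiv i (X i * pderiv i (V * P)) - (2 * ((r : MvPolynomial (Fin r) ℤ) - 1)) * (X i * pderiv i (V * P))
      = P * (X i * pderiv i (X i * pderiv i V) - (2 * ((r : MvPolynomial (Fin r) ℤ) - 1)) * (X i * pderiv i V))
      + (2 * ∑ j, B i j * (X j * (X i * pderiv i P)) + V * (X i * pderiv i (X i * pderiv i P))) := by
    intro i
    rw [h1, hrow, theta_mul i V P]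
    ring
  simp only [h4]
  rw [Finset.sum_add_distrib, ← Finset.mul_sum, ← hL]
  have h5 : c • (V * P) = P * (c • V) := by rw [mul_comm V, mul_smul_comm]
  rw [h5]
  linear_combination (-P) * hV0

/-- The Frobenius product `V * p_w`. -/
noncomputable def frobPoly (r : ℕ) {k : ℕ} (w : Equiv.Perm (Fin k)) : MvPolynomial (Fin r) ℤ :=
  vandermondeMv r * invPoly r w

/-- The raising operator `F ↦ ∑ i, x_i * diagOp (g i) F`. -/
noncomputable def raiseOp {r : ℕ} (g : Fin r → (Fin r →₀ ℕ) → ℤ) :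
    MvPolynomial (Fin r) ℤ →ₗ[ℤ] MvPolynomial (Fin r) ℤ :=
  ∑ i, (LinearMap.mulLeft ℤ (X i)) ∘ₗ diagOp (g i)

theorem raiseOp_apply {r : ℕ} (g : Fin r → (Fin r →₀ ℕ) → ℤ) (F : MvPolynomial (Fin r) ℤ) :
    raiseOp g F = ∑ i, X i * diagOp (g i) F := by
  simp [raiseOp, LinearMap.sum_apply]

theorem diagOp_raiseOp {r : ℕ} (h : (Fin r →₀ ℕ) → ℤ) (g : Fin r → (Fin r →₀ ℕ) → ℤ)
    (F : MvPolynomial (Fin r) ℤ) :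
    diagOp h (raiseOp g F) = raiseOp (fun i m => h (m + Finsupp.single i 1) * g i m) F := by
  rw [raiseOp_apply, raiseOp_apply, map_sum]
  refine Finset.sum_congr rfl fun i _ => ?_
  rw [diagOp_X_mul, diagOp_diagOp]

theorem raiseOp_diagOp {r : ℕ} (h : (Fin r →₀ ℕ) → ℤ) (g : Fin r → (Fin r →₀ ℕ) → ℤ)
    (F : MvPolynomial (Fin r) ℤ) :
    raiseOp g (diagOp h F) = raiseOp (fun i m => g i m * h m) F := by
  rw [raiseOp_apply, raiseOp_apply]
  refine Finset.sum_congr rfl fun i _ => ?_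
  rw [diagOp_diagOp]

theorem diagOp_add_fn {r : ℕ} (g h : (Fin r →₀ ℕ) → ℤ) (F : MvPolynomial (Fin r) ℤ) :
    diagOp g F + diagOp h F = diagOp (fun m => g m + h m) F := by
  ext m
  rw [coeff_add, coeff_diagOp, coeff_diagOp, coeff_diagOp, add_mul]

theorem diagOp_smul_fn {r : ℕ} (c : ℤ) (h : (Fin r →₀ ℕ) → ℤ) (F : MvPolynomial (Fin r) ℤ) :
    c • diagOp h F = diagOp (fun m => c * h m) F := by
  ext m
  rw [coeff_smul, coeff_diagOp, coeff_diagOp, smul_eq_mul, mul_assoc]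

theorem raiseOp_add_fn {r : ℕ} (g h : Fin r → (Fin r →₀ ℕ) → ℤ) (F : MvPolynomial (Fin r) ℤ) :
    raiseOp g F + raiseOp h F = raiseOp (fun i m => g i m + h i m) F := by
  simp only [raiseOp_apply, ← Finset.sum_add_distrib, ← mul_add, diagOp_add_fn]

theorem raiseOp_smul_fn {r : ℕ} (c : ℤ) (h : Fin r → (Fin r →₀ ℕ) → ℤ)
    (F : MvPolynomial (Fin r) ℤ) :
    c • raiseOp h F = raiseOp (fun i m => c * h i m) F := by
  simp only [raiseOp_apply, Finset.smul_sum, ← diagOp_smul_fn, mul_smul_comm]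

theorem diagOp_one_fn {r : ℕ} (F : MvPolynomial (Fin r) ℤ) : diagOp (fun _ => 1) F = F := by
  ext m
  rw [coeff_diagOp, one_mul]

theorem frob_zero (r : ℕ) {k : ℕ} (w : Equiv.Perm (Fin k)) :
    frobPoly r (iotaPerm w) = raiseOp (fun _ _ => 1) (frobPoly r w) := by
  rw [raiseOp_apply]
  simp only [diagOp_one_fn]
  rw [frobPoly, invPoly_iota, frobPoly, ← Finset.sum_mul]
  ring

theorem sum_swap_succ {M : Type*} [AddCommGroup M] {k : ℕ} (g : Equiv.Perm (Fin (k + 1)))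
    (G : Equiv.Perm (Fin (k + 1)) → M) :
    ∑ c, ∑ d, G (g * Equiv.swap c d) = G g + (2 : ℤ) • (∑ a, G (g * swz a))
      + ∑ a, ∑ b, G (g * iotaPerm (Equiv.swap a b)) := by
  have h1 : ∀ a : Fin k, Equiv.swap 0 a.succ = swz a := fun a => rfl
  have h2 : ∀ a : Fin k, Equiv.swap a.succ 0 = swz a := fun a => Equiv.swap_comm _ _
  simp only [Fin.sum_univ_succ, Finset.sum_add_distrib, Equiv.swap_self, iotaPerm_swap, h1, h2]
  have h3 : g * (Equiv.refl _) = g := mul_one g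
  rw [h3, two_smul]
  abel

theorem frob_transp (r : ℕ) {k : ℕ} (w : Equiv.Perm (Fin k)) :
    ∑ a, ∑ b, frobPoly r (w * Equiv.swap a b) = diagOp tauFn (frobPoly r w) := by
  rw [frobPoly, ← transp_sum]
  simp only [frobPoly, Finset.mul_sum]

theorem tauFn_step {r : ℕ} (m : Fin r →₀ ℕ) (i : Fin r) :
    tauFn (m + Finsupp.single i 1) = tauFn m + (2 * ((m i : ℤ) - r + 1) + 1) := by
  unfold tauFn
  have h : ∀ j : Fin r, (((m + Finsupp.single i 1 : Fin r →₀ ℕ) j : ℕ) : ℤ) * (((m + Finsupp.single i 1 : Fin r →₀ ℕ) j : ℕ) : ℤ)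
      - 2 * ((r : ℤ) - 1) * (((m + Finsupp.single i 1 : Fin r →₀ ℕ) j : ℕ) : ℤ)
      = ((m j : ℤ) * (m j : ℤ) - 2 * ((r : ℤ) - 1) * (m j : ℤ))
        + (if j = i then (2 * ((m i : ℤ) - r + 1) + 1) else 0) := by
    intro j
    by_cases hj : j = i
    · subst hj
      simp
      ring
    · simp [hj, Finsupp.single_apply, Ne.symm hj]
  simp only [h, Finset.sum_add_distrib, Finset.sum_ite_eq', Finset.mem_univ, if_true]
  ring

/-- shifted exponent -/
noncomputable def shiftExp {r : ℕ} (n : ℕ) (i : Fin r) (m : Fin r →₀ ℕ) : ℤ :=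
  ((m i : ℤ) - r + 1) ^ n

theorem two_cancel {r : ℕ} {F G : MvPolynomial (Fin r) ℤ} (h : (2 : ℤ) • F = (2 : ℤ) • G) :
    F = G := by
  ext m
  have := congrArg (coeff m) h
  rw [coeff_smul, coeff_smul, smul_eq_mul, smul_eq_mul] at this
  linarith

theorem frob_one (r : ℕ) {k : ℕ} (w : Equiv.Perm (Fin k)) :
    ∑ a, frobPoly r (iotaPerm w * swz a) = raiseOp (shiftExp 1) (frobPoly r w) := by
  have h1 := frob_transp r (iotaPerm w)
  rw [sum_swap_succ, frob_zero, diagOp_raiseOp] at h1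
  simp only [← iotaPerm_mul, frob_zero] at h1
  simp only [← map_sum, frob_transp] at h1
  rw [raiseOp_diagOp] at h1
  apply two_cancel
  have h2 : (2 : ℤ) • ∑ a, frobPoly r (iotaPerm w * swz a)
      = raiseOp (fun i m => tauFn (m + Finsupp.single i 1) * 1) (frobPoly r w)
        + (-1 : ℤ) • raiseOp (fun i m => 1) (frobPoly r w)
        + (-1 : ℤ) • raiseOp (fun i m => 1 * tauFn m) (frobPoly r w) := by
    rw [← h1]; simp only [neg_smul, one_smul]; abel
  rw [h2, raiseOp_smul_fn, raiseOp_smul_fn, raiseOp_smul_fn, raiseOp_add_fn, raiseOp_add_fn]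
  congr 2
  funext i m
  rw [tauFn_step, shiftExp]
  ring

theorem frob_two (r : ℕ) {k : ℕ} (w : Equiv.Perm (Fin k)) :
    ∑ a, ∑ b, frobPoly r (iotaPerm w * swz a * swz b) = raiseOp (shiftExp 2) (frobPoly r w) := by
  have h0 : ∑ a, ∑ c, ∑ d, frobPoly r (iotaPerm w * swz a * Equiv.swap c d)
      = diagOp tauFn (raiseOp (shiftExp 1) (frobPoly r w)) := by
    rw [← frob_one, map_sum]
    refine Finset.sum_congr rfl fun a _ => frob_transp r _
  have h3 : ∑ a, ∑ b, ∑ c, frobPoly r (iotaPerm w * swz a * iotaPerm (Equiv.swap b c))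
      = raiseOp (shiftExp 1) (diagOp tauFn (frobPoly r w)) := by
    rw [← sum_rot3 (fun b c a => frobPoly r (iotaPerm w * swz a * iotaPerm (Equiv.swap b c))),
      ← frob_transp, map_sum]
    refine Finset.sum_congr rfl fun b _ => ?_
    rw [map_sum]
    refine Finset.sum_congr rfl fun c _ => ?_
    rw [← frob_one, iotaPerm_mul]
    have := sum_swz_comm (Equiv.swap b c) (fun g => frobPoly r (iotaPerm w * g))
    simp only [mul_assoc]
    exact this
  simp only [sum_swap_succ, Finset.sum_add_distrib] at h0
  rw [h3, frob_one, ← Finset.smul_sum, diagOp_raiseOp, raiseOp_diagOp] at h0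
  apply two_cancel
  have h2 : (2 : ℤ) • ∑ a, ∑ b, frobPoly r (iotaPerm w * swz a * swz b)
      = raiseOp (fun i m => tauFn (m + Finsupp.single i 1) * shiftExp 1 i m) (frobPoly r w)
        + (-1 : ℤ) • raiseOp (shiftExp 1) (frobPoly r w)
        + (-1 : ℤ) • raiseOp (fun i m => shiftExp 1 i m * tauFn m) (frobPoly r w) := by
    rw [← h0]; simp only [neg_smul, one_smul]; abel
  rw [h2, raiseOp_smul_fn, raiseOp_smul_fn, raiseOp_smul_fn, raiseOp_add_fn, raiseOp_add_fn]
  congr 2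
  funext i m
  simp only [tauFn_step, shiftExp]
  ring

/-- The shifted rising factorial product. -/
noncomputable def gamFn {r : ℕ} (t : ℤ) (m : Fin r →₀ ℕ) : ℤ :=
  ∏ i, ∏ s ∈ Finset.range (m i), (t - r + 1 + s)

/-- The value of `gamFn` at the staircase. -/
noncomputable def gamDelta (r : ℕ) (t : ℤ) : ℤ :=
  ∏ i : Fin r, ∏ s ∈ Finset.range (i : ℕ), (t - r + 1 + s)

theorem gamFn_permExp {r : ℕ} (t : ℤ) (σ : Equiv.Perm (Fin r)) :
    gamFn t (permExp σ) = gamDelta r t := by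
  unfold gamFn gamDelta permExp
  exact Equiv.prod_comp σ (fun i : Fin r => ∏ s ∈ Finset.range (i : ℕ), (t - r + 1 + s))

theorem gamFn_step {r : ℕ} (t : ℤ) (m : Fin r →₀ ℕ) (i : Fin r) :
    gamFn t (m + Finsupp.single i 1) = (t + shiftExp 1 i m) * gamFn t m := by
  unfold gamFn
  rw [← Finset.mul_prod_erase _ _ (Finset.mem_univ i),
    ← Finset.mul_prod_erase _ (fun j => ∏ s ∈ Finset.range (m j), (t - r + 1 + s)) (Finset.mem_univ i)]
  have h : ∏ x ∈ Finset.univ.erase i, ∏ s ∈ Finset.range ((m + Finsupp.single i 1 : Fin r →₀ ℕ) x),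
      (t - r + 1 + (s : ℤ)) = ∏ x ∈ Finset.univ.erase i, ∏ s ∈ Finset.range (m x), (t - r + 1 + (s : ℤ)) := by
    refine Finset.prod_congr rfl fun j hj => ?_
    have hji : j ≠ i := (Finset.mem_erase.mp hj).1
    simp [Finsupp.single_apply, hji.symm]
  rw [h]
  have h2 : (m + Finsupp.single i 1 : Fin r →₀ ℕ) i = m i + 1 := by simp
  rw [h2, Finset.prod_range_succ, shiftExp]
  ring

theorem frobPoly_conj (r : ℕ) {k : ℕ} (g w : Equiv.Perm (Fin k)) :
    frobPoly r (g * w * g⁻¹) = frobPoly r w := by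
  rw [frobPoly, invPoly_conj, frobPoly]

theorem frob_conj_sum (r : ℕ) (t : ℤ) {k : ℕ} (g w : Equiv.Perm (Fin k)) :
    ∑ u, t ^ cyclesCount u • frobPoly r (g * w * g⁻¹ * u)
      = ∑ u, t ^ cyclesCount u • frobPoly r (w * u) := by
  rw [← Equiv.sum_comp (MulAut.conj g).toEquiv]
  refine Finset.sum_congr rfl fun u _ => ?_
  change t ^ cyclesCount (g * u * g⁻¹) • frobPoly r (g * w * g⁻¹ * (g * u * g⁻¹)) = _
  rw [cyclesCount_conj, ← frobPoly_conj r g (w * u)]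
  congr 2
  group

theorem frob_central (r : ℕ) (t : ℤ) : ∀ (k : ℕ) (w : Equiv.Perm (Fin k)),
    gamDelta r t • ∑ u, t ^ cyclesCount u • frobPoly r (w * u) = diagOp (gamFn t) (frobPoly r w) := by
  intro k
  induction k with
  | zero =>
    intro w
    have h : ∀ v : Equiv.Perm (Fin 0), frobPoly r v = vandermondeMv r := by
      intro v
      simp [frobPoly, invPoly]
    have hc : ∀ v : Equiv.Perm (Fin 0), cyclesCount v = 0 := by
      intro v
      simp [cyclesCount, parts_partition, Subsingleton.elim v 1]
    simp only [h, hc]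
    rw [diagOp_vandermonde _ _ (gamFn_permExp t)]
    simp
  | succ k ih =>
    intro w
    rw [← sub_eq_zero]
    refine class_vanish (M := MvPolynomial (Fin r) ℤ) ?_ (fun w => gamDelta r t • ∑ u, t ^ cyclesCount u • frobPoly r (w * u)
      - diagOp (gamFn t) (frobPoly r w)) ?_ ?_ ?_ w
    · intro n x hn hx
      exact (smul_eq_zero.mp hx).resolve_left hn
    · intro g w
      simp only [frob_conj_sum, frobPoly_conj]
    · intro e
      have h1 : ∀ e' : Equiv.Perm (Fin k), t • frobPoly r (iotaPerm e * iotaPerm e')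
          + ∑ a, frobPoly r (iotaPerm e * (iotaPerm e' * swz a))
          = raiseOp (fun i m => t * 1 + shiftExp 1 i m) (frobPoly r (e * e')) := by
        intro e'
        simp only [← mul_assoc, ← iotaPerm_mul]
        rw [frob_zero, frob_one, raiseOp_smul_fn, raiseOp_add_fn]
      simp only [sum_cycles_succ, h1, ← map_zsmul, ← map_sum]
      rw [ih, frob_zero, diagOp_raiseOp, raiseOp_diagOp, sub_eq_zero]
      congr 2
      funext i m
      rw [gamFn_step]
      ring
    · intro e
      have h1 : ∀ e' : Equiv.Perm (Fin k), ∑ c, (t • frobPoly r (iotaPerm e * swz c * iotaPerm e')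
          + ∑ a, frobPoly r (iotaPerm e * swz c * (iotaPerm e' * swz a)))
          = raiseOp (fun i m => t * shiftExp 1 i m + shiftExp 2 i m) (frobPoly r (e * e')) := by
        intro e'
        rw [Finset.sum_add_distrib, ← Finset.smul_sum]
        have s1 := sum_swz_comm e' (fun g => frobPoly r (iotaPerm e * g))
        have s2 := sum_swz_comm e' (fun g => ∑ a, frobPoly r (iotaPerm e * g * swz a))
        simp only [← mul_assoc, ← iotaPerm_mul] at s1 s2 ⊢
        rw [s1, s2, frob_one, frob_two, raiseOp_smul_fn, raiseOp_add_fn]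
      simp only [sum_cycles_succ]
      rw [Finset.sum_sub_distrib, ← Finset.smul_sum, Finset.sum_comm]
      simp only [← Finset.smul_sum, h1]
      simp only [← map_zsmul, ← map_sum]
      rw [ih, frob_one, diagOp_raiseOp, raiseOp_diagOp, sub_eq_zero]
      congr 2
      funext i m
      simp only [gamFn_step, shiftExp]
      ring

/-- The exponent `λ + δ`. -/
noncomputable def lamDelta (L : List ℕ) : Fin L.length →₀ ℕ :=
  Finsupp.equivFunOnFinite.symm (fun i : Fin L.length => L.get i + (L.length - 1 - (i : ℕ)))

theorem symChar_eq_coeff (L : List ℕ) {k : ℕ} (w : Equiv.Perm (Fin k)) :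
    symChar L w.partition.parts = coeff (lamDelta L) (frobPoly L.length w) := by
  rw [symChar, frobPoly, invPoly_eq]
  rfl

/-- The content product `∏ (t + c(u))`. -/
def contProd (L : List ℕ) (t : ℤ) : ℤ :=
  ∏ i ∈ Finset.range L.length, ∏ j ∈ Finset.range (L.getD i 0), (t + ((j : ℤ) - (i : ℤ)))

theorem gamFn_lamDelta (L : List ℕ) (t : ℤ) :
    gamFn t (lamDelta L) = gamDelta L.length t * contProd L t := by
  have h1 : contProd L t = ∏ i : Fin L.length, ∏ j ∈ Finset.range (L.get i), (t + ((j : ℤ) - ((i : ℕ) : ℤ))) := by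
    unfold contProd
    rw [Finset.prod_range]
    refine Finset.prod_congr rfl fun i _ => ?_
    simp
  have h2 : gamDelta L.length t = ∏ i : Fin L.length,
      ∏ s ∈ Finset.range (L.length - 1 - (i : ℕ)), (t - L.length + 1 + (s : ℤ)) := by
    unfold gamDelta
    rw [← Equiv.prod_comp Fin.revPerm]
    refine Finset.prod_congr rfl fun i _ => ?_
    have : ((Fin.revPerm i : Fin L.length) : ℕ) = L.length - 1 - (i : ℕ) := by
      simp [Fin.val_rev]; omega
    rw [this]
  rw [h1, h2, ← Finset.prod_mul_distrib]
  unfold gamFn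
  refine Finset.prod_congr rfl fun i _ => ?_
  have : lamDelta L i = (L.length - 1 - (i : ℕ)) + L.get i := by
    simp [lamDelta]; omega
  rw [this, Finset.prod_range_add]
  congr 1
  refine Finset.prod_congr rfl fun j _ => ?_
  have hi := i.2
  have : ((L.length - 1 - (i : ℕ) : ℕ) : ℤ) = L.length - 1 - (i : ℕ) := by omega
  push_cast
  rw [this]
  ring

theorem gamDelta_pos (r : ℕ) (t : ℤ) (h : (r : ℤ) ≤ t) : 0 < gamDelta r t := by
  unfold gamDelta
  refine Finset.prod_pos fun i _ => Finset.prod_pos fun s _ => ?_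
  have : (0 : ℤ) ≤ (s : ℤ) := Int.natCast_nonneg s
  linarith

theorem char_central_large (L : List ℕ) {k : ℕ} (w : Equiv.Perm (Fin k)) (t : ℤ)
    (ht : (L.length : ℤ) ≤ t) :
    ∑ u : Equiv.Perm (Fin k), t ^ cyclesCount u * symChar L (w * u).partition.parts
      = contProd L t * symChar L w.partition.parts := by
  have h := congrArg (coeff (lamDelta L)) (frob_central L.length t k w)
  rw [coeff_diagOp, coeff_smul, coeff_sum, gamFn_lamDelta, ← symChar_eq_coeff, smul_eq_mul,
    mul_assoc] at h
  have h2 := mul_left_cancel₀ (gamDelta_pos L.length t ht).ne' h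
  rw [← h2]
  refine Finset.sum_congr rfl fun u _ => ?_
  rw [coeff_smul, smul_eq_mul, symChar_eq_coeff]

theorem char_central (L : List ℕ) {k : ℕ} (w : Equiv.Perm (Fin k)) (t : ℤ) :
    ∑ u : Equiv.Perm (Fin k), t ^ cyclesCount u * symChar L (w * u).partition.parts
      = contProd L t * symChar L w.partition.parts := by
  let p : Polynomial ℤ := ∑ u : Equiv.Perm (Fin k), Polynomial.X ^ cyclesCount u
    * Polynomial.C (symChar L (w * u).partition.parts)
  let q : Polynomial ℤ := (∏ i ∈ Finset.range L.length, ∏ j ∈ Finset.range (L.getD i 0),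
    (Polynomial.X + Polynomial.C ((j : ℤ) - (i : ℤ)))) * Polynomial.C (symChar L w.partition.parts)
  have hp : ∀ s, p.eval s = ∑ u : Equiv.Perm (Fin k), s ^ cyclesCount u
      * symChar L (w * u).partition.parts := by
    intro s
    simp [p, Polynomial.eval_finsetSum]
  have hq : ∀ s, q.eval s = contProd L s * symChar L w.partition.parts := by
    intro s
    simp [q, contProd, Polynomial.eval_prod]
  have : p = q := by
    apply Polynomial.eq_of_infinite_eval_eq
    refine Set.Infinite.mono (s := Set.Ici (L.length : ℤ)) ?_ (Set.Ici_infinite _)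
    intro s hs
    change p.eval s = q.eval s
    rw [hp, hq, char_central_large L w s hs]
  rw [← hp, this, hq]

theorem conjPart_spec (L : List ℕ) (hL : Antitone (fun a => L.getD a 0)) (a j : ℕ) :
    a < conjPart L j ↔ j < L.getD a 0 := by
  have hc : conjPart L j = ((Finset.range L.length).filter (fun i => j < L.getD i 0)).card := by
    unfold conjPart
    rw [← Multiset.coe_card, ← Multiset.filter_coe]
    rfl
  rw [hc]
  constructor
  · intro h
    by_contra hn
    have hsub : (Finset.range L.length).filter (fun i => j < L.getD i 0) ⊆ Finset.range a := by
      intro i hi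
      rw [Finset.mem_filter] at hi
      rw [Finset.mem_range]
      by_contra hia
      have := hL (not_lt.mp hia)
      simp only at this
      omega
    have := Finset.card_le_card hsub
    rw [Finset.card_range] at this
    omega
  · intro h
    have hsub : Finset.range (a + 1) ⊆ (Finset.range L.length).filter (fun i => j < L.getD i 0) := by
      intro i hi
      rw [Finset.mem_range] at hi
      have := hL (Nat.lt_succ_iff.mp hi)
      simp only at this
      rw [Finset.mem_filter, Finset.mem_range]
      refine ⟨?_, by omega⟩
      by_contra hlen
      rw [List.getD_eq_default _ _ (not_lt.mp hlen)] at this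
      omega
    have := Finset.card_le_card hsub
    rw [Finset.card_range] at this
    omega

/-- The shifted parts. -/
def shiftPart (L : List ℕ) (r a : ℕ) : ℕ := L.getD a 0 + (r - 1 - a)

theorem conjPart_le (L : List ℕ) (j : ℕ) : conjPart L j ≤ L.length := by
  unfold conjPart
  exact (List.length_filter_le _ _).trans (by simp)

theorem hook_row (L : List ℕ) (hL : Antitone (fun a => L.getD a 0)) (r : ℕ) (hr : L.length ≤ r)
    (i : ℕ) (hi : i < r) :
    (∏ a ∈ Finset.Ioo i r, ((shiftPart L r i : ℤ) - shiftPart L r a))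
      * ∏ j ∈ Finset.range (L.getD i 0), hookLen L i j = ((shiftPart L r i).factorial : ℤ) := by
  set l := shiftPart L r with hl
  let n : ℕ → ℕ := fun j => j + r - conjPart L j
  have hcr : ∀ j, conjPart L j ≤ r := fun j => (conjPart_le L j).trans hr
  have spec := conjPart_spec L hL
  have hlanti : ∀ a b, a < b → b < r → l b < l a := by
    intro a b hab hb
    have := hL hab.le
    simp only at this
    simp only [hl, shiftPart]
    omega
  have hconj_anti : ∀ j j', j ≤ j' → conjPart L j' ≤ conjPart L j := by
    intro j j' hj
    by_contra hlt
    have h1 := (spec (conjPart L j) j').mp (not_le.mp hlt)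
    have h2 := (spec (conjPart L j) j).mpr (by omega)
    omega
  have hninj : ∀ j j', j < j' → n j < n j' := by
    intro j j' hj
    have := hconj_anti j j' hj.le
    have := hcr j
    simp only [n]
    omega
  have hA : Set.InjOn l (Finset.Ioo i r) := by
    intro a ha b hb hab
    simp only [Finset.coe_Ioo, Set.mem_Ioo] at ha hb
    rcases lt_trichotomy a b with h | h | h
    · have := hlanti a b h hb.2; omega
    · exact h
    · have := hlanti b a h ha.2; omega
  have hB : Set.InjOn n (Finset.range (L.getD i 0)) := by
    intro a _ b _ hab
    rcases lt_trichotomy a b with h | h | h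
    · have := hninj a b h; omega
    · exact h
    · have := hninj b a h; omega
  have hdisj : Disjoint ((Finset.Ioo i r).image l) ((Finset.range (L.getD i 0)).image n) := by
    rw [Finset.disjoint_left]
    intro x hx hx'
    rw [Finset.mem_image] at hx hx'
    obtain ⟨a, ha, rfl⟩ := hx
    obtain ⟨j, hj, hja⟩ := hx'
    rw [Finset.mem_Ioo] at ha
    have h1 := spec a j
    have h2 := hcr j
    simp only [n, hl, shiftPart] at hja
    by_cases h : j < L.getD a 0
    · have := h1.mpr h
      omega
    · have : ¬ a < conjPart L j := fun h' => h (h1.mp h')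
      omega
  have hnlt : ∀ j, j < L.getD i 0 → n j < l i := by
    intro j hj
    have := (spec i j).mpr hj
    have h2 := hcr j
    simp only [n, hl, shiftPart]
    omega
  have hunion : (Finset.Ioo i r).image l ∪ (Finset.range (L.getD i 0)).image n = Finset.range (l i) := by
    apply Finset.eq_of_subset_of_card_le
    · intro x hx
      rw [Finset.mem_union, Finset.mem_image, Finset.mem_image] at hx
      rw [Finset.mem_range]
      rcases hx with ⟨a, ha, rfl⟩ | ⟨j, hj, rfl⟩
      · rw [Finset.mem_Ioo] at ha
        exact hlanti i a ha.1 ha.2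
      · exact hnlt j (Finset.mem_range.mp hj)
    · rw [Finset.card_union_of_disjoint hdisj, Finset.card_image_of_injOn hA,
        Finset.card_image_of_injOn hB, Finset.card_range, Finset.card_range, Nat.card_Ioo]
      simp only [hl, shiftPart]
      omega
  have hfac : ((l i).factorial : ℤ) = ∏ x ∈ Finset.range (l i), ((l i : ℤ) - x) := by
    rw [← Finset.prod_range_add_one_eq_factorial, ← Finset.prod_range_reflect]
    push_cast
    refine Finset.prod_congr rfl fun x hx => ?_
    rw [Finset.mem_range] at hx
    omega
  rw [hfac, ← hunion, Finset.prod_union hdisj, Finset.prod_image hA, Finset.prod_image hB]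
  congr 1
  refine Finset.prod_congr rfl fun j hj => ?_
  have h1 := (spec i j).mpr (Finset.mem_range.mp hj)
  have h2 := hcr j
  simp only [n, hl, shiftPart, hookLen]
  omega

theorem hookLen_pos (L : List ℕ) (hL : Antitone (fun a => L.getD a 0)) (i j : ℕ)
    (hj : j < L.getD i 0) : 0 < hookLen L i j := by
  have := (conjPart_spec L hL i j).mpr hj
  unfold hookLen
  omega

theorem hookProd_ne_zero (L : List ℕ) (hL : Antitone (fun a => L.getD a 0)) : hookProd L ≠ 0 := by
  unfold hookProd
  refine Finset.prod_ne_zero_iff.mpr fun i _ => Finset.prod_ne_zero_iff.mpr fun j hj => ?_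
  exact_mod_cast (hookLen_pos L hL i j (Finset.mem_range.mp hj)).ne'

theorem schurSpec_mul_hookProd (L : List ℕ) (hL : Antitone (fun a => L.getD a 0)) (t : ℚ) :
    hookProd L * schurSpec L t = ∏ i ∈ Finset.range L.length, ∏ j ∈ Finset.range (L.getD i 0),
      (t + ((j : ℚ) - (i : ℚ))) := by
  unfold hookProd schurSpec
  rw [← Finset.prod_mul_distrib]
  refine Finset.prod_congr rfl fun i _ => ?_
  rw [← Finset.prod_mul_distrib]
  refine Finset.prod_congr rfl fun j hj => ?_
  have : (hookLen L i j : ℚ) ≠ 0 := by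
    exact_mod_cast (hookLen_pos L hL i j (Finset.mem_range.mp hj)).ne'
  field_simp

theorem prod_range_extend (L : List ℕ) (r : ℕ) (hr : L.length ≤ r) (f : ℕ → ℕ → ℚ) :
    ∏ i ∈ Finset.range L.length, ∏ j ∈ Finset.range (L.getD i 0), f i j
      = ∏ i ∈ Finset.range r, ∏ j ∈ Finset.range (L.getD i 0), f i j := by
  refine Finset.prod_subset (Finset.range_mono hr) fun i _ hi => ?_
  rw [Finset.mem_range, not_lt] at hi
  rw [List.getD_eq_default _ _ hi]
  simp

theorem vand_schurSpec (L : List ℕ) (hL : Antitone (fun a => L.getD a 0)) (r : ℕ)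
    (hr : L.length ≤ r) :
    (∏ i ∈ Finset.range r, ∏ a ∈ Finset.Ioo i r, ((shiftPart L r i : ℚ) - shiftPart L r a))
      = (∏ i ∈ Finset.range r, ∏ a ∈ Finset.Ioo i r, ((a : ℚ) - i)) * schurSpec L r := by
  have hH := hookProd_ne_zero L hL
  apply mul_right_cancel₀ hH
  rw [mul_assoc, mul_comm (schurSpec L r), schurSpec_mul_hookProd L hL]
  unfold hookProd
  rw [prod_range_extend L r hr, prod_range_extend L r hr, ← Finset.prod_mul_distrib,
    ← Finset.prod_mul_distrib]
  refine Finset.prod_congr rfl fun i hi => ?_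
  rw [Finset.mem_range] at hi
  have h1 := congrArg (Int.cast : ℤ → ℚ) (hook_row L hL r hr i hi)
  have h0 := hook_row [] (fun _ _ _ => by simp) r (by simp) i hi
  have h2 : ((r - 1 - i).factorial : ℚ) = ∏ a ∈ Finset.Ioo i r, ((a : ℚ) - i) := by
    have : ((r - 1 - i).factorial : ℤ) = ∏ a ∈ Finset.Ioo i r, ((a : ℤ) - i) := by
      simp only [shiftPart, List.getD_nil, Finset.range_zero, Finset.prod_empty, mul_one,
        zero_add] at h0
      rw [← h0]
      refine Finset.prod_congr rfl fun a ha => ?_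
      rw [Finset.mem_Ioo] at ha
      omega
    exact_mod_cast this
  push_cast at h1
  rw [h1, ← h2, shiftPart, add_comm, ← Nat.factorial_mul_ascFactorial, Nat.cast_mul,
    Nat.ascFactorial_eq_prod_range]
  push_cast
  congr 1
  refine Finset.prod_congr rfl fun j _ => ?_
  have : ((r - 1 - i : ℕ) : ℚ) = r - 1 - i := by
    rw [Nat.cast_sub (by omega), Nat.cast_sub (by omega)]
    simp
  rw [this]
  ring

/-- The exponent `λ + δ` in `r` variables. -/
noncomputable def lamDeltaR (L : List ℕ) (r : ℕ) : Fin r →₀ ℕ :=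
  Finsupp.equivFunOnFinite.symm (fun i : Fin r => shiftPart L r i)

theorem lamDelta_eq (L : List ℕ) : lamDelta L = lamDeltaR L L.length := by
  ext i
  simp [lamDelta, lamDeltaR, shiftPart]

theorem vandermondeMv_eq_prod (r : ℕ) : vandermondeMv r
    = ∏ i : Fin r, ∏ j : Fin r, if i < j then (X i - X j : MvPolynomial (Fin r) ℤ) else 1 := by
  unfold vandermondeMv
  rw [Finset.prod_filter, ← Finset.univ_product_univ, Finset.prod_product]

/-- Setting the last variable to zero. -/
noncomputable def killLast (r : ℕ) : MvPolynomial (Fin (r + 1)) ℤ →ₐ[ℤ] MvPolynomial (Fin r) ℤ :=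
  killCompl (Fin.castSucc_injective r)

theorem killLast_X (r : ℕ) (i : Fin r) : killLast r (X i.castSucc) = X i := by
  rw [killLast, ← rename_X (R := ℤ) Fin.castSucc i, killCompl_rename_app]

theorem killLast_last (r : ℕ) : killLast r (X (Fin.last r)) = 0 := by
  rw [killLast, killCompl, aeval_X, dif_neg]
  rintro ⟨i, hi⟩
  exact (Fin.castSucc_lt_last i).ne hi

theorem killLast_vandermonde (r : ℕ) :
    killLast r (vandermondeMv (r + 1)) = (∏ i, X i) * vandermondeMv r := by
  rw [vandermondeMv_eq_prod, vandermondeMv_eq_prod, Fin.prod_univ_castSucc, map_mul, map_prod]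
  have h1 : ∏ j : Fin (r + 1), (if Fin.last r < j then
      (X (Fin.last r) - X j : MvPolynomial (Fin (r + 1)) ℤ) else 1) = 1 := by
    refine Finset.prod_eq_one fun j _ => ?_
    rw [if_neg (not_lt.mpr (Fin.le_last j))]
  rw [h1, map_one, mul_one, ← Finset.prod_mul_distrib]
  refine Finset.prod_congr rfl fun i _ => ?_
  rw [Fin.prod_univ_castSucc, if_pos (Fin.castSucc_lt_last i), map_mul, map_sub, killLast_X,
    killLast_last, sub_zero, mul_comm, map_prod]
  congr 1
  refine Finset.prod_congr rfl fun j _ => ?_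
  by_cases h : i < j
  · rw [if_pos h, if_pos (Fin.castSucc_lt_castSucc_iff.mpr h), map_sub, killLast_X, killLast_X]
  · rw [if_neg h, if_neg (fun h' => h (Fin.castSucc_lt_castSucc_iff.mp h')), map_one]

theorem killLast_invPoly (r : ℕ) {k : ℕ} (w : Equiv.Perm (Fin k)) :
    killLast r (invPoly (r + 1) w) = invPoly r w := by
  rw [invPoly_eq, invPoly_eq, map_multiset_prod, Multiset.map_map]
  congr 1
  refine Multiset.map_congr rfl fun a ha => ?_
  have hpos := w.partition.parts_pos ha
  simp only [Function.comp_apply, powerSumMv, Fin.sum_univ_castSucc, map_add, map_sum, map_pow,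
    killLast_X, killLast_last]
  rw [zero_pow hpos.ne', add_zero]

theorem frob_stable (L : List ℕ) (r : ℕ) (h : L.getD r 0 = 0) {k : ℕ} (w : Equiv.Perm (Fin k)) :
    coeff (lamDeltaR L (r + 1)) (frobPoly (r + 1) w) = coeff (lamDeltaR L r) (frobPoly r w) := by
  have h1 : lamDeltaR L (r + 1) = Finsupp.mapDomain Fin.castSucc
      (lamDeltaR L r + Finsupp.equivFunOnFinite.symm (fun _ => 1)) := by
    ext j
    refine Fin.lastCases ?_ (fun i => ?_) j
    · rw [Finsupp.mapDomain_of_notMem_range]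
      · change L.getD r 0 + (r + 1 - 1 - r) = 0
        omega
      · rintro ⟨i, hi⟩
        exact (Fin.castSucc_lt_last i).ne hi
    · rw [Finsupp.mapDomain_apply (Fin.castSucc_injective r)]
      simp [lamDeltaR, shiftPart]
      omega
  have h2 := coeff_killCompl (R := ℤ) (Fin.castSucc_injective r) (p := frobPoly (r + 1) w)
    (s := lamDeltaR L r + Finsupp.equivFunOnFinite.symm (fun _ => 1))
  rw [← h1] at h2
  rw [← h2]
  have h3 : killCompl (Fin.castSucc_injective r) (frobPoly (r + 1) w)
      = monomial (Finsupp.equivFunOnFinite.symm (fun _ => 1)) 1 * frobPoly r w := by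
    change killLast r (frobPoly (r + 1) w) = _
    rw [frobPoly, map_mul, killLast_vandermonde, killLast_invPoly, frobPoly, mul_assoc]
    congr 1
    rw [monomial_eq, Finsupp.prod_fintype _ _ (fun i => by simp)]
    simp
  rw [h3, add_comm, coeff_monomial_mul, one_mul]

theorem symChar_eq_coeffR (L : List ℕ) (r : ℕ) (hr : L.length ≤ r) {k : ℕ}
    (w : Equiv.Perm (Fin k)) :
    symChar L w.partition.parts = coeff (lamDeltaR L r) (frobPoly r w) := by
  induction r, hr using Nat.le_induction with
  | base => rw [symChar_eq_coeff, lamDelta_eq]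
  | succ r hr ih => rw [frob_stable L r (List.getD_eq_default _ _ hr), ih]

theorem permExp_mapDomain {r : ℕ} (σ τ : Equiv.Perm (Fin r)) :
    Finsupp.mapDomain σ (permExp τ) = permExp (τ * σ⁻¹) := by
  ext i
  obtain ⟨j, rfl⟩ := σ.surjective i
  rw [Finsupp.mapDomain_apply σ.injective]
  simp [permExp]

theorem rename_vandermonde {r : ℕ} (σ : Equiv.Perm (Fin r)) :
    rename σ (vandermondeMv r) = (Equiv.Perm.sign σ : ℤ) • vandermondeMv r := by
  obtain ⟨ε, h⟩ := vandermondeMv_eq r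
  rw [h, map_zsmul, map_sum, smul_comm, Finset.smul_sum (r := ((Equiv.Perm.sign σ : ℤˣ) : ℤ))]
  congr 1
  rw [← Equiv.sum_comp (Equiv.mulRight σ)]
  refine Finset.sum_congr rfl fun τ _ => ?_
  rw [map_zsmul, rename_monomial, permExp_mapDomain]
  simp only [Equiv.coe_mulRight, mul_assoc, mul_inv_cancel, mul_one, Perm.sign_mul, Units.val_mul]
  rw [mul_comm, mul_smul]

theorem rename_invPoly {r k : ℕ} (σ : Equiv.Perm (Fin r)) (w : Equiv.Perm (Fin k)) :
    rename σ (invPoly r w) = invPoly r w := by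
  rw [invPoly_eq, map_multiset_prod, Multiset.map_map]
  congr 1
  refine Multiset.map_congr rfl fun a _ => ?_
  simp only [Function.comp_apply, powerSumMv, map_sum, map_pow, rename_X]
  exact Equiv.sum_comp σ (fun i => (X i : MvPolynomial (Fin r) ℤ) ^ a)

theorem rename_frob {r k : ℕ} (σ : Equiv.Perm (Fin r)) (w : Equiv.Perm (Fin k)) :
    rename σ (frobPoly r w) = (Equiv.Perm.sign σ : ℤ) • frobPoly r w := by
  rw [frobPoly, map_mul, rename_vandermonde, rename_invPoly, smul_mul_assoc]

theorem coeff_frob_perm {r k : ℕ} (σ : Equiv.Perm (Fin r)) (w : Equiv.Perm (Fin k))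
    (m : Fin r →₀ ℕ) :
    (Equiv.Perm.sign σ : ℤ) * coeff (Finsupp.mapDomain σ m) (frobPoly r w)
      = coeff m (frobPoly r w) := by
  rw [← coeff_rename_mapDomain σ σ.injective (frobPoly r w) m, rename_frob, coeff_smul, smul_eq_mul]

/-- Product of differences. -/
noncomputable def diffProd {R : Type*} [CommRing R] {r : ℕ} (v : Fin r → R) : R :=
  ∏ i : Fin r, ∏ j ∈ Finset.Ioi i, (v j - v i)

theorem det_expand {R : Type*} [CommRing R] {r : ℕ} (v : Fin r → R) :
    ∑ σ : Equiv.Perm (Fin r), (Equiv.Perm.sign σ : ℤ) • ∏ i, v i ^ (σ i : ℕ) = diffProd v := by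
  rw [diffProd, ← Matrix.det_vandermonde, ← Matrix.det_transpose, Matrix.det_apply]
  refine Finset.sum_congr rfl fun σ _ => ?_
  rw [Units.smul_def]
  simp [Matrix.vandermonde]

theorem diffProd_perm {R : Type*} [CommRing R] {r : ℕ} (v : Fin r → R) (σ : Equiv.Perm (Fin r)) :
    diffProd (fun i => v (σ i)) = (Equiv.Perm.sign σ : ℤ) • diffProd v := by
  rw [diffProd, diffProd, ← Matrix.det_vandermonde, ← Matrix.det_vandermonde]
  have := Matrix.det_permute σ (Matrix.vandermonde v)
  rw [zsmul_eq_mul, ← this]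
  rfl

/-- Evaluation in an arbitrary commutative ring. -/
noncomputable def evMap {R : Type*} [CommRing R] {r : ℕ} (v : Fin r → R) :
    MvPolynomial (Fin r) ℤ →ₐ[ℤ] R := aeval v

theorem evMap_X {R : Type*} [CommRing R] {r : ℕ} (v : Fin r → R) (i : Fin r) :
    evMap v (X i) = v i := aeval_X v i

theorem vandermonde_eval {R : Type*} [CommRing R] {r : ℕ} (v : Fin r → R) :
    evMap v (vandermondeMv r) = diffProd (fun i => - v i) := by
  rw [vandermondeMv_eq_prod, map_prod, diffProd]
  refine Finset.prod_congr rfl fun i _ => ?_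
  rw [map_prod, ← Finset.prod_subset (Finset.subset_univ (Finset.Ioi i))]
  · refine Finset.prod_congr rfl fun j hj => ?_
    rw [if_pos (Finset.mem_Ioi.mp hj)]
    rw [map_sub, evMap_X, evMap_X]
    ring
  · intro j _ hj
    rw [if_neg (fun h => hj (Finset.mem_Ioi.mpr h)), map_one]

theorem eval_antisym {r k : ℕ} (w : Equiv.Perm (Fin k)) {R : Type*} [CommRing R] (y : R) :
    (r.factorial : R) * evMap (fun i : Fin r => y ^ (i : ℕ)) (frobPoly r w)
      = ∑ m ∈ (frobPoly r w).support, (coeff m (frobPoly r w)) • diffProd (fun i => y ^ m i) := by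
  set F := frobPoly r w with hF
  have h1 : ∑ σ : Equiv.Perm (Fin r), (Equiv.Perm.sign σ : ℤ) •
      evMap (fun i : Fin r => y ^ (i : ℕ)) (rename σ F)
      = (r.factorial : R) * evMap (fun i : Fin r => y ^ (i : ℕ)) F := by
    have : ∀ σ : Equiv.Perm (Fin r), (Equiv.Perm.sign σ : ℤ) •
      evMap (fun i : Fin r => y ^ (i : ℕ)) (rename σ F) = evMap (fun i : Fin r => y ^ (i : ℕ)) F := by
      intro σ
      rw [hF, rename_frob, map_zsmul, ← mul_smul, Int.units_coe_mul_self, one_smul]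
    simp only [this]
    rw [Finset.sum_const, Finset.card_univ, Fintype.card_perm, Fintype.card_fin, nsmul_eq_mul]
  rw [← h1]
  have h2 : ∀ σ : Equiv.Perm (Fin r), evMap (fun i : Fin r => y ^ (i : ℕ)) (rename σ F)
      = ∑ m ∈ F.support, coeff m F • ∏ i, (y ^ m i) ^ (σ i : ℕ) := by
    intro σ
    rw [evMap, aeval_rename, aeval_def, eval₂_eq']
    refine Finset.sum_congr rfl fun m _ => ?_
    rw [Algebra.smul_def]
    congr 1
    refine Finset.prod_congr rfl fun i _ => ?_
    simp only [Function.comp_apply]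
    rw [← pow_mul, ← pow_mul, mul_comm]
  simp only [h2, Finset.smul_sum]
  rw [Finset.sum_comm]
  refine Finset.sum_congr rfl fun m _ => ?_
  rw [← det_expand, Finset.smul_sum]
  refine Finset.sum_congr rfl fun σ _ => ?_
  rw [smul_comm]

theorem diffProd_mul {R : Type*} [CommRing R] {r : ℕ} (c : R) (v : Fin r → R) :
    diffProd (fun i => c * v i) = (∏ i : Fin r, ∏ _j ∈ Finset.Ioi i, c) * diffProd v := by
  simp only [diffProd, ← Finset.prod_mul_distrib, mul_sub]

/-- The sign `(-1)^(r choose 2)`. -/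
noncomputable def negProd (R : Type*) [CommRing R] (r : ℕ) : R :=
  ∏ i : Fin r, ∏ _j ∈ Finset.Ioi i, (-1 : R)

theorem diffProd_neg {R : Type*} [CommRing R] {r : ℕ} (v : Fin r → R) :
    diffProd (fun i => - v i) = negProd R r * diffProd v := by
  rw [negProd, ← diffProd_mul]
  simp

theorem diffProd_add {R : Type*} [CommRing R] {r : ℕ} (c : R) (v : Fin r → R) :
    diffProd (fun i => v i + c) = diffProd v := by
  simp only [diffProd, add_sub_add_right_eq_sub]

theorem diffProd_geom {r : ℕ} (m : Fin r → ℕ) :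
    diffProd (fun i => (Polynomial.X : Polynomial ℤ) ^ m i)
      = (∏ i : Fin r, ∏ _j ∈ Finset.Ioi i, (Polynomial.X - 1)) *
        diffProd (fun i => ∑ s ∈ Finset.range (m i), (Polynomial.X : Polynomial ℤ) ^ s) := by
  rw [← diffProd_mul, ← diffProd_add (-1) (fun i => (Polynomial.X : Polynomial ℤ) ^ m i)]
  congr 1
  funext i
  rw [mul_geom_sum]
  ring

theorem eval_diffProd {r : ℕ} (m : Fin r → ℕ) :
    (diffProd (fun i => ∑ s ∈ Finset.range (m i), (Polynomial.X : Polynomial ℤ) ^ s)).eval 1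
      = diffProd (fun i => (m i : ℤ)) := by
  simp [diffProd, Polynomial.eval_prod, Polynomial.eval_finsetSum]

theorem frob_master {r k : ℕ} (w : Equiv.Perm (Fin k)) :
    (r.factorial : ℤ) * (diffProd (fun i : Fin r => - ((i : ℕ) : ℤ)) * (r : ℤ) ^ cyclesCount w)
      = ∑ m ∈ (frobPoly r w).support, (coeff m (frobPoly r w)) * diffProd (fun i => (m i : ℤ)) := by
  have h := eval_antisym (r := r) w (Polynomial.X : Polynomial ℤ)
  rw [frobPoly, map_mul, vandermonde_eval, ← frobPoly] at h
  rw [diffProd_neg, diffProd_geom] at h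
  simp only [diffProd_geom] at h
  set Q := (∏ i : Fin r, ∏ _j ∈ Finset.Ioi i, (Polynomial.X - 1 : Polynomial ℤ)) with hQ
  have hQ0 : Q ≠ 0 := by
    refine Finset.prod_ne_zero_iff.mpr fun i _ => Finset.prod_ne_zero_iff.mpr fun j _ => ?_
    exact Polynomial.X_sub_C_ne_zero 1
  have h2 : (r.factorial : Polynomial ℤ) * ((negProd (Polynomial ℤ) r *
      diffProd (fun i : Fin r => ∑ s ∈ Finset.range (i : ℕ), (Polynomial.X : Polynomial ℤ) ^ s)) *
      evMap (fun i : Fin r => (Polynomial.X : Polynomial ℤ) ^ (i : ℕ)) (invPoly r w))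
      = ∑ m ∈ (frobPoly r w).support, (coeff m (frobPoly r w)) •
        diffProd (fun i => ∑ s ∈ Finset.range (m i), (Polynomial.X : Polynomial ℤ) ^ s) := by
    apply mul_left_cancel₀ hQ0
    rw [Finset.mul_sum]
    simp only [mul_smul_comm]
    rw [← h]
    ring
  have h3 := congrArg (Polynomial.eval 1) h2
  have hP : (evMap (fun i : Fin r => (Polynomial.X : Polynomial ℤ) ^ (i : ℕ)) (invPoly r w)).eval 1
      = (r : ℤ) ^ cyclesCount w := by
    rw [invPoly_eq, map_multiset_prod, Multiset.map_map, ← Polynomial.coe_evalRingHom,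
      map_multiset_prod, Multiset.map_map]
    have : ∀ a ∈ w.partition.parts, (⇑(Polynomial.evalRingHom (1 : ℤ)) ∘
        ⇑(evMap (fun i : Fin r => (Polynomial.X : Polynomial ℤ) ^ (i : ℕ))) ∘ powerSumMv r) a = r := by
      intro a _
      simp [powerSumMv, evMap_X, Polynomial.eval_finsetSum]
    rw [Multiset.map_congr rfl this, Multiset.map_const', Multiset.prod_replicate, cyclesCount]
  rw [Polynomial.eval_mul, Polynomial.eval_mul, Polynomial.eval_mul, eval_diffProd, hP,
    Polynomial.eval_finsetSum] at h3
  simp only [Polynomial.eval_smul, eval_diffProd, smul_eq_mul] at h3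
  rw [← h3, diffProd_neg]
  simp [Polynomial.eval_prod, negProd]

theorem partList_pairwise {n : ℕ} (P : Nat.Partition n) : (partList P).Pairwise (· ≥ ·) :=
  Multiset.pairwise_sort _ _

theorem getD_antitone (L : List ℕ) (h : L.Pairwise (· ≥ ·)) : Antitone (fun a => L.getD a 0) := by
  intro a b hab
  simp only
  rcases hab.eq_or_lt with h' | h'
  · rw [h']
  · by_cases hb : b < L.length
    · rw [List.getD_eq_getElem _ _ hb, List.getD_eq_getElem _ _ (h'.trans hb)]
      exact List.pairwise_iff_getElem.mp h a b (h'.trans hb) hb h'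
    · rw [List.getD_eq_default _ _ (not_lt.mp hb)]
      exact Nat.zero_le _

theorem partList_antitone {n : ℕ} (P : Nat.Partition n) :
    Antitone (fun a => (partList P).getD a 0) := getD_antitone _ (partList_pairwise P)

theorem partList_coe {n : ℕ} (P : Nat.Partition n) : ((partList P : List ℕ) : Multiset ℕ) = P.parts :=
  Multiset.sort_eq _ _

theorem partList_length {n : ℕ} (P : Nat.Partition n) : (partList P).length ≤ n := by
  have h1 : (partList P).length = P.parts.card := Multiset.length_sort _
  rw [h1]
  have h2 : ∀ s : Multiset ℕ, (∀ x ∈ s, 0 < x) → s.card ≤ s.sum := by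
    intro s
    induction s using Multiset.induction_on with
    | empty => simp
    | cons a s ih =>
      intro hs
      rw [Multiset.card_cons, Multiset.sum_cons]
      have := ih (fun x hx => hs x (Multiset.mem_cons_of_mem hx))
      have := hs a (Multiset.mem_cons_self a s)
      omega
  have := h2 P.parts (fun x hx => P.parts_pos hx)
  rwa [P.parts_sum] at this

theorem getD_filter (L : List ℕ) (h : L.Pairwise (· ≥ ·)) (i : ℕ) :
    (L.filter (fun x => x ≠ 0)).getD i 0 = L.getD i 0 := by
  induction L generalizing i with
  | nil => simp
  | cons a L ih =>
    rw [List.pairwise_cons] at h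
    by_cases ha : a = 0
    · have hz : ∀ x ∈ a :: L, x = 0 := by
        intro x hx
        rcases List.mem_cons.mp hx with h' | h'
        · rw [h', ha]
        · have := h.1 x h'
          omega
      have h1 : (a :: L).filter (fun x => x ≠ 0) = [] := by
        rw [List.filter_eq_nil_iff]
        intro x hx
        simp [hz x hx]
      rw [h1]
      by_cases hi : i < (a :: L).length
      · rw [List.getD_eq_getElem _ _ hi, hz _ (List.getElem_mem hi)]
        simp
      · rw [List.getD_eq_default _ _ (not_lt.mp hi)]
        simp
    · rw [List.filter_cons_of_pos (by simpa using ha)]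
      cases i with
      | zero => simp
      | succ i => simpa using ih h.2 i

theorem partList_inj {n : ℕ} (P Q : Nat.Partition n)
    (h : ∀ i < n, (partList P).getD i 0 = (partList Q).getD i 0) : P = Q := by
  have hall : ∀ i, (partList P).getD i 0 = (partList Q).getD i 0 := by
    intro i
    by_cases hi : i < n
    · exact h i hi
    · rw [List.getD_eq_default _ _ ((partList_length P).trans (not_lt.mp hi)),
        List.getD_eq_default _ _ ((partList_length Q).trans (not_lt.mp hi))]
  have hpos : ∀ (P : Nat.Partition n) i, 0 < (partList P).getD i 0 ↔ i < (partList P).length := by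
    intro P i
    by_cases hi : i < (partList P).length
    · rw [List.getD_eq_getElem _ _ hi]
      refine ⟨fun _ => hi, fun _ => P.parts_pos ?_⟩
      rw [← partList_coe P]
      exact Multiset.mem_coe.mpr (List.getElem_mem hi)
    · rw [List.getD_eq_default _ _ (not_lt.mp hi)]
      simp [hi]
  have hlen : (partList P).length = (partList Q).length := by
    have h1 : ∀ i, i < (partList P).length ↔ i < (partList Q).length := by
      intro i
      rw [← hpos, ← hpos, hall]
    have h2 := h1 (partList P).length
    have h3 := h1 (partList Q).length
    omega
  have hl : partList P = partList Q := by
    apply List.ext_getElem hlen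
    intro i h1 h2
    have := hall i
    rwa [List.getD_eq_getElem _ _ h1, List.getD_eq_getElem _ _ h2] at this
  apply Nat.Partition.ext
  rw [← partList_coe P, hl, partList_coe]

theorem partList_surj {n r : ℕ} (a : Fin r → ℕ) (ha : Antitone a) (hs : ∑ i, a i = n) :
    ∃ P : Nat.Partition n, ∀ i : Fin r, (partList P).getD i 0 = a i := by
  have hsum : ((List.ofFn a : List ℕ) : Multiset ℕ).sum = n := by
    rw [Multiset.sum_coe, List.sum_ofFn, hs]
  have hpw : (List.ofFn a).Pairwise (· ≥ ·) := by
    rw [List.pairwise_ofFn]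
    intro i j hij
    exact ha hij.le
  refine ⟨Nat.Partition.ofSums n _ hsum, fun i => ?_⟩
  have h1 : partList (Nat.Partition.ofSums n _ hsum) = (List.ofFn a).filter (fun x => x ≠ 0) := by
    apply List.Perm.eq_of_pairwise' (r := (· ≥ ·)) (partList_pairwise _) (hpw.filter _)
    rw [← Multiset.coe_eq_coe, partList_coe]
    simp [Nat.Partition.ofSums]
  rw [h1, getD_filter _ hpw, List.getD_eq_getElem _ _ (by simp)]
  simp

theorem mapDomain_perm_apply {r : ℕ} (σ : Equiv.Perm (Fin r)) (m : Fin r →₀ ℕ) (i : Fin r) :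
    Finsupp.mapDomain σ m i = m (σ⁻¹ i) := by
  obtain ⟨j, rfl⟩ := σ.surjective i
  rw [Finsupp.mapDomain_apply σ.injective]
  simp

/-- The symmetrized summand. -/
noncomputable def frobTerm {r k : ℕ} (w : Equiv.Perm (Fin k)) (m : Fin r →₀ ℕ) : ℤ :=
  coeff m (frobPoly r w) * diffProd (fun i => (m i : ℤ))

theorem frobTerm_perm {r k : ℕ} (w : Equiv.Perm (Fin k)) (m : Fin r →₀ ℕ)
    (σ : Equiv.Perm (Fin r)) : frobTerm w (Finsupp.mapDomain σ m) = frobTerm w m := by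
  unfold frobTerm
  rw [← coeff_frob_perm σ w m]
  have h : diffProd (fun i => ((Finsupp.mapDomain σ m i : ℕ) : ℤ))
      = (Equiv.Perm.sign σ : ℤ) * diffProd (fun i => (m i : ℤ)) := by
    simp only [mapDomain_perm_apply]
    rw [diffProd_perm (fun i => (m i : ℤ)) σ⁻¹, sign_inv, smul_eq_mul]
  rw [h]
  ring

theorem diffProd_eq_zero {r : ℕ} (v : Fin r → ℤ) (h : ¬ Function.Injective v) : diffProd v = 0 := by
  rw [diffProd, ← Matrix.det_vandermonde]
  by_contra hne
  exact h (Matrix.det_vandermonde_ne_zero_iff.mp hne)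

theorem exists_unique_sort {r : ℕ} (m : Fin r →₀ ℕ) (h : Function.Injective m) :
    ∃! σ : Equiv.Perm (Fin r), StrictAnti (Finsupp.mapDomain σ m) := by
  have hfun : ∀ σ : Equiv.Perm (Fin r), (⇑(Finsupp.mapDomain σ m) : Fin r → ℕ) = ⇑m ∘ ⇑(σ⁻¹) := by
    intro σ
    funext i
    exact mapDomain_perm_apply σ m i
  refine ⟨(Tuple.sort m * Fin.revPerm)⁻¹, ?_, ?_⟩
  · simp only [hfun, inv_inv]
    have hm : StrictMono (⇑m ∘ ⇑(Tuple.sort m)) :=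
      (Tuple.monotone_sort m).strictMono_of_injective (h.comp (Tuple.sort m).injective)
    intro i j hij
    exact hm (Fin.rev_lt_rev.mpr hij)
  · intro τ hτ
    simp only [hfun] at hτ
    have hm : StrictMono (⇑m ∘ ⇑(Tuple.sort m)) :=
      (Tuple.monotone_sort m).strictMono_of_injective (h.comp (Tuple.sort m).injective)
    have h2 : StrictAnti (⇑m ∘ ⇑(Tuple.sort m * Fin.revPerm : Equiv.Perm (Fin r))) := by
      intro i j hij
      exact hm (Fin.rev_lt_rev.mpr hij)
    have h3 := Tuple.unique_antitone hτ.antitone h2.antitone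
    rw [eq_inv_iff_mul_eq_one, ← inv_inj, mul_inv_rev, inv_one, inv_mul_eq_one]
    ext i
    have := congrFun h3 i
    simp only [Function.comp_apply] at this
    rw [h this]

theorem frobTerm_symm {r k : ℕ} (w : Equiv.Perm (Fin k)) :
    ∑ m ∈ (frobPoly r w).support, frobTerm w m
      = r.factorial * ∑ m ∈ (frobPoly r w).support, if StrictAnti m then frobTerm w m else 0 := by
  have h1 : ∀ m : Fin r →₀ ℕ, frobTerm w m = ∑ σ : Equiv.Perm (Fin r),
      if StrictAnti (Finsupp.mapDomain σ m) then frobTerm w (Finsupp.mapDomain σ m) else 0 := by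
    intro m
    simp only [frobTerm_perm]
    by_cases h : Function.Injective m
    · obtain ⟨σ, hσ, hu⟩ := exists_unique_sort m h
      rw [Finset.sum_eq_single σ]
      · rw [if_pos hσ]
      · intro τ _ hτ
        rw [if_neg (fun h' => hτ (hu τ h'))]
      · simp
    · have : frobTerm w m = 0 := by
        rw [frobTerm, diffProd_eq_zero, mul_zero]
        intro hi
        exact h (fun a b hab => hi (by simp [hab]))
      simp [this]
  have hmem : ∀ (σ : Equiv.Perm (Fin r)) m, m ∈ (frobPoly r w).support →
      Finsupp.mapDomain σ m ∈ (frobPoly r w).support := by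
    intro σ m hm
    rw [mem_support_iff] at hm ⊢
    intro h0
    apply hm
    rw [← coeff_frob_perm σ, h0, mul_zero]
  have hcomp : ∀ (σ τ : Equiv.Perm (Fin r)) (m : Fin r →₀ ℕ), σ * τ = 1 →
      Finsupp.mapDomain σ (Finsupp.mapDomain τ m) = m := by
    intro σ τ m h
    rw [← Finsupp.mapDomain_comp, ← Perm.coe_mul, h, Perm.coe_one, Finsupp.mapDomain_id]
  rw [Finset.sum_congr rfl (fun m _ => h1 m), Finset.sum_comm]
  have h2 : ∀ σ : Equiv.Perm (Fin r), (∑ m ∈ (frobPoly r w).support,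
      if StrictAnti (Finsupp.mapDomain σ m) then frobTerm w (Finsupp.mapDomain σ m) else 0)
      = ∑ m ∈ (frobPoly r w).support, if StrictAnti m then frobTerm w m else 0 := by
    intro σ
    refine Finset.sum_nbij' (Finsupp.mapDomain σ) (Finsupp.mapDomain ⇑σ⁻¹) (hmem σ) (hmem σ⁻¹)
      ?_ ?_ ?_
    · intro m _
      exact hcomp _ _ m (by simp)
    · intro m _
      exact hcomp _ _ m (by simp)
    · intro m _
      rfl
  simp only [h2]
  rw [Finset.sum_const, Finset.card_univ, Fintype.card_perm, Fintype.card_fin, nsmul_eq_mul]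

theorem frob_degree {r k : ℕ} (w : Equiv.Perm (Fin k)) (m : Fin r →₀ ℕ)
    (hm : coeff m (frobPoly r w) ≠ 0) : ∑ i, m i = ∑ i : Fin r, (i : ℕ) + k := by
  have h1 : (vandermondeMv r).IsHomogeneous (∑ i : Fin r, (i : ℕ)) := by
    obtain ⟨ε, h⟩ := vandermondeMv_eq r
    rw [h, ← C_mul']
    rw [← zero_add (∑ i : Fin r, (i : ℕ))]
    refine (isHomogeneous_C _ ε).mul (IsHomogeneous.sum _ _ _ fun σ _ => ?_)
    rw [smul_monomial]
    apply isHomogeneous_monomial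
    rw [Finsupp.degree_eq_sum]
    exact Equiv.sum_comp σ (fun i : Fin r => (i : ℕ))
  have h2 : (invPoly r w).IsHomogeneous k := by
    unfold invPoly
    refine IsHomogeneous.sum _ _ _ fun f _ => ?_
    split_ifs
    · have := IsHomogeneous.prod (Finset.univ) (fun d : Fin k => (X (f d) : MvPolynomial (Fin r) ℤ))
        (fun _ => 1) (fun d _ => isHomogeneous_X ℤ (f d))
      simpa using this
    · exact isHomogeneous_zero _ _ _
  have h3 := (h1.mul h2) hm
  rw [← h3, Finsupp.weight_apply, Finsupp.sum_fintype _ _ (fun i => by simp)]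
  simp

theorem sum_strictAnti {r k : ℕ} (hr : k ≤ r) (w : Equiv.Perm (Fin k)) :
    (∑ m ∈ (frobPoly r w).support, if StrictAnti m then frobTerm w m else 0)
      = ∑ lam : Nat.Partition k, frobTerm w (lamDeltaR (partList lam) r) := by
  classical
  rw [← Finset.sum_filter]
  symm
  refine Finset.sum_bij_ne_zero (fun lam _ _ => lamDeltaR (partList lam) r) ?_ ?_ ?_ ?_
  · intro lam _ h
    rw [Finset.mem_filter, mem_support_iff]
    refine ⟨fun h0 => h (by rw [frobTerm, h0, zero_mul]), ?_⟩
    intro i j hij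
    change shiftPart (partList lam) r j < shiftPart (partList lam) r i
    have h1 := partList_antitone lam (show (i : ℕ) ≤ (j : ℕ) from hij.le)
    simp only at h1
    have := j.2
    have : (i : ℕ) < j := hij
    unfold shiftPart
    omega
  · intro lam _ _ lam' _ _ h
    apply partList_inj
    intro i hi
    have := DFunLike.congr_fun h (⟨i, by omega⟩ : Fin r)
    change shiftPart (partList lam) r i = shiftPart (partList lam') r i at this
    unfold shiftPart at this
    omega
  · intro m hm h0
    rw [Finset.mem_filter, mem_support_iff] at hm
    have hdeg := frob_degree w m hm.1
    have hge : ∀ d : ℕ, ∀ i : Fin r, (i : ℕ) + d + 1 = r → d ≤ m i := by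
      intro d
      induction d with
      | zero => intro i _; exact Nat.zero_le _
      | succ d ih =>
        intro i hi
        have h1 := ih ⟨(i : ℕ) + 1, by omega⟩ (by simp only; omega)
        have h2 : m ⟨(i : ℕ) + 1, by omega⟩ < m i := hm.2 (by rw [Fin.lt_def]; simp)
        omega
    have hge' : ∀ i : Fin r, r - 1 - (i : ℕ) ≤ m i := fun i => hge _ i (by have := i.2; omega)
    have hanti : Antitone (fun i : Fin r => m i - (r - 1 - (i : ℕ))) := by
      have key : ∀ d : ℕ, ∀ i j : Fin r, (i : ℕ) + d = j → m j + d ≤ m i := by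
        intro d
        induction d with
        | zero =>
          intro i j hij
          have : i = j := Fin.ext (by simpa using hij)
          rw [this]; simp
        | succ d ih =>
          intro i j hij
          have h1 := ih ⟨(i : ℕ) + 1, by have := j.2; omega⟩ j (by simp only; omega)
          have h2 : m ⟨(i : ℕ) + 1, by have := j.2; omega⟩ < m i := hm.2 (by rw [Fin.lt_def]; simp)
          omega
      intro i j hij
      have hij' : (i : ℕ) ≤ j := hij
      have h1 := key ((j : ℕ) - i) i j (by omega)
      have h2 := hge' i
      have h3 := hge' j
      have := j.2
      simp only
      omega
    have hsum : ∑ i : Fin r, (m i - (r - 1 - (i : ℕ))) = k := by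
      have h1 : ∑ i : Fin r, (m i - (r - 1 - (i : ℕ))) + ∑ i : Fin r, (r - 1 - (i : ℕ)) = ∑ i, m i := by
        rw [← Finset.sum_add_distrib]
        exact Finset.sum_congr rfl fun i _ => Nat.sub_add_cancel (hge' i)
      have h2 : ∑ i : Fin r, (r - 1 - (i : ℕ)) = ∑ i : Fin r, (i : ℕ) := by
        rw [← Equiv.sum_comp Fin.revPerm (fun i : Fin r => (i : ℕ))]
        refine Finset.sum_congr rfl fun i _ => ?_
        simp [Fin.val_rev]
        omega
      omega
    obtain ⟨P, hP⟩ := partList_surj _ hanti hsum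
    have hPm : lamDeltaR (partList P) r = m := by
      ext i
      change (partList P).getD i 0 + (r - 1 - (i : ℕ)) = m i
      rw [hP]
      exact Nat.sub_add_cancel (hge' i)
    exact ⟨P, Finset.mem_univ _, by rw [hPm]; exact h0, hPm⟩
  · intro lam _ _
    rfl

theorem diffProd_fin (r : ℕ) (f : ℕ → ℚ) : diffProd (fun i : Fin r => f i)
    = ∏ i ∈ Finset.range r, ∏ a ∈ Finset.Ioo i r, (f a - f i) := by
  rw [diffProd, Finset.prod_range]
  refine Finset.prod_congr rfl fun i _ => ?_
  rw [← Fin.map_valEmbedding_Ioi, Finset.prod_map]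
  rfl

theorem diffProd_cast {r : ℕ} (v : Fin r → ℤ) :
    ((diffProd v : ℤ) : ℚ) = diffProd (fun i => (v i : ℚ)) := by
  simp [diffProd]

theorem power_expand_large {r k : ℕ} (hr : k ≤ r) (w : Equiv.Perm (Fin k)) :
    (r : ℚ) ^ cyclesCount w = ∑ lam : Nat.Partition k, schurSpec (partList lam) r
      * (symChar (partList lam) w.partition.parts : ℚ) := by
  have h1 := frob_master (r := r) w
  have h2 : ∑ m ∈ (frobPoly r w).support, (coeff m (frobPoly r w)) * diffProd (fun i => (m i : ℤ))
      = ∑ m ∈ (frobPoly r w).support, frobTerm w m := rfl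
  rw [h2, frobTerm_symm, sum_strictAnti hr] at h1
  have h3 := mul_left_cancel₀ (by exact_mod_cast Nat.factorial_ne_zero r) h1
  have h4 := congrArg (Int.cast : ℤ → ℚ) h3
  rw [Int.cast_mul, Int.cast_sum, diffProd_cast] at h4
  set D : ℚ := diffProd (fun i : Fin r => ((i : ℕ) : ℚ)) with hD
  set N : ℚ := negProd ℚ r with hN
  have hN2 : N * N = 1 := by
    rw [hN, negProd, ← Finset.prod_mul_distrib]
    refine Finset.prod_eq_one fun i _ => ?_
    rw [← Finset.prod_mul_distrib]
    exact Finset.prod_eq_one fun j _ => by norm_num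
  have hD0 : D ≠ 0 := by
    rw [hD, diffProd]
    refine Finset.prod_ne_zero_iff.mpr fun i _ => Finset.prod_ne_zero_iff.mpr fun j hj => ?_
    rw [Finset.mem_Ioi, Fin.lt_def] at hj
    rw [sub_ne_zero]
    exact_mod_cast hj.ne'
  have h5 : diffProd (fun i : Fin r => ((- ((i : ℕ) : ℤ) : ℤ) : ℚ)) = N * D := by
    rw [hN, hD, ← diffProd_neg]
    simp
  rw [h5] at h4
  have h6 : ∀ lam : Nat.Partition k, ((frobTerm w (lamDeltaR (partList lam) r) : ℤ) : ℚ)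
      = (N * D) * (schurSpec (partList lam) r * (symChar (partList lam) w.partition.parts : ℚ)) := by
    intro lam
    have hlen := (partList_length lam).trans hr
    rw [frobTerm, ← symChar_eq_coeffR _ r hlen, Int.cast_mul, diffProd_cast]
    have hv := vand_schurSpec (partList lam) (partList_antitone lam) r hlen
    have e1 : D = ∏ i ∈ Finset.range r, ∏ a ∈ Finset.Ioo i r, ((a : ℚ) - i) := diffProd_fin r _
    have e2 : N * diffProd (fun i : Fin r => (shiftPart (partList lam) r i : ℚ))
        = ∏ i ∈ Finset.range r, ∏ a ∈ Finset.Ioo i r,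
          ((shiftPart (partList lam) r i : ℚ) - shiftPart (partList lam) r a) := by
      rw [hN, ← diffProd_neg, diffProd_fin r (fun i => - (shiftPart (partList lam) r i : ℚ))]
      refine Finset.prod_congr rfl fun i _ => Finset.prod_congr rfl fun a _ => ?_
      ring
    rw [← e1, ← e2] at hv
    have e3 : (fun i : Fin r => (((lamDeltaR (partList lam) r i : ℕ) : ℤ) : ℚ))
        = fun i : Fin r => (shiftPart (partList lam) r i : ℚ) := by
      funext i
      simp [lamDeltaR]
    rw [e3]
    linear_combination (N * (symChar (partList lam) w.partition.parts : ℚ)) * hv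
      - (symChar (partList lam) w.partition.parts : ℚ)
        * diffProd (fun i : Fin r => (shiftPart (partList lam) r i : ℚ)) * hN2
  rw [Finset.sum_congr rfl (fun lam _ => h6 lam), ← Finset.mul_sum] at h4
  have hND : N * D ≠ 0 := mul_ne_zero (fun h => by rw [h] at hN2; simp at hN2) hD0
  have h7 := mul_left_cancel₀ hND h4
  rw [← h7]
  simp

theorem power_expand {k : ℕ} (w : Equiv.Perm (Fin k)) (t : ℚ) :
    t ^ cyclesCount w = ∑ lam : Nat.Partition k, schurSpec (partList lam) t
      * (symChar (partList lam) w.partition.parts : ℚ) := by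
  let p : Polynomial ℚ := Polynomial.X ^ cyclesCount w
  let q : Polynomial ℚ := ∑ lam : Nat.Partition k,
    (∏ i ∈ Finset.range (partList lam).length, ∏ j ∈ Finset.range ((partList lam).getD i 0),
      ((Polynomial.X + Polynomial.C ((j : ℚ) - (i : ℚ))) * Polynomial.C ((hookLen (partList lam) i j : ℚ)⁻¹)))
    * Polynomial.C (symChar (partList lam) w.partition.parts : ℚ)
  have hp : ∀ s, p.eval s = s ^ cyclesCount w := by
    intro s
    simp [p]
  have hq : ∀ s, q.eval s = ∑ lam : Nat.Partition k, schurSpec (partList lam) s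
      * (symChar (partList lam) w.partition.parts : ℚ) := by
    intro s
    simp only [q, schurSpec, Polynomial.eval_finsetSum, Polynomial.eval_mul, Polynomial.eval_prod,
      Polynomial.eval_add, Polynomial.eval_X, Polynomial.eval_C, div_eq_mul_inv]
  have : p = q := by
    apply Polynomial.eq_of_infinite_eval_eq
    refine Set.Infinite.mono (s := (fun n : ℕ => (n : ℚ)) '' Set.Ici k) ?_
      ((Set.Ici_infinite k).image Nat.cast_injective.injOn)
    rintro _ ⟨n, hn, rfl⟩
    change p.eval _ = q.eval _
    rw [hp, hq, power_expand_large hn w]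
  rw [← hp, this, hq]

theorem contProd_cast (L : List ℕ) (hL : Antitone (fun a => L.getD a 0)) (q : ℤ) :
    ((contProd L (-q) : ℤ) : ℚ) = hookProd L * schurSpec L (-(q : ℚ)) := by
  rw [schurSpec_mul_hookProd L hL]
  unfold contProd
  push_cast
  rfl

theorem pair_sum {k : ℕ} (w : Equiv.Perm (Fin k)) (a b : ℚ) :
    (∑ uv ∈ Finset.univ.filter
            (fun uv : Equiv.Perm (Fin k) × Equiv.Perm (Fin k) => uv.1 * uv.2 = w),
          a ^ cyclesCount uv.1 * b ^ cyclesCount uv.2)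
      = ∑ v : Equiv.Perm (Fin k), a ^ cyclesCount (w * v) * b ^ cyclesCount v := by
  refine Finset.sum_nbij' (fun uv => uv.2⁻¹) (fun v => (w * v, v⁻¹)) ?_ ?_ ?_ ?_ ?_
  · simp
  · simp
  · rintro ⟨u, v⟩ h
    simp only [Finset.mem_filter, Finset.mem_univ, true_and] at h
    simp [← h]
  · simp
  · rintro ⟨u, v⟩ h
    simp only [Finset.mem_filter, Finset.mem_univ, true_and] at h
    simp [← h, cyclesCount_inv]

end

/-- For `μ ⊢ k`, a fixed `w` of cycle type `μ`, and all integers `p, q`: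
`∑_{λ ⊢ k} H_λ s_λ(1^p) s_λ(1^{-q}) χ^λ(μ) = ∑_{uv = w} p^{κ(u)} (-q)^{κ(v)}`. -/
theorem schur_specialization_character_identity (k : ℕ) (μ : Nat.Partition k)
    (w : Equiv.Perm (Fin k)) (hw : w.partition.parts = μ.parts) (p q : ℤ) :
    ∑ lam : Nat.Partition k,
        hookProd (partList lam) * schurSpec (partList lam) (p : ℚ)
          * schurSpec (partList lam) (-(q : ℚ)) * (symChar (partList lam) μ.parts : ℚ)
      = ∑ uv ∈ Finset.univ.filter
            (fun uv : Equiv.Perm (Fin k) × Equiv.Perm (Fin k) => uv.1 * uv.2 = w),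
          (p : ℚ) ^ cyclesCount uv.1 * (-(q : ℚ)) ^ cyclesCount uv.2 := by
  rw [pair_sum, ← hw]
  simp only [power_expand (w * _) (p : ℚ), Finset.sum_mul]
  rw [Finset.sum_comm]
  refine Finset.sum_congr rfl (fun lam _ => ?_)
  have h := congrArg (fun z : ℤ => (z : ℚ)) (char_central (partList lam) w (-q))
  simp only [Int.cast_mul, Int.cast_sum, Int.cast_pow] at h
  rw [contProd_cast _ (partList_antitone lam)] at h
  push_cast at h
  have h2 : ∀ v : Equiv.Perm (Fin k),
      schurSpec (partList lam) (p : ℚ) * (symChar (partList lam) (w * v).partition.parts : ℚ)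
        * (-(q : ℚ)) ^ cyclesCount v
      = schurSpec (partList lam) (p : ℚ) * ((-(q : ℚ)) ^ cyclesCount v
        * (symChar (partList lam) (w * v).partition.parts : ℚ)) := fun v => by ring
  simp only [h2]
  rw [← Finset.mul_sum, h]
  ring
end

section
/- Fix k ≥ 1 and m ≥ 1. There exists a polynomial F_k ∈ ℤ[p_1, …, p_m, q_1, …, q_m] with integer coefficients such that for all positive integers p_1, …, p_m and q_1 > q_2 > ⋯ > q_m ≥ 1 with k ≤ n := Σ_{i=1}^m p_i q_i, the normalized character of the shape σ = (q_1^{p_1}, q_2^{p_2}, …, q_m^{p_m}) satisfies χ̂^σ(k, 1^{n−k}) = F_k(p_1, …, p_m; q_1, …, q_m). Moreover (−1)^k F_k(1, …, 1; −1, …, −1) = (k+m−1)_k, where (N)_k = N(N−1)⋯(N−k+1). -/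
open MvPolynomial

/-- The union-of-rectangles shape `σ = (q_1^{p_1}, …, q_m^{p_m})`, as a list of parts. -/
def unionRectangles {m : ℕ} (p q : Fin m → ℕ) : List ℕ :=
  (List.ofFn fun i : Fin m => List.replicate (p i) (q i)).flatten

namespace RectProof

section PS
variable {A : Type*} [CommRing A]

/-- The linear factor `1 - c z`. -/
noncomputable def lin (c : A) : PowerSeries A := 1 - PowerSeries.C c * PowerSeries.X

/-- The geometric series `1 / (1 - c z)`. -/
noncomputable def ilin (c : A) : PowerSeries A := PowerSeries.mk fun n => c ^ n

lemma lin_mul_ilin (c : A) : lin c * ilin c = 1 := by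
  ext n
  rw [lin, sub_mul, one_mul, mul_assoc, map_sub, PowerSeries.coeff_C_mul]
  cases n with
  | zero => simp [ilin]
  | succ n =>
    rw [PowerSeries.coeff_succ_X_mul]
    simp [ilin, PowerSeries.coeff_one, pow_succ']

lemma coeff_ilin (c : A) (n : ℕ) : PowerSeries.coeff n (ilin c) = c ^ n := by simp [ilin]

lemma map_lin {B : Type*} [CommRing B] (f : A →+* B) (c : A) :
    PowerSeries.map f (lin c) = lin (f c) := by simp [lin]

lemma map_ilin {B : Type*} [CommRing B] (f : A →+* B) (c : A) :
    PowerSeries.map f (ilin c) = ilin (f c) := by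
  ext n; simp [ilin]

/-- `e z / (1 - t z)`. -/
noncomputable def mob (e t : A) : PowerSeries A := PowerSeries.C e * PowerSeries.X * ilin t

lemma hasSubst_mob (e t : A) : PowerSeries.HasSubst (mob e t) :=
  PowerSeries.HasSubst.of_constantCoeff_zero' (by simp [mob])

/-- substitution `z ↦ e z / (1 - t z)`. -/
noncomputable def sb (e t : A) : PowerSeries A →ₐ[A] PowerSeries A :=
  PowerSeries.substAlgHom (hasSubst_mob e t)

lemma sb_apply (e t : A) (u : PowerSeries A) : sb e t u = PowerSeries.subst (mob e t) u := by
  rw [sb, PowerSeries.coe_substAlgHom]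

lemma sb_X (e t : A) : sb e t PowerSeries.X = mob e t := by
  rw [sb_apply, PowerSeries.subst_X (hasSubst_mob e t)]

lemma sb_C (e t c : A) : sb e t (PowerSeries.C c) = PowerSeries.C c := by
  have := (sb e t).commutes c
  simpa [PowerSeries.algebraMap_apply] using this

lemma lin_mul_mob (e t : A) : lin t * mob e t = PowerSeries.C e * PowerSeries.X := by
  rw [mob, mul_left_comm, lin_mul_ilin, mul_one]

lemma eq_of_lin_mul {t : A} {u v : PowerSeries A} (h : lin t * u = lin t * v) : u = v := by
  calc u = lin t * ilin t * u := by rw [lin_mul_ilin, one_mul]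
    _ = ilin t * (lin t * u) := by ring
    _ = ilin t * (lin t * v) := by rw [h]
    _ = lin t * ilin t * v := by ring
    _ = v := by rw [lin_mul_ilin, one_mul]

lemma lin_mul_sb_lin (e t c : A) : lin t * sb e t (lin c) = lin (t + c * e) := by
  conv_lhs => rw [lin.eq_1 c]
  rw [map_sub, map_one, map_mul, sb_C, sb_X, mul_sub, mul_left_comm, lin_mul_mob, lin, lin]
  simp only [map_add, map_mul]
  ring

lemma sb_sb (e t e' t' : A) (u : PowerSeries A) :
    sb e t (sb e' t' u) = sb (e * e') (t + t' * e) u := by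
  rw [sb_apply, sb_apply, sb_apply,
    PowerSeries.subst_comp_subst_apply (hasSubst_mob _ _) (hasSubst_mob _ _)]
  congr 1
  rw [← sb_apply]
  apply eq_of_lin_mul (t := t + t' * e)
  rw [lin_mul_mob, ← lin_mul_sb_lin, mul_assoc, ← map_mul, lin_mul_mob, map_mul, sb_C, sb_X,
    mul_left_comm, lin_mul_mob, map_mul]
  ring

lemma sb_one_zero (u : PowerSeries A) : sb 1 0 u = u := by
  rw [sb_apply]
  have : mob (1 : A) 0 = PowerSeries.X := by
    have := lin_mul_mob (1 : A) 0
    simpa [lin] using this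
  rw [this, PowerSeries.X_subst]

/-- twisted substitution in degree `d`. -/
noncomputable def tw (e t : A) (d : ℕ) (u : PowerSeries A) : PowerSeries A :=
  lin t ^ d * sb e t u

lemma tw_mul (e t : A) (d d' : ℕ) (u v : PowerSeries A) :
    tw e t (d + d') (u * v) = tw e t d u * tw e t d' v := by
  simp only [tw, map_mul, pow_add]; ring

lemma tw_pow (e t : A) (d n : ℕ) (u : PowerSeries A) :
    tw e t (d * n) (u ^ n) = tw e t d u ^ n := by
  simp only [tw, map_pow, pow_mul, mul_pow]

lemma tw_tw (e t e' t' : A) (d : ℕ) (u : PowerSeries A) :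
    tw e t d (tw e' t' d u) = tw (e * e') (t + t' * e) d u := by
  simp only [tw, map_mul, map_pow, sb_sb, ← mul_assoc, ← mul_pow, lin_mul_sb_lin]

lemma tw_prod {ι : Type*} (s : Finset ι) (e t : A) (f : ι → PowerSeries A) :
    tw e t s.card (∏ i ∈ s, f i) = ∏ i ∈ s, tw e t 1 (f i) := by
  simp only [tw, map_prod, pow_one, Finset.prod_mul_distrib, Finset.prod_const]

lemma mob_pow_coeff_zero (e t : A) (d j : ℕ) (hj : d + 1 < j) :
    PowerSeries.coeff (d + 1) (lin t ^ d * mob e t ^ j) = 0 := by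
  have : (PowerSeries.X : PowerSeries A) ^ j ∣ lin t ^ d * mob e t ^ j :=
    ⟨lin t ^ d * (PowerSeries.C e * ilin t) ^ j, by rw [mob]; ring⟩
  exact PowerSeries.X_pow_dvd_iff.1 this _ hj

lemma coeff_lin_pow (t : A) (n j : ℕ) (h : n < j) : PowerSeries.coeff j (lin t ^ n) = 0 := by
  have : lin t = ((1 - Polynomial.C t * Polynomial.X : Polynomial A) : PowerSeries A) := by
    simp [lin]
  rw [this, ← Polynomial.coe_pow, Polynomial.coeff_coe]
  apply Polynomial.coeff_eq_zero_of_natDegree_lt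
  refine lt_of_le_of_lt ?_ h
  refine Polynomial.natDegree_pow_le_of_le n (m := 1) ?_ |>.trans (by simp)
  compute_degree

lemma coeff_tw_X_pow (e t : A) (d j : ℕ) :
    PowerSeries.coeff (d + 1) (lin t ^ d * mob e t ^ j) = if j = d + 1 then e ^ (d + 1) else 0 := by
  rcases lt_trichotomy j (d + 1) with h | h | h
  · rw [if_neg h.ne]
    obtain ⟨i, rfl⟩ := Nat.exists_eq_add_of_le (Nat.lt_succ_iff.1 h)
    rw [pow_add, mul_comm (lin t ^ j), mul_assoc, ← mul_pow, lin_mul_mob, mul_pow, ← map_pow,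
      mul_left_comm, PowerSeries.coeff_C_mul, PowerSeries.coeff_mul_X_pow', if_pos (by omega),
      coeff_lin_pow _ _ _ (by omega), mul_zero]
  · subst h
    rw [if_pos rfl, pow_succ (mob e t), ← mul_assoc, ← mul_pow, lin_mul_mob, mob, mul_pow,
      ← map_pow]
    have : PowerSeries.C (e ^ d) * PowerSeries.X ^ d * (PowerSeries.C e * PowerSeries.X * ilin t)
      = PowerSeries.C (e ^ (d + 1)) * (ilin t * PowerSeries.X ^ (d + 1)) := by
      rw [pow_succ e, map_mul]; ring
    rw [this, PowerSeries.coeff_C_mul, PowerSeries.coeff_mul_X_pow']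
    simp [coeff_ilin]
  · rw [if_neg h.ne', mob_pow_coeff_zero _ _ _ _ h]

lemma coeff_tw (e t : A) (d : ℕ) (u : PowerSeries A) :
    PowerSeries.coeff (d + 1) (tw e t d u) = e ^ (d + 1) * PowerSeries.coeff (d + 1) u := by
  obtain ⟨w, hw⟩ : ∃ w, u = (PowerSeries.trunc (d + 2) u : PowerSeries A)
      + PowerSeries.X ^ (d + 2) * w := by
    have : (PowerSeries.X : PowerSeries A) ^ (d + 2) ∣ u - (PowerSeries.trunc (d + 2) u : PowerSeries A) := by
      rw [PowerSeries.X_pow_dvd_iff]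
      intro m hm
      simp [PowerSeries.coeff_trunc, hm]
    obtain ⟨w, hw⟩ := this
    exact ⟨w, by rw [← hw]; ring⟩
  have h1 : (PowerSeries.trunc (d + 2) u : PowerSeries A)
     = ∑ i ∈ Finset.range (d + 2), PowerSeries.C (PowerSeries.coeff i u) * PowerSeries.X ^ i := by
    ext n
    simp [PowerSeries.coeff_trunc]
  have h0 : sb e t u = sb e t (∑ i ∈ Finset.range (d + 2),
      PowerSeries.C (PowerSeries.coeff i u) * PowerSeries.X ^ i) + mob e t ^ (d + 2) * sb e t w := by
    conv_lhs => rw [hw, h1]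
    rw [map_add, map_mul (sb e t) (PowerSeries.X ^ (d + 2)), map_pow, sb_X]
  rw [tw, h0, mul_add, map_add]
  have h2 : PowerSeries.coeff (d + 1) (lin t ^ d * (mob e t ^ (d + 2) * sb e t w)) = 0 := by
    have : (PowerSeries.X : PowerSeries A) ^ (d + 2) ∣ lin t ^ d * (mob e t ^ (d + 2) * sb e t w) :=
      ⟨lin t ^ d * (PowerSeries.C e * ilin t) ^ (d + 2) * sb e t w, by rw [mob]; ring⟩
    exact PowerSeries.X_pow_dvd_iff.1 this _ (by omega)
  rw [h2, add_zero, map_sum, Finset.mul_sum, map_sum]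
  simp_rw [map_mul, sb_C, map_pow, sb_X, mul_left_comm (lin t ^ d), PowerSeries.coeff_C_mul,
    coeff_tw_X_pow]
  simp [mul_comm]

/-- derivative with respect to `x = 1 / z` in degree `d`. -/
noncomputable def dd (d : ℕ) (u : PowerSeries A) : PowerSeries A :=
  (d : PowerSeries A) * u - PowerSeries.X * PowerSeries.derivative A u

lemma dd_mul (d d' : ℕ) (u v : PowerSeries A) :
    dd (d + d') (u * v) = dd d u * v + u * dd d' v := by
  simp only [dd, Derivation.leibniz, smul_eq_mul]
  push_cast; ring

lemma dd_one (d : ℕ) : dd d (1 : PowerSeries A) = d := by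
  simp [dd]

lemma dd_pow (d n : ℕ) (u : PowerSeries A) :
    dd (d * (n + 1)) (u ^ (n + 1)) = (n + 1 : ℕ) * (u ^ n * dd d u) := by
  induction n with
  | zero => simp
  | succ n ih =>
    rw [pow_succ, mul_add d, mul_one, dd_mul, ih]
    push_cast; ring

lemma dd_prod {ι : Type*} [DecidableEq ι] (s : Finset ι) (f : ι → PowerSeries A) :
    dd s.card (∏ i ∈ s, f i) = ∑ i ∈ s, dd 1 (f i) * ∏ j ∈ s.erase i, f j := by
  induction s using Finset.induction_on with
  | empty => simp [dd]
  | insert a s ha ih =>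
    rw [Finset.prod_insert ha, Finset.card_insert_of_notMem ha, add_comm, dd_mul, ih,
      Finset.sum_insert ha, Finset.erase_insert ha, Finset.mul_sum]
    congr 1
    apply Finset.sum_congr rfl
    intro i hi
    have hne : a ≠ i := fun h => ha (h ▸ hi)
    rw [Finset.erase_insert_of_ne hne, Finset.prod_insert (fun h => ha (Finset.mem_of_mem_erase h))]
    ring

lemma coeff_dd (d n : ℕ) (u : PowerSeries A) :
    PowerSeries.coeff n (dd d u) = ((d : A) - n) * PowerSeries.coeff n u := by
  rw [dd, map_sub, ← map_natCast (PowerSeries.C (R := A)), PowerSeries.coeff_C_mul]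
  cases n with
  | zero => simp
  | succ n =>
    rw [PowerSeries.coeff_succ_X_mul, PowerSeries.coeff_derivative]
    push_cast; ring

lemma dd_tw_one (e t : A) (u : PowerSeries A) :
    dd 1 (tw e t 1 u) = tw e t 0 (dd 1 u) := by
  have hder : PowerSeries.derivative A (sb e t u)
      = sb e t (PowerSeries.derivative A u) * PowerSeries.derivative A (mob e t) := by
    rw [sb_apply, PowerSeries.derivative_subst (hasSubst_mob e t), sb_apply]
  have hl : PowerSeries.derivative A (lin t) = - PowerSeries.C t := by
    simp [lin]
  have hm : lin t * PowerSeries.derivative A (mob e t) = PowerSeries.C e + PowerSeries.C t * mob e t := by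
    have := congrArg (PowerSeries.derivative A) (lin_mul_mob e t)
    rw [Derivation.leibniz, hl, Derivation.leibniz] at this
    simp at this
    linear_combination this
  have hX : PowerSeries.X * (PowerSeries.C e + PowerSeries.C t * mob e t) = mob e t := by
    apply eq_of_lin_mul (t := t)
    have := lin_mul_mob e t
    have h3 : lin t = 1 - PowerSeries.C t * PowerSeries.X := rfl
    linear_combination (PowerSeries.C t * PowerSeries.X - 1) * this + PowerSeries.C e * PowerSeries.X * h3
  simp only [tw, dd, pow_one, pow_zero, one_mul, Nat.cast_one, Derivation.leibniz, smul_eq_mul, hl,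
    hder, map_sub, map_mul, sb_X]
  have h3 : lin t = 1 - PowerSeries.C t * PowerSeries.X := rfl
  linear_combination (-PowerSeries.X * sb e t (PowerSeries.derivative A u)) * hm -
    sb e t (PowerSeries.derivative A u) * hX + sb e t u * h3

lemma map_mob {B : Type*} [CommRing B] (f : A →+* B) (e t : A) :
    PowerSeries.map f (mob e t) = mob (f e) (f t) := by
  simp [mob, map_ilin]

lemma map_sb {B : Type*} [CommRing B] (f : A →+* B) (e t : A) (u : PowerSeries A) :
    PowerSeries.map f (sb e t u) = sb (f e) (f t) (PowerSeries.map f u) := by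
  rw [sb_apply, sb_apply, ← map_mob]
  exact PowerSeries.map_subst (hasSubst_mob e t) u

lemma map_tw {B : Type*} [CommRing B] (f : A →+* B) (e t : A) (d : ℕ) (u : PowerSeries A) :
    PowerSeries.map f (tw e t d u) = tw (f e) (f t) d (PowerSeries.map f u) := by
  simp [tw, map_lin, map_sb]

lemma map_dd {B : Type*} [CommRing B] (f : A →+* B) (d : ℕ) (u : PowerSeries A) :
    PowerSeries.map f (dd d u) = dd d (PowerSeries.map f u) := by
  ext n
  simp [coeff_dd]

end PS
section Integrality
variable {A : Type*} [CommRing A]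

lemma tw_succ_mul (s : A) (w v : PowerSeries A) (d : ℕ) {n : ℕ} (h : d + 1 = n) :
    tw 1 s n (w * v) = lin s * tw 1 s 0 w * tw 1 s d v := by
  subst h
  simp only [tw, map_mul, pow_succ, pow_zero]
  ring

lemma coeff_norm_zmod (k : ℕ) [NeZero k] [Algebra (ZMod k) A] (g : PowerSeries A) :
    PowerSeries.coeff (k + 1) (∏ t : ZMod k, tw 1 (algebraMap (ZMod k) A t) 1 g)
      = - (algebraMap (ZMod k) A (∑ u : ZMod k, u)) *
        PowerSeries.coeff k (dd 1 g *
          ∏ t ∈ (Finset.univ : Finset (ZMod k)).erase 0, tw 1 (algebraMap (ZMod k) A t) 1 g) := by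
  set a := algebraMap (ZMod k) A with ha
  set Q := dd 1 g * ∏ t ∈ (Finset.univ : Finset (ZMod k)).erase 0, tw 1 (a t) 1 g with hQ
  have hk0 : (k : A) = 0 := by
    have : a (k : ZMod k) = (k : A) := map_natCast a k
    rw [← this, ZMod.natCast_self, map_zero]
  have hcard : (Finset.univ : Finset (ZMod k)).card = k := by
    rw [Finset.card_univ, ZMod.card]
  have hk1 : 1 ≤ k := NeZero.one_le
  have h1 := dd_prod (Finset.univ : Finset (ZMod k)) (fun t => tw 1 (a t) 1 g)
  rw [hcard] at h1
  have h2 := congrArg (PowerSeries.coeff (k + 1)) h1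
  rw [coeff_dd, map_sum] at h2
  have h3 : ∀ u : ZMod k, PowerSeries.coeff (k + 1) (dd 1 (tw 1 (a u) 1 g) *
      ∏ t ∈ (Finset.univ : Finset (ZMod k)).erase u, tw 1 (a t) 1 g)
      = PowerSeries.coeff (k + 1) Q + a u * PowerSeries.coeff k Q := by
    intro u
    have hc : ((Finset.univ : Finset (ZMod k)).erase u).card + 1 = k := by
      rw [Finset.card_erase_add_one (Finset.mem_univ _), hcard]
    have h4 := coeff_tw 1 (-a u) k (dd 1 (tw 1 (a u) 1 g) *
      ∏ t ∈ (Finset.univ : Finset (ZMod k)).erase u, tw 1 (a t) 1 g)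
    rw [one_pow, one_mul] at h4
    rw [← h4]
    have h5 : tw 1 (-a u) k (dd 1 (tw 1 (a u) 1 g) *
      ∏ t ∈ (Finset.univ : Finset (ZMod k)).erase u, tw 1 (a t) 1 g) = lin (-a u) * Q := by
      have h6 : ∀ v : PowerSeries A, tw 1 (-a u) k (dd 1 (tw 1 (a u) 1 g) * v)
        = lin (-a u) * (dd 1 g * tw 1 (-a u) ((Finset.univ : Finset (ZMod k)).erase u).card v) := by
        intro v
        rw [tw_succ_mul _ _ _ _ hc, dd_tw_one, tw_tw]
        have : tw ((1 : A) * 1) (-a u + a u * 1) 0 (dd 1 g) = tw 1 0 0 (dd 1 g) := by norm_num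
        rw [this, tw, sb_one_zero, pow_zero, one_mul, mul_assoc]
      rw [h6, tw_prod, hQ]
      congr 2
      refine Finset.prod_bij' (fun t _ => t - u) (fun t _ => t + u) ?_ ?_ ?_ ?_ ?_
      · intro t ht; simpa [sub_eq_zero] using ht
      · intro t ht; simpa using ht
      · intro t ht; simp
      · intro t ht; simp
      · intro t ht
        rw [tw_tw, map_sub]
        congr 1 <;> ring
    rw [h5, lin, sub_mul, one_mul, map_sub, mul_assoc, PowerSeries.coeff_C_mul,
      PowerSeries.coeff_succ_X_mul]
    ring
  simp_rw [h3] at h2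
  rw [Finset.sum_add_distrib, Finset.sum_const, hcard, nsmul_eq_mul, hk0, ← Finset.sum_mul,
    ← map_sum] at h2
  push_cast at h2
  rw [hk0] at h2
  linear_combination -h2

lemma coeff_reflect [IsDomain A] [CharZero A] (n : ℕ) (g : PowerSeries A) :
    PowerSeries.coeff (2 * n + 2) (dd 1 g * tw (-1) 1 1 g * (g * tw (-1) 1 1 g) ^ n) = 0 := by
  set γ := tw (-1) 1 1 g with hγ
  have h1 : tw (-1) 1 1 γ = g := by
    rw [hγ, tw_tw]
    have : tw ((-1 : A) * -1) (1 + 1 * -1) 1 g = tw 1 0 1 g := by norm_num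
    rw [this, tw, sb_one_zero]
    simp [lin]
  set θ := dd 1 g * γ with hθ
  have h2 : dd 2 (g * γ) = θ + tw (-1) 1 1 θ := by
    rw [show 2 = 1 + 1 from rfl, dd_mul, hθ]
    congr 1
    rw [show tw (-1) 1 1 (dd 1 g * γ) = tw (-1) 1 0 (dd 1 g) * tw (-1) 1 1 γ from
      tw_mul (-1) 1 0 1 _ _, h1, hγ, dd_tw_one, mul_comm]
  have h3 : tw (-1) 1 2 (g * γ) = g * γ := by
    rw [show tw (-1) 1 2 (g * γ) = tw (-1) 1 1 g * tw (-1) 1 1 γ from tw_mul (-1) 1 1 1 _ _, h1,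
      ← hγ, mul_comm]
  have h4 := dd_pow 2 n (g * γ)
  have h5 := congrArg (PowerSeries.coeff (2 * n + 2)) h4
  rw [coeff_dd] at h5
  have h6 : tw (-1) 1 (2 * n + 1) (θ * (g * γ) ^ n) = (g * γ) ^ n * tw (-1) 1 1 θ := by
    rw [add_comm, tw_mul, tw_pow, h3, mul_comm]
  have h7 := coeff_tw (-1) 1 (2 * n + 1) (θ * (g * γ) ^ n)
  rw [h6, show 2 * n + 1 + 1 = 2 * (n + 1) by ring, pow_mul] at h7
  rw [h2, mul_add ((g * γ) ^ n), ← map_natCast (PowerSeries.C (R := A)), PowerSeries.coeff_C_mul, map_add,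
    show 2 * n + 2 = 2 * (n + 1) by ring, h7, mul_comm ((g * γ) ^ n)] at h5
  rw [show 2 * n + 2 = 2 * (n + 1) by ring]
  have h8 : ((2 * (n + 1) : ℕ) : A) * PowerSeries.coeff (2 * (n + 1)) (θ * (g * γ) ^ n) = 0 := by
    push_cast at h5 ⊢
    simp only [sub_self, zero_mul, even_two, Even.neg_pow, one_pow, one_mul] at h5
    linear_combination -h5
  rcases mul_eq_zero.1 h8 with h | h
  · exact absurd h (Nat.cast_ne_zero.2 (by omega))
  · exact h

lemma prod_zmod_eq {B : Type*} [CommRing B] (k : ℕ) [NeZero k] [Algebra (ZMod k) B] {M : Type*} [CommMonoid M]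
    (f : B → M) : ∏ t : ZMod k, f (algebraMap (ZMod k) B t) = ∏ t ∈ Finset.range k, f (t : B) := by
  refine Finset.prod_bij' (fun t _ => t.val) (fun t _ => (t : ZMod k)) ?_ ?_ ?_ ?_ ?_
  · intro t _; simpa using ZMod.val_lt t
  · intro t _; simp
  · intro t _; simp
  · intro t ht; exact ZMod.val_cast_of_lt (Finset.mem_range.1 ht)
  · intro t _
    rw [← map_natCast (algebraMap (ZMod k) B), ZMod.natCast_zmod_val]

lemma prod_zmod_erase_eq {B : Type*} [CommRing B] (k : ℕ) [NeZero k] [Algebra (ZMod k) B] {M : Type*} [CommMonoid M]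
    (f : B → M) : ∏ t ∈ (Finset.univ : Finset (ZMod k)).erase 0, f (algebraMap (ZMod k) B t)
      = ∏ t ∈ Finset.Ico 1 k, f (t : B) := by
  refine Finset.prod_bij' (fun t _ => t.val) (fun t _ => (t : ZMod k)) ?_ ?_ ?_ ?_ ?_
  · intro t ht
    have h0 : t ≠ 0 := by simpa using ht
    have := ZMod.val_lt t
    have h1 : t.val ≠ 0 := by rwa [Ne, ZMod.val_eq_zero]
    simp; omega
  · intro t ht
    have ht := Finset.mem_Ico.1 ht
    have : (t : ZMod k) ≠ 0 := by
      intro h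
      have := congrArg ZMod.val h
      rw [ZMod.val_cast_of_lt ht.2] at this
      simp at this; omega
    simpa using this
  · intro t _; simp
  · intro t ht; exact ZMod.val_cast_of_lt (Finset.mem_Ico.1 ht).2
  · intro t _
    rw [← map_natCast (algebraMap (ZMod k) B), ZMod.natCast_zmod_val]

lemma prod_char_two {B : Type*} [CommRing B] (h2 : (2 : B) = 0) {M : Type*} [CommMonoid M]
    (f : B → M) (n : ℕ) :
    ∏ t ∈ Finset.Ico 1 (2 * n + 2), f (t : B) = f 1 * (f 0 * f 1) ^ n := by
  induction n with
  | zero => simp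
  | succ n ih =>
    rw [show 2 * (n + 1) + 2 = (2 * n + 2) + 1 + 1 by ring, Finset.prod_Ico_succ_top (by omega),
      Finset.prod_Ico_succ_top (by omega), ih]
    have e1 : ((2 * n + 2 : ℕ) : B) = 0 := by push_cast; rw [h2]; ring
    have e2 : ((2 * n + 2 + 1 : ℕ) : B) = 1 := by rw [Nat.cast_add, e1]; simp
    rw [e1, e2, pow_succ, mul_assoc, mul_assoc]

lemma even_coeff {τ : Type*} (n : ℕ) (g : PowerSeries (MvPolynomial τ ℤ)) :
    ∃ r : MvPolynomial τ ℤ, PowerSeries.coeff (2 * n + 2) (dd 1 g *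
      ∏ t ∈ Finset.Ico 1 (2 * n + 2), tw 1 (t : MvPolynomial τ ℤ) 1 g) = 2 * r := by
  set f := MvPolynomial.map (σ := τ) (Int.castRingHom (ZMod 2)) with hf
  have h2 : (2 : MvPolynomial τ (ZMod 2)) = 0 := by
    have : (2 : MvPolynomial τ (ZMod 2)) = algebraMap (ZMod 2) _ 2 := (map_ofNat _ 2).symm
    rw [this, show (2 : ZMod 2) = 0 from rfl, map_zero]
  have key : f (PowerSeries.coeff (2 * n + 2) (dd 1 g *
      ∏ t ∈ Finset.Ico 1 (2 * n + 2), tw 1 (t : MvPolynomial τ ℤ) 1 g)) = 0 := by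
    rw [← PowerSeries.coeff_map, map_mul, map_prod, map_dd]
    simp_rw [map_tw, map_one, map_natCast]
    have hg := congrArg f (coeff_reflect n g)
    rw [← PowerSeries.coeff_map, map_mul (PowerSeries.map f), map_mul (PowerSeries.map f),
      map_pow (PowerSeries.map f), map_mul (PowerSeries.map f), map_dd, map_tw, map_zero,
      map_neg, map_one] at hg
    have hneg : (-1 : MvPolynomial τ (ZMod 2)) = 1 := by
      linear_combination -h2
    rw [hneg] at hg
    rw [prod_char_two h2 (fun t => tw 1 t 1 (PowerSeries.map f g)), ← mul_assoc]
    have h0 : tw 1 0 1 (PowerSeries.map f g) = PowerSeries.map f g := by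
      rw [tw, sb_one_zero]; simp [lin]
    rw [h0]
    exact hg
  have := (MvPolynomial.C_dvd_iff_zmod 2 _).2 key
  obtain ⟨r, hr⟩ := this
  exact ⟨r, by rw [hr]; simp⟩

lemma dvd_coeff_norm {τ : Type*} (k : ℕ) (hk : 1 ≤ k) (g : PowerSeries (MvPolynomial τ ℤ)) :
    ∃ r : MvPolynomial τ ℤ, PowerSeries.coeff (k + 1)
      (∏ t ∈ Finset.range k, tw 1 (t : MvPolynomial τ ℤ) 1 g) = (k : MvPolynomial τ ℤ) * r := by
  have : NeZero k := ⟨by omega⟩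
  set f := MvPolynomial.map (σ := τ) (Int.castRingHom (ZMod k)) with hf
  have key : f (PowerSeries.coeff (k + 1)
      (∏ t ∈ Finset.range k, tw 1 (t : MvPolynomial τ ℤ) 1 g)) = 0 := by
    have h1 := coeff_norm_zmod k (PowerSeries.map f g)
    rw [prod_zmod_eq k (fun t => tw 1 t 1 (PowerSeries.map f g)),
      prod_zmod_erase_eq k (fun t => tw 1 t 1 (PowerSeries.map f g)),
      show (∑ u : ZMod k, u) = ∑ u : ZMod k, algebraMap (ZMod k) (ZMod k) u from rfl] at h1
    have hs : ∑ u : ZMod k, algebraMap (ZMod k) (ZMod k) u = ∑ t ∈ Finset.range k, (t : ZMod k) :=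
      prod_zmod_eq (M := Multiplicative (ZMod k)) k Multiplicative.ofAdd
    rw [hs] at h1
    rw [← PowerSeries.coeff_map, map_prod]
    simp_rw [map_tw, map_one, map_natCast]
    rw [h1, ← Nat.cast_sum]
    have hgs := Finset.sum_range_id_mul_two k
    rcases Nat.even_or_odd k with he | ho
    · obtain ⟨n, rfl⟩ : ∃ n, k = 2 * n + 2 := by
        obtain ⟨m, hm⟩ := he
        exact ⟨m - 1, by omega⟩
      obtain ⟨r, hr⟩ := even_coeff n g
      have hr' := congrArg f hr
      rw [← PowerSeries.coeff_map, map_mul, map_prod, map_dd] at hr'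
      simp_rw [map_tw, map_one, map_natCast] at hr'
      rw [hr', map_mul, map_ofNat, map_natCast, neg_mul, ← mul_assoc]
      have : ((∑ i ∈ Finset.range (2 * n + 2), i : ℕ) : MvPolynomial τ (ZMod (2 * n + 2))) * 2 = 0 := by
        have h9 : ((∑ i ∈ Finset.range (2 * n + 2), i : ℕ) : ZMod (2 * n + 2)) * 2 = 0 := by
          have := congrArg (Nat.cast (R := ZMod (2 * n + 2))) hgs
          rw [Nat.cast_mul, Nat.cast_mul, ZMod.natCast_self, zero_mul] at this
          exact_mod_cast this
        have := congrArg (algebraMap (ZMod (2 * n + 2)) (MvPolynomial τ (ZMod (2 * n + 2)))) h9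
        rw [map_mul, map_natCast, map_ofNat, map_zero] at this
        exact this
      rw [this, zero_mul, neg_zero]
    · obtain ⟨n, rfl⟩ := ho
      have h9 : ∑ i ∈ Finset.range (2 * n + 1), i = (2 * n + 1) * n := by
        have : 2 * n + 1 - 1 = 2 * n := by omega
        rw [this] at hgs
        nlinarith
      rw [h9, Nat.cast_mul, ZMod.natCast_self, zero_mul, map_zero, neg_zero, zero_mul]
  obtain ⟨r, hr⟩ := (MvPolynomial.C_dvd_iff_zmod k _).2 key
  exact ⟨r, by rw [hr]; simp⟩

end Integrality
section Frob

/-- Vandermonde product. -/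
def Vd {R : Type*} [CommRing R] {r : ℕ} (v : Fin r → R) : R :=
  ∏ p ∈ Finset.univ.filter (fun p : Fin r × Fin r => p.1 < p.2), (v p.1 - v p.2)

lemma Vd_eq_det {R : Type*} [CommRing R] {r : ℕ} (v : Fin r → R) :
    Vd v = (Matrix.vandermonde (fun i => v (Fin.rev i))).det := by
  rw [Matrix.det_vandermonde, Finset.prod_sigma', Vd]
  refine Finset.prod_bij' (fun p _ => ⟨Fin.rev p.2, Fin.rev p.1⟩)
    (fun p _ => (Fin.rev p.2, Fin.rev p.1)) ?_ ?_ ?_ ?_ ?_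
  · intro p hp; simpa using hp
  · intro p hp; simpa using hp
  · intro p hp; simp
  · intro p hp; simp
  · intro p hp; simp

/-- exponent of the term of a permutation. -/
noncomputable def ex {r : ℕ} (π : Equiv.Perm (Fin r)) : Fin r →₀ ℕ :=
  Finsupp.equivFunOnFinite.symm (fun j => ((π⁻¹ (Fin.rev j) : Fin r) : ℕ))

lemma vandermondeMv_eq (r : ℕ) : vandermondeMv r =
    ∑ π : Equiv.Perm (Fin r), (Equiv.Perm.sign π : ℤ) • MvPolynomial.monomial (ex π) (1 : ℤ) := by
  have : vandermondeMv r = Vd (fun i : Fin r => (X i : MvPolynomial (Fin r) ℤ)) := rfl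
  rw [this, Vd_eq_det, Matrix.det_apply]
  apply Finset.sum_congr rfl
  intro π _
  rw [Units.smul_def]
  congr 1
  rw [MvPolynomial.monomial_eq, map_one, one_mul, Finsupp.prod_fintype _ _ (by simp)]
  conv_rhs => rw [← Equiv.prod_comp (π.trans Fin.revPerm)]
  apply Finset.prod_congr rfl
  intro i _
  simp [Matrix.vandermonde_apply, ex]

lemma multinomial_mul {r : ℕ} (d : Fin r →₀ ℕ) :
    (∏ i, (d i).factorial) * d.multinomial = (∑ i, d i).factorial := by
  rw [Finsupp.multinomial_eq]
  have h := Nat.multinomial_spec d.support d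
  rw [Finset.prod_subset (Finset.subset_univ d.support) (by
      intro x _ hx; simp [Finsupp.notMem_support_iff.1 hx]),
    Finset.sum_subset (Finset.subset_univ d.support) (by
      intro x _ hx; simp [Finsupp.notMem_support_iff.1 hx])] at h
  exact h

lemma sum_ex {r : ℕ} (π : Equiv.Perm (Fin r)) : ∑ j, ex π j = ∑ i : Fin r, (i : ℕ) := by
  simp only [ex, Finsupp.equivFunOnFinite_symm_apply_apply]
  rw [← Equiv.sum_comp (π.trans Fin.revPerm)]
  simp

lemma frob (r N : ℕ) (v : Fin r → ℕ) (hv : ∑ i, v i = N + ∑ i : Fin r, (i : ℕ)) :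
    MvPolynomial.coeff (Finsupp.equivFunOnFinite.symm v) (vandermondeMv r * powerSumMv r 1 ^ N)
      * ∏ i, ((v i).factorial : ℤ) = N.factorial * Vd (fun i => (v i : ℤ)) := by
  set v' := Finsupp.equivFunOnFinite.symm v with hv'
  have hvi : ∀ i, v' i = v i := fun i => rfl
  rw [vandermondeMv_eq, Finset.sum_mul, MvPolynomial.coeff_sum, Finset.sum_mul, Vd_eq_det,
    Matrix.det_eval_matrixOfPolynomials_eq_det_vandermonde _ (fun i => descPochhammer ℤ i)
      (fun i => descPochhammer_natDegree ℤ i) (fun i => monic_descPochhammer ℤ i),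
    Matrix.det_apply, Finset.mul_sum]
  apply Finset.sum_congr rfl
  intro π _
  rw [smul_mul_assoc, MvPolynomial.coeff_smul, MvPolynomial.coeff_monomial_mul', one_mul,
    Units.smul_def, smul_mul_assoc, mul_smul_comm]
  congr 1
  have hp : powerSumMv r 1 = ∑ i, X i := by simp [powerSumMv]
  have hprod : ∏ i, Matrix.of (fun i j : Fin r => (descPochhammer ℤ (j : ℕ)).eval ((v (Fin.rev i) : ℕ) : ℤ))
      (π i) i = ∏ j, (((v j).descFactorial (ex π j) : ℕ) : ℤ) := by
    conv_rhs => rw [← Equiv.prod_comp (π.trans Fin.revPerm)]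
    apply Finset.prod_congr rfl
    intro i _
    simp [ex, descPochhammer_eval_eq_descFactorial]
  rw [hprod, hp]
  split_ifs with hle
  · rw [MvPolynomial.coeff_sum_X_pow_of_fintype]
    have hle' : ∀ j, ex π j ≤ v j := fun j => hle j
    have hsum : ∑ j, (v' - ex π) j = N := by
      have h1 : ∑ j, (v' - ex π) j + ∑ j, ex π j = ∑ j, v j := by
        rw [← Finset.sum_add_distrib]
        apply Finset.sum_congr rfl
        intro j _
        rw [Finsupp.tsub_apply, hvi]
        exact Nat.sub_add_cancel (hle' j)
      rw [sum_ex, hv] at h1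
      omega
    rw [Finsupp.sum_fintype _ _ (by simp), if_pos hsum]
    have h2 := multinomial_mul (v' - ex π)
    rw [hsum] at h2
    have h3 : ∀ j, (v j).factorial = ((v' - ex π) j).factorial * (v j).descFactorial (ex π j) := by
      intro j
      rw [Finsupp.tsub_apply, hvi, Nat.factorial_mul_descFactorial (hle' j)]
    rw [← h2]
    simp_rw [h3]
    push_cast
    rw [Finset.prod_mul_distrib]
    ring
  · rw [zero_mul]
    have : ∃ j, v j < ex π j := by
      by_contra! h
      exact hle (fun j => h j)
    obtain ⟨j, hj⟩ := this
    rw [Finset.prod_eq_zero (Finset.mem_univ j), mul_zero]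
    rw [Nat.descFactorial_eq_zero_iff_lt.2 hj]; rfl

lemma frob_k (r k : ℕ) (v : Fin r → ℕ) (P : MvPolynomial (Fin r) ℤ) :
    MvPolynomial.coeff (Finsupp.equivFunOnFinite.symm v) (powerSumMv r k * P)
    = ∑ j, if k ≤ v j then
      MvPolynomial.coeff (Finsupp.equivFunOnFinite.symm (Function.update v j (v j - k))) P else 0 := by
  rw [powerSumMv, Finset.sum_mul, MvPolynomial.coeff_sum]
  apply Finset.sum_congr rfl
  intro j _
  rw [MvPolynomial.X_pow_eq_monomial, MvPolynomial.coeff_monomial_mul', one_mul]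
  have h1 : (Finsupp.single j k ≤ Finsupp.equivFunOnFinite.symm v) ↔ k ≤ v j := by
    rw [Finsupp.single_le_iff]; rfl
  simp only [h1]
  split_ifs with h
  · congr 1
    ext i
    rw [Finsupp.tsub_apply]
    by_cases hi : i = j
    · subst hi; simp
    · simp [Function.update_of_ne hi, Ne.symm hi]
  · rfl

lemma Vd_split {R : Type*} [CommRing R] {r : ℕ} (j : Fin r) (w : Fin r → R) :
    Vd w = (∏ p ∈ Finset.univ.filter (fun p : Fin r × Fin r => p.1 < p.2 ∧ p.1 ≠ j ∧ p.2 ≠ j),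
        (w p.1 - w p.2)) * (∏ i ∈ Finset.univ.erase j, if i < j then (-1 : R) else 1) *
        ∏ i ∈ Finset.univ.erase j, (w j - w i) := by
  rw [mul_assoc, ← Finset.prod_mul_distrib, Vd,
    ← Finset.prod_filter_mul_prod_filter_not _ (fun p : Fin r × Fin r => p.1 ≠ j ∧ p.2 ≠ j),
    Finset.filter_filter]
  congr 1
  refine Finset.prod_bij' (fun p _ => if p.1 = j then p.2 else p.1)
    (fun i _ => if i < j then (i, j) else (j, i)) ?_ ?_ ?_ ?_ ?_
  all_goals simp only [Finset.mem_filter, Finset.mem_univ, true_and, Finset.mem_erase, and_true,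
    Prod.forall]
  · grind
  · grind
  · grind
  · grind
  · rintro a b ⟨hab, h⟩
    by_cases ha : a = j
    · subst ha; simp [not_lt_of_gt hab]
    · have hb : b = j := by tauto
      subst hb
      simp [ha, hab]

lemma Vd_update {R : Type*} [CommRing R] {r : ℕ} (j : Fin r) (w : Fin r → R) (y : R) :
    Vd (Function.update w j y) * ∏ i ∈ Finset.univ.erase j, (w j - w i) =
      Vd w * ∏ i ∈ Finset.univ.erase j, (y - w i) := by
  rw [Vd_split j w, Vd_split j (Function.update w j y)]
  have h1 : ∏ i ∈ Finset.univ.erase j, (Function.update w j y j - Function.update w j y i)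
      = ∏ i ∈ Finset.univ.erase j, (y - w i) := by
    apply Finset.prod_congr rfl
    intro i hi
    rw [Function.update_self, Function.update_of_ne (Finset.ne_of_mem_erase hi)]
  have h2 : ∏ p ∈ Finset.univ.filter (fun p : Fin r × Fin r => p.1 < p.2 ∧ p.1 ≠ j ∧ p.2 ≠ j),
        (Function.update w j y p.1 - Function.update w j y p.2) =
      ∏ p ∈ Finset.univ.filter (fun p : Fin r × Fin r => p.1 < p.2 ∧ p.1 ≠ j ∧ p.2 ≠ j),
        (w p.1 - w p.2) := by
    apply Finset.prod_congr rfl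
    intro p hp
    simp only [Finset.mem_filter, Finset.mem_univ, true_and] at hp
    rw [Function.update_of_ne hp.2.1, Function.update_of_ne hp.2.2]
  rw [h1, h2]; ring

lemma Vd_ne_zero {r : ℕ} (v : Fin r → ℤ) (hv : Function.Injective v) : Vd v ≠ 0 := by
  rw [Vd, Finset.prod_ne_zero_iff]
  intro p hp
  simp only [Finset.mem_filter, Finset.mem_univ, true_and] at hp
  intro h
  exact hp.ne (hv (sub_eq_zero.1 h))

lemma normalized (r k n : ℕ) (hkn : k ≤ n) (v : Fin r → ℕ) (hinj : Function.Injective v)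
    (hv : ∑ i, v i = n + ∑ i : Fin r, (i : ℕ)) :
    (n.descFactorial k : ℚ) *
      (MvPolynomial.coeff (Finsupp.equivFunOnFinite.symm v)
        (vandermondeMv r * (powerSumMv r k * powerSumMv r 1 ^ (n - k))) : ℤ) /
      (MvPolynomial.coeff (Finsupp.equivFunOnFinite.symm v)
        (vandermondeMv r * powerSumMv r 1 ^ n) : ℤ) =
    ∑ j, ((v j).descFactorial k : ℚ) *
      ((∏ i ∈ Finset.univ.erase j, ((v j : ℚ) - k - v i)) /
        ∏ i ∈ Finset.univ.erase j, ((v j : ℚ) - v i)) := by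
  have hinjZ : Function.Injective (fun i => (v i : ℤ)) := fun a b h => hinj (by simpa using h)
  have hV := Vd_ne_zero _ hinjZ
  have h1 := frob r n v hv
  set c1 := MvPolynomial.coeff (Finsupp.equivFunOnFinite.symm v)
        (vandermondeMv r * powerSumMv r 1 ^ n) with hc1
  have hc0 : c1 ≠ 0 := by
    intro h0
    rw [h0, zero_mul] at h1
    exact (mul_ne_zero (by exact_mod_cast Nat.factorial_ne_zero n) hV) h1.symm
  rw [mul_left_comm, frob_k, div_eq_iff (by exact_mod_cast hc0), Int.cast_sum, Finset.mul_sum,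
    Finset.sum_mul]
  apply Finset.sum_congr rfl
  intro j _
  split_ifs with hj
  · set w := Function.update v j (v j - k) with hw
    have hwsum : ∑ i, w i = (n - k) + ∑ i : Fin r, (i : ℕ) := by
      have e1 : ∑ i, w i + k = ∑ i, v i := by
        rw [hw, Finset.sum_update_of_mem (Finset.mem_univ j),
          ← Finset.add_sum_erase _ v (Finset.mem_univ j), Finset.sdiff_singleton_eq_erase]
        omega
      omega
    have h2 := frob r (n - k) w hwsum
    set c2 := MvPolynomial.coeff (Finsupp.equivFunOnFinite.symm w)
        (vandermondeMv r * powerSumMv r 1 ^ (n - k)) with hc2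
    have h3 := Vd_update j (fun i => (v i : ℤ)) ((v j : ℤ) - k)
    have h4 : Function.update (fun i => (v i : ℤ)) j ((v j : ℤ) - k) = fun i => (w i : ℤ) := by
      funext i
      by_cases hi : i = j
      · subst hi; simp [hw, hj]
      · simp [hw, Function.update_of_ne hi]
    rw [h4] at h3
    have hE : ∏ i ∈ Finset.univ.erase j, ((v j : ℚ) - v i) ≠ 0 := by
      rw [Finset.prod_ne_zero_iff]
      intro i hi h
      have : (v j : ℚ) = v i := sub_eq_zero.1 h
      exact Finset.ne_of_mem_erase hi (hinj (by exact_mod_cast this.symm))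
    have h5 : (∏ i, ((v i).factorial : ℤ)) = (∏ i, ((w i).factorial : ℤ)) * (v j).descFactorial k := by
      rw [← Finset.mul_prod_erase _ _ (Finset.mem_univ j),
        ← Finset.mul_prod_erase _ (fun i => ((w i).factorial : ℤ)) (Finset.mem_univ j)]
      have : ∏ i ∈ Finset.univ.erase j, ((w i).factorial : ℤ)
          = ∏ i ∈ Finset.univ.erase j, ((v i).factorial : ℤ) := by
        apply Finset.prod_congr rfl
        intro i hi
        rw [hw, Function.update_of_ne (Finset.ne_of_mem_erase hi)]
      rw [this, ← Nat.factorial_mul_descFactorial hj, hw, Function.update_self]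
      push_cast; ring
    have h6 := Nat.factorial_mul_descFactorial hkn
    have hD : (∏ i, ((w i).factorial : ℤ)) ≠ 0 := by
      rw [Finset.prod_ne_zero_iff]; intro i _; exact_mod_cast Nat.factorial_ne_zero _
    set D := (∏ i, ((w i).factorial : ℤ))
    rw [h5] at h1
    have g1 : (c1 : ℚ) * ((D : ℚ) * (v j).descFactorial k) = n.factorial * (Vd fun i => (v i : ℤ) : ℤ) := by
      exact_mod_cast h1
    have g2 : (c2 : ℚ) * D = (n - k).factorial * (Vd fun i => (w i : ℤ) : ℤ) := by
      exact_mod_cast h2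
    have g3 : ((Vd fun i => (w i : ℤ) : ℤ) : ℚ) * ∏ i ∈ Finset.univ.erase j, ((v j : ℚ) - v i)
       = (Vd fun i => (v i : ℤ) : ℤ) * ∏ i ∈ Finset.univ.erase j, ((v j : ℚ) - k - v i) := by
      exact_mod_cast h3
    have g6 : ((n - k).factorial : ℚ) * n.descFactorial k = n.factorial := by exact_mod_cast h6
    have hDQ : (D : ℚ) ≠ 0 := by exact_mod_cast hD
    set E := ∏ i ∈ Finset.univ.erase j, ((v j : ℚ) - v i)
    set E' := ∏ i ∈ Finset.univ.erase j, ((v j : ℚ) - k - v i)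
    rw [mul_div_assoc', div_mul_eq_mul_div, eq_div_iff hE]
    apply mul_right_cancel₀ hDQ
    linear_combination (n.descFactorial k : ℚ) * E * g2 - E' * g1 +
      (n.descFactorial k : ℚ) * (n - k).factorial * g3 +
      E' * ((Vd fun i => (v i : ℤ) : ℤ) : ℚ) * g6
  · rw [show (v j).descFactorial k = 0 from Nat.descFactorial_eq_zero_iff_lt.2 (by omega)]
    simp

end Frob

section Res

lemma reflect_prod {ι : Type*} (s : Finset ι) (ν : ι → ℚ) :
    ((Polynomial.reflect s.card (∏ i ∈ s, (Polynomial.X - Polynomial.C (ν i))) : Polynomial ℚ) :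
      PowerSeries ℚ) = ∏ i ∈ s, lin (ν i) := by
  classical
  induction s using Finset.induction_on with
  | empty => simp
  | insert a s ha ih =>
    rw [Finset.card_insert_of_notMem ha, Finset.prod_insert ha, Finset.prod_insert ha, add_comm,
      Polynomial.reflect_mul _ _ (Polynomial.natDegree_X_sub_C_le _)
        (by rw [Polynomial.natDegree_finsetProd_X_sub_C_eq_card]), Polynomial.coe_mul, ih]
    congr 1
    rw [lin, Polynomial.reflect_sub, Polynomial.reflect_one_X, Polynomial.reflect_C]
    simp

lemma residue {ι κ : Type*} [Fintype ι] [DecidableEq ι] [Nonempty ι] [Fintype κ] (k : ℕ) (μ : ι → ℚ)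
    (hμ : Function.Injective μ) (ν : κ → ℚ) (hc : Fintype.card κ = Fintype.card ι + k)
    (S : PowerSeries ℚ) (hS : S * ∏ i, lin (μ i) = ∏ l, lin (ν l)) :
    PowerSeries.coeff (k + 1) S =
      ∑ j, (∏ l, (μ j - ν l)) / ∏ i ∈ Finset.univ.erase j, (μ j - μ i) := by
  set r := Fintype.card ι with hr
  have hr0 : 0 < r := Fintype.card_pos
  set P : Polynomial ℚ := ∏ i, (Polynomial.X - Polynomial.C (μ i)) with hP
  set N : Polynomial ℚ := ∏ l, (Polynomial.X - Polynomial.C (ν l)) with hN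
  have hPm : P.Monic := Polynomial.monic_prod_of_monic _ _ fun i _ => Polynomial.monic_X_sub_C _
  have hPd : P.natDegree = r := by
    rw [hP, Polynomial.natDegree_finsetProd_X_sub_C_eq_card]; rfl
  have hNd : N.natDegree = r + k := by
    rw [hN, Polynomial.natDegree_finsetProd_X_sub_C_eq_card, ← hc]; rfl
  set Q := N /ₘ P
  set ρ := N %ₘ P with hρ
  have hdecomp : ρ + P * Q = N := Polynomial.modByMonic_add_div N P
  have hQd : Q.natDegree ≤ k := by
    rw [Polynomial.natDegree_divByMonic _ hPm]; omega
  have hρd : ρ.degree < r := by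
    have := Polynomial.degree_modByMonic_lt N hPm
    rwa [Polynomial.degree_eq_natDegree hPm.ne_zero, hPd] at this
  have hPr : ((Polynomial.reflect r P : Polynomial ℚ) : PowerSeries ℚ) = ∏ i, lin (μ i) :=
    reflect_prod Finset.univ μ
  have hNr : ((Polynomial.reflect (r + k) N : Polynomial ℚ) : PowerSeries ℚ) = ∏ i, lin (ν i) := by
    rw [← hc]; exact reflect_prod Finset.univ ν
  have h1 : Polynomial.reflect (r + k) N = Polynomial.reflect (r + k) ρ +
      Polynomial.reflect r P * Polynomial.reflect k Q := by
    rw [← Polynomial.reflect_mul _ _ hPd.le hQd, ← Polynomial.reflect_add, hdecomp]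
  have h2 : (S - (Polynomial.reflect k Q : Polynomial ℚ)) * ∏ i, lin (μ i) =
      (Polynomial.reflect (r + k) ρ : Polynomial ℚ) := by
    rw [sub_mul, hS, ← hNr, h1, ← hPr]
    push_cast
    ring
  have h3 : (PowerSeries.X : PowerSeries ℚ) ^ (k + 1) ∣
      ((Polynomial.reflect (r + k) ρ : Polynomial ℚ) : PowerSeries ℚ) := by
    rw [PowerSeries.X_pow_dvd_iff]
    intro d hd
    rw [Polynomial.coeff_coe, Polynomial.coeff_reflect, Polynomial.revAt_le (by omega)]
    apply Polynomial.coeff_eq_zero_of_degree_lt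
    refine hρd.trans_le ?_
    exact_mod_cast (by omega : r ≤ r + k - d)
  obtain ⟨U, hU⟩ := h3
  have hinv : (∏ i, lin (μ i)) * ∏ i, ilin (μ i) = 1 := by
    rw [← Finset.prod_mul_distrib]; exact Finset.prod_eq_one fun i _ => lin_mul_ilin _
  have h4 : S - ((Polynomial.reflect k Q : Polynomial ℚ) : PowerSeries ℚ) =
      PowerSeries.X ^ (k + 1) * (U * ∏ i, ilin (μ i)) := by
    rw [← mul_assoc, ← hU, ← h2, mul_assoc, hinv, mul_one]
  have h5 := congrArg (PowerSeries.coeff (k + 1)) h4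
  have h6 := congrArg (PowerSeries.coeff (k + 1)) hU
  have e0 : ∀ V : PowerSeries ℚ, PowerSeries.coeff (k + 1) (PowerSeries.X ^ (k + 1) * V) =
      PowerSeries.constantCoeff V := by
    intro V
    have := PowerSeries.coeff_X_pow_mul V (k + 1) 0
    simpa using this
  have e1 : PowerSeries.constantCoeff (∏ i, ilin (μ i)) = 1 := by
    rw [map_prod]
    refine Finset.prod_eq_one fun i _ => ?_
    rw [← PowerSeries.coeff_zero_eq_constantCoeff_apply, coeff_ilin, pow_zero]
  have e2 : Q.coeff (k + 1) = 0 := Polynomial.coeff_eq_zero_of_natDegree_lt (by omega)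
  rw [e0, Polynomial.coeff_coe, Polynomial.coeff_reflect, Polynomial.revAt_le (by omega)] at h6
  rw [map_sub, e0, Polynomial.coeff_coe, Polynomial.coeff_reflect,
    Polynomial.revAt_eq_self_of_lt (by omega), e2, sub_zero, map_mul, e1, mul_one, ← h6] at h5
  rw [h5, show r + k - (k + 1) = r - 1 by omega]
  have := Lagrange.coeff_eq_sum (s := Finset.univ) (v := μ) hμ.injOn (P := ρ) (by exact_mod_cast hρd)
  rw [Finset.card_univ] at this
  rw [this]
  refine Finset.sum_congr rfl fun j _ => ?_
  congr 1
  have h7 : P.eval (μ j) = 0 := by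
    rw [hP, Polynomial.eval_prod]
    exact Finset.prod_eq_zero (Finset.mem_univ j) (by simp)
  have h8 : N.eval (μ j) = ρ.eval (μ j) := by
    rw [← hdecomp, Polynomial.eval_add, Polynomial.eval_mul, h7, zero_mul, add_zero]
  rw [← h8, hN, Polynomial.eval_prod]
  simp

end Res

section Ser
variable {A : Type*} [CommRing A] {m : ℕ}

/-- the block offsets -/
def aa {A : Type*} [AddCommMonoid A] {m : ℕ} (P Q : Fin m → A) (b : Fin m) : A :=
  Q b + ∑ c, if b < c then P c else 0

/-- the basic rational function -/
noncomputable def gg (P Q : Fin m → A) : PowerSeries A :=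
  ∏ b, (lin (aa P Q b + P b) * ilin (aa P Q b))

/-- product of the shifts -/
noncomputable def SS (k : ℕ) (P Q : Fin m → A) : PowerSeries A :=
  ∏ t ∈ Finset.range k, tw 1 (t : A) 1 (gg P Q)

lemma map_aa {B : Type*} [CommRing B] (f : A →+* B) (P Q : Fin m → A) (b : Fin m) :
    f (aa P Q b) = aa (fun i => f (P i)) (fun i => f (Q i)) b := by
  simp only [aa, map_add, map_sum]
  congr 1
  refine Finset.sum_congr rfl fun c _ => ?_
  split_ifs <;> simp

lemma map_SS {B : Type*} [CommRing B] (f : A →+* B) (k : ℕ) (P Q : Fin m → A) :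
    PowerSeries.map f (SS k P Q) = SS k (fun i => f (P i)) (fun i => f (Q i)) := by
  simp only [SS, gg, map_prod, map_tw, map_mul, map_lin, map_ilin, map_add, map_aa, map_one,
    map_natCast]

lemma SS_mul (k : ℕ) (P Q : Fin m → A) :
    SS k P Q * ∏ b, ∏ t ∈ Finset.range k, lin (aa P Q b + (t : A)) =
      (∏ t ∈ Finset.range k, lin (t : A)) *
        ∏ b, ∏ t ∈ Finset.range k, lin (aa P Q b + P b + (t : A)) := by
  have hg : gg P Q * ∏ b, lin (aa P Q b) = ∏ b, lin (aa P Q b + P b) := by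
    rw [gg, ← Finset.prod_mul_distrib]
    refine Finset.prod_congr rfl fun b _ => ?_
    rw [mul_assoc, mul_comm (ilin _), lin_mul_ilin, mul_one]
  rw [Finset.prod_comm, Finset.prod_comm (s := (Finset.univ : Finset (Fin m))), SS,
    ← Finset.prod_mul_distrib, ← Finset.prod_mul_distrib]
  refine Finset.prod_congr rfl fun t _ => ?_
  have h1 : ∀ c : Fin m → A, ∏ b, lin (c b + (t : A)) = lin (t : A) ^ m * sb 1 (t : A) (∏ b, lin (c b)) := by
    intro c
    have : lin (t : A) ^ m = ∏ _b : Fin m, lin (t : A) := by simp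
    rw [map_prod, this, ← Finset.prod_mul_distrib]
    refine Finset.prod_congr rfl fun b _ => ?_
    rw [lin_mul_sb_lin, mul_one, add_comm]
  rw [h1, h1 fun b => aa P Q b + P b, ← hg, map_mul, tw]
  ring

end Ser

section Tele
variable {A : Type*} [CommRing A]

lemma lin_ne_zero {A : Type*} [CommRing A] [Nontrivial A] (c : A) : lin c ≠ 0 := by
  intro h
  have := lin_mul_ilin c
  rw [h, zero_mul] at this
  exact zero_ne_one this

lemma tele (a : A) (p k : ℕ) :
    (∏ s ∈ Finset.range p, lin (a + (s : A) + (k : A))) * ∏ t ∈ Finset.range k, lin (a + (t : A)) =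
    (∏ s ∈ Finset.range p, lin (a + (s : A))) * ∏ t ∈ Finset.range k, lin (a + (p : A) + (t : A)) := by
  have h1 := Finset.prod_range_add (fun s : ℕ => lin (a + (s : A))) p k
  have h2 := Finset.prod_range_add (fun s : ℕ => lin (a + (s : A))) k p
  rw [add_comm k p] at h2
  rw [h2] at h1
  rw [mul_comm]
  convert h1 using 3 <;> · push_cast; ring_nf

end Tele

section Shape

/-- shifted parts -/
def mu (L : List ℕ) (i : Fin L.length) : ℕ := L.get i + (L.length - 1 - (i : ℕ))

lemma prod_mu_cons {M : Type*} [CommMonoid M] (f : ℕ → M) (a : ℕ) (L : List ℕ) :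
    ∏ i, f (mu (a :: L) i) = f (a + L.length) * ∏ i, f (mu L i) := by
  have := Fin.prod_univ_succ (n := L.length) (fun i => f (mu (a :: L) i))
  refine this.trans ?_
  congr 1
  refine Finset.prod_congr rfl fun i _ => ?_
  congr 1
  simp only [mu, List.get_eq_getElem, Fin.val_succ, List.getElem_cons_succ, List.length_cons]
  congr 1
  omega

lemma prod_mu_replicate {M : Type*} [CommMonoid M] (f : ℕ → M) (p q : ℕ) (L : List ℕ) :
    ∏ i, f (mu (List.replicate p q ++ L) i) =
      (∏ s ∈ Finset.range p, f (q + L.length + s)) * ∏ i, f (mu L i) := by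
  induction p with
  | zero => simp
  | succ p ih =>
    have h : q + (List.replicate p q ++ L).length = q + L.length + p := by
      rw [List.length_append, List.length_replicate]; omega
    rw [List.replicate_succ, List.cons_append, prod_mu_cons, ih, Finset.prod_range_succ, h,
      mul_assoc, mul_left_comm]

lemma uR_succ {m : ℕ} (p q : Fin (m + 1) → ℕ) : unionRectangles p q =
    List.replicate (p 0) (q 0) ++ unionRectangles (fun i => p i.succ) (fun i => q i.succ) := by
  simp [unionRectangles, List.ofFn_succ]

lemma uR_length {m : ℕ} (p q : Fin m → ℕ) : (unionRectangles p q).length = ∑ i, p i := by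
  induction m with
  | zero => simp [unionRectangles]
  | succ m ih => rw [uR_succ, List.length_append, ih, Fin.sum_univ_succ]; simp

lemma uR_sum {m : ℕ} (p q : Fin m → ℕ) : (unionRectangles p q).sum = ∑ i, p i * q i := by
  induction m with
  | zero => simp [unionRectangles]
  | succ m ih => rw [uR_succ, List.sum_append, ih, Fin.sum_univ_succ]; simp

lemma uR_prod {M : Type*} [CommMonoid M] (f : ℕ → M) {m : ℕ} (p q : Fin m → ℕ) :
    ∏ i, f (mu (unionRectangles p q) i) = ∏ b, ∏ s ∈ Finset.range (p b), f (aa p q b + s) := by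
  induction m with
  | zero =>
    have : unionRectangles p q = [] := by simp [unionRectangles]
    rw [this]
    simp
  | succ m ih =>
    rw [uR_succ, prod_mu_replicate, ih, Fin.prod_univ_succ, uR_length]
    simp [aa, Fin.sum_univ_succ]

lemma uR_pairwise {m : ℕ} (p q : Fin m → ℕ) (hq : ∀ i j : Fin m, i < j → q j < q i) :
    (unionRectangles p q).Pairwise (· ≥ ·) := by
  rw [unionRectangles, List.pairwise_flatten]
  constructor
  · intro l hl
    rw [List.mem_ofFn] at hl
    obtain ⟨i, rfl⟩ := hl
    rw [List.pairwise_replicate]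
    right; exact le_refl _
  · rw [List.pairwise_ofFn]
    intro i j hij x hx y hy
    rw [List.eq_of_mem_replicate hx, List.eq_of_mem_replicate hy]
    exact (hq i j hij).le

lemma mu_injective (L : List ℕ) (hL : L.Pairwise (· ≥ ·)) : Function.Injective (mu L) := by
  have : StrictAnti (mu L) := by
    intro i j hij
    have h := List.pairwise_iff_get.1 hL i j hij
    have h1 := j.2
    have h2 : (i : ℕ) < j := hij
    simp only [mu]
    omega
  exact this.injective

lemma sum_mu (L : List ℕ) : ∑ i, mu L i = L.sum + ∑ i : Fin L.length, (i : ℕ) := by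
  simp only [mu, Finset.sum_add_distrib]
  congr 1
  · simp
  · rw [← Equiv.sum_comp Fin.revPerm]
    refine Finset.sum_congr rfl fun i _ => ?_
    have := i.2
    simp
    omega

end Shape

section Final

lemma cast_desc (n k : ℕ) : (n.descFactorial k : ℚ) = ∏ t ∈ Finset.range k, ((n : ℚ) - t) := by
  induction k with
  | zero => simp
  | succ k ih =>
    rw [Nat.descFactorial_succ, Finset.prod_range_succ, ← ih, mul_comm]
    push_cast
    rcases le_or_gt k n with h | h
    · rw [Nat.cast_sub h]
    · rw [show n.descFactorial k = 0 from Nat.descFactorial_eq_zero_iff_lt.2 h]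
      simp

lemma cast_aa {m : ℕ} (p q : Fin m → ℕ) (b : Fin m) :
    ((aa p q b : ℕ) : ℚ) = aa (fun i => (p i : ℚ)) (fun i => (q i : ℚ)) b := by
  simp [aa]

lemma SS_shape {m : ℕ} (k : ℕ) (p q : Fin m → ℕ) :
    SS k (fun i => (p i : ℚ)) (fun i => (q i : ℚ)) *
        ∏ i, lin ((mu (unionRectangles p q) i : ℕ) : ℚ) =
      (∏ t ∈ Finset.range k, lin (t : ℚ)) *
        ∏ i, lin (((mu (unionRectangles p q) i : ℕ) : ℚ) + k) := by
  rw [uR_prod (fun n : ℕ => lin (n : ℚ)), uR_prod (fun n : ℕ => lin ((n : ℚ) + k))]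
  simp only [Nat.cast_add, cast_aa]
  set P : Fin m → ℚ := fun i => (p i : ℚ) with hP
  set Q : Fin m → ℚ := fun i => (q i : ℚ)
  have h := SS_mul k P Q
  have ht : (∏ b, ∏ s ∈ Finset.range (p b), lin (aa P Q b + (s : ℚ) + (k : ℚ))) *
        (∏ b, ∏ t ∈ Finset.range k, lin (aa P Q b + (t : ℚ))) =
      (∏ b, ∏ s ∈ Finset.range (p b), lin (aa P Q b + (s : ℚ))) *
        ∏ b, ∏ t ∈ Finset.range k, lin (aa P Q b + P b + (t : ℚ)) := by
    rw [← Finset.prod_mul_distrib, ← Finset.prod_mul_distrib]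
    exact Finset.prod_congr rfl fun b _ => tele _ _ _
  have hne : (∏ b, ∏ t ∈ Finset.range k, lin (aa P Q b + (t : ℚ))) ≠ 0 :=
    Finset.prod_ne_zero_iff.2 fun b _ => Finset.prod_ne_zero_iff.2 fun t _ => lin_ne_zero _
  apply mul_right_cancel₀ hne
  rw [mul_assoc (∏ t ∈ Finset.range k, lin (t : ℚ)), ht, mul_right_comm, h]
  ring

lemma coeff_SS {m : ℕ} (k : ℕ) (p q : Fin m → ℕ)
    (hq : ∀ i j : Fin m, i < j → q j < q i) (hne : 0 < ∑ i, p i) :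
    PowerSeries.coeff (k + 1) (SS k (fun i => (p i : ℚ)) (fun i => (q i : ℚ))) =
    -(k : ℚ) * ∑ j, ((mu (unionRectangles p q) j).descFactorial k : ℚ) *
      ((∏ i ∈ Finset.univ.erase j, ((mu (unionRectangles p q) j : ℚ) - k
          - mu (unionRectangles p q) i)) /
        ∏ i ∈ Finset.univ.erase j, ((mu (unionRectangles p q) j : ℚ)
          - mu (unionRectangles p q) i)) := by
  have hS := SS_shape k p q
  have hinj := mu_injective _ (uR_pairwise p q hq)
  rw [← uR_length p q] at hne
  generalize unionRectangles p q = L at *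
  have : Nonempty (Fin L.length) := ⟨⟨0, hne⟩⟩
  rw [residue k (fun i => (mu L i : ℚ)) (fun i j h => hinj (Nat.cast_injective (R := ℚ) h))
    (Sum.elim (fun t : Fin k => ((t : ℕ) : ℚ)) (fun i => (mu L i : ℚ) + k))
    (by simp [add_comm]) _ (by
      rw [hS, Fintype.prod_sum_type, Finset.prod_range]; rfl), Finset.mul_sum]
  refine Finset.sum_congr rfl fun j _ => ?_
  rw [Fintype.prod_sum_type]
  simp only [Sum.elim_inl, Sum.elim_inr]
  rw [cast_desc, Finset.prod_range, ← Finset.mul_prod_erase _ _ (Finset.mem_univ j)]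
  have : ∀ i, (mu L j : ℚ) - (mu L i + k) = (mu L j : ℚ) - k - mu L i := fun i => by ring
  simp only [this]
  ring

lemma value_neg (k m : ℕ) (hm : 1 ≤ m) :
    PowerSeries.coeff (k + 1) (SS k (fun _ : Fin m => (1 : ℚ)) (fun _ => -1)) =
      -(k : ℚ) * ((-1) ^ k * ((k + m - 1).descFactorial k : ℚ)) := by
  have haa : ∀ b : Fin m, aa (fun _ : Fin m => (1 : ℚ)) (fun _ => -1) b = (m : ℚ) - 2 - (b : ℕ) := by
    intro b
    have h1 : (∑ c : Fin m, if b < c then (1 : ℚ) else 0) = ((m - 1 - (b : ℕ) : ℕ) : ℚ) := by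
      rw [Finset.sum_boole]
      congr 1
      have : Finset.univ.filter (fun c => b < c) = Finset.Ioi b := by ext; simp
      rw [this, Fin.card_Ioi]
    have hb := b.2
    rw [aa, h1, Nat.cast_sub (by omega), Nat.cast_sub hm]
    push_cast; ring
  have h := SS_mul k (fun _ : Fin m => (1 : ℚ)) (fun _ => -1)
  simp only [haa] at h
  set G : ℚ → PowerSeries ℚ := fun x => ∏ t ∈ Finset.range k, lin (x + (t : ℚ)) with hG
  have hGne : ∀ x, G x ≠ 0 := fun x => Finset.prod_ne_zero_iff.2 fun t _ => lin_ne_zero _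
  set S := SS k (fun _ : Fin m => (1 : ℚ)) (fun _ => -1) with hSdef
  have h' : S * ∏ b : Fin m, G ((m : ℚ) - 2 - (b : ℕ)) =
      G 0 * ∏ b : Fin m, G ((m : ℚ) - 2 - (b : ℕ) + 1) := by
    simpa [hG] using h
  obtain ⟨d, rfl⟩ : ∃ d, m = d + 1 := ⟨m - 1, by omega⟩
  rw [Fin.prod_univ_castSucc, Fin.prod_univ_succ (fun b : Fin (d + 1) =>
    G (((d + 1 : ℕ) : ℚ) - 2 - (b : ℕ) + 1))] at h'
  have hmid : ∏ i : Fin d, G (((d + 1 : ℕ) : ℚ) - 2 - ((i.succ : Fin (d + 1)) : ℕ) + 1) =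
      ∏ i : Fin d, G (((d + 1 : ℕ) : ℚ) - 2 - ((i.castSucc : Fin (d + 1)) : ℕ)) := by
    refine Finset.prod_congr rfl fun i _ => ?_
    congr 1
    simp
    ring
  rw [hmid] at h'
  have hmne : ∏ i : Fin d, G (((d + 1 : ℕ) : ℚ) - 2 - ((i.castSucc : Fin (d + 1)) : ℕ)) ≠ 0 :=
    Finset.prod_ne_zero_iff.2 fun b _ => hGne _
  have h2 : S * G (-1) = G 0 * G d := by
    apply mul_left_cancel₀ hmne
    have e1 : ((d + 1 : ℕ) : ℚ) - 2 - ((Fin.last d : Fin (d + 1)) : ℕ) = -1 := by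
      push_cast [Fin.val_last]; ring
    have e2 : ((d + 1 : ℕ) : ℚ) - 2 - ((0 : Fin (d + 1)) : ℕ) + 1 = d := by
      push_cast [Fin.val_zero]; ring
    rw [e1, e2] at h'
    linear_combination h'
  have h3 : G (-1) * lin ((k : ℚ) - 1) = lin (-1) * G 0 := by
    have a1 := Finset.prod_range_succ (fun t : ℕ => lin ((-1 : ℚ) + t)) k
    rw [Finset.prod_range_succ'] at a1
    rw [hG]
    simp only
    rw [show (k : ℚ) - 1 = -1 + k by ring, ← a1, mul_comm]
    congr 1
    · simp
    · refine Finset.prod_congr rfl fun t _ => ?_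
      congr 1; push_cast; ring
  have h4 : S * lin (-1) = lin ((k : ℚ) - 1) * G d := by
    apply mul_right_cancel₀ (hGne 0)
    linear_combination (lin ((k : ℚ) - 1)) * h2 - S * h3
  rw [residue k (fun _ : Unit => (-1 : ℚ)) (fun _ _ _ => rfl)
    (Sum.elim (fun _ : Unit => (k : ℚ) - 1) (fun t : Fin k => (d : ℚ) + (t : ℕ)))
    (by simp) _ (by
      rw [Fintype.prod_sum_type]
      simp only [Finset.univ_unique, Finset.prod_singleton, Sum.elim_inl, Sum.elim_inr]
      rw [h4, hG]
      simp only
      rw [Finset.prod_range])]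
  rw [Fintype.prod_sum_type, show k + (d + 1) - 1 = d + k by omega,
    Nat.add_descFactorial_eq_ascFactorial, Nat.ascFactorial_eq_prod_range]
  simp only [Finset.univ_unique, Finset.sum_singleton, Finset.prod_singleton, Sum.elim_inl,
    Sum.elim_inr]
  rw [Finset.prod_range]
  have : ∀ t : Fin k, (-1 : ℚ) - (d + (t : ℕ)) = -1 * ((d + 1 + (t : ℕ) : ℕ) : ℚ) := by
    intro t; push_cast; ring
  simp only [this, Finset.prod_mul_distrib]
  simp
  ring

end Final

end RectProof

/-- **Proposition 1.** For fixed `k, m ≥ 1` there is a polynomial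
`F_k ∈ ℤ[p_1,…,p_m,q_1,…,q_m]` such that for all positive integers `p_i` and
`q_1 > ⋯ > q_m ≥ 1` with `k ≤ n = ∑ p_i q_i`, the normalized character of the
union-of-rectangles shape `σ = (q_1^{p_1},…,q_m^{p_m})` satisfies
`χ̂^σ(k,1^{n-k}) = F_k(p_1,…,p_m;q_1,…,q_m)`; moreover
`(-1)^k F_k(1,…,1;-1,…,-1) = (k+m-1)_k`. -/
theorem union_of_rectangles_polynomiality (k m : ℕ) (hk : 1 ≤ k) (hm : 1 ≤ m) :
    ∃ F : MvPolynomial (Fin m ⊕ Fin m) ℤ,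
      (∀ p q : Fin m → ℕ, (∀ i, 1 ≤ p i) → (∀ i, 1 ≤ q i) →
        (∀ i j : Fin m, i < j → q j < q i) → k ≤ ∑ i, p i * q i →
        ((∑ i, p i * q i).descFactorial k : ℚ)
            * (symChar (unionRectangles p q)
                ((k ::ₘ Multiset.replicate ((∑ i, p i * q i) - k) 1)) : ℚ)
            / (symChar (unionRectangles p q) (Multiset.replicate (∑ i, p i * q i) 1) : ℚ)
          = (MvPolynomial.eval
              (Sum.elim (fun i => (p i : ℤ)) (fun i => (q i : ℤ))) F : ℚ)) ∧
      (-1 : ℤ) ^ k * MvPolynomial.eval (Sum.elim (fun _ => 1) (fun _ => -1)) F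
        = ((k + m - 1).descFactorial k : ℤ) := by
  set P : Fin m → MvPolynomial (Fin m ⊕ Fin m) ℤ := fun i => X (Sum.inl i) with hP
  set Q : Fin m → MvPolynomial (Fin m ⊕ Fin m) ℤ := fun i => X (Sum.inr i) with hQ
  obtain ⟨R, hR⟩ := RectProof.dvd_coeff_norm k hk (RectProof.gg P Q)
  have hk0 : (k : ℚ) ≠ 0 := by exact_mod_cast (by omega : k ≠ 0)
  have key : ∀ x y : Fin m → ℤ,
      PowerSeries.coeff (k + 1) (RectProof.SS k (fun i => (x i : ℚ)) (fun i => (y i : ℚ))) =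
        -(k : ℚ) * (MvPolynomial.eval (Sum.elim x y) (-R) : ℤ) := by
    intro x y
    have h := RectProof.map_SS ((Int.castRingHom ℚ).comp (MvPolynomial.eval (Sum.elim x y))) k P Q
    have h1 : RectProof.SS k (fun i => (x i : ℚ)) (fun i => (y i : ℚ)) =
        PowerSeries.map ((Int.castRingHom ℚ).comp (MvPolynomial.eval (Sum.elim x y)))
          (RectProof.SS k P Q) := by
      refine Eq.trans ?_ h.symm
      simp [hP, hQ]
    rw [h1, PowerSeries.coeff_map, RectProof.SS, hR]
    simp
  refine ⟨-R, ?_, ?_⟩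
  · intro p q hp hq hqq hkn
    have hpos : 0 < ∑ i, p i :=
      Finset.sum_pos (fun i _ => hp i) ⟨⟨0, hm⟩, Finset.mem_univ _⟩
    have h1 := RectProof.coeff_SS k p q hqq hpos
    have h2 := key (fun i => (p i : ℤ)) (fun i => (q i : ℤ))
    simp only [Int.cast_natCast] at h2
    rw [h2] at h1
    have h3 := mul_left_cancel₀ (neg_ne_zero.2 hk0) h1
    rw [h3, ← RectProof.normalized _ k (∑ i, p i * q i) hkn
      (RectProof.mu (unionRectangles p q))
      (RectProof.mu_injective _ (RectProof.uR_pairwise p q hqq))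
      (by rw [RectProof.sum_mu, RectProof.uR_sum])]
    simp only [symChar, Multiset.map_cons, Multiset.prod_cons, Multiset.map_replicate,
      Multiset.prod_replicate]
    rfl
  · have h1 := key (fun _ => 1) (fun _ => -1)
    have h2 := RectProof.value_neg k m hm
    simp only [Int.cast_one, Int.cast_neg] at h1
    rw [h1] at h2
    have h3 := mul_left_cancel₀ (neg_ne_zero.2 hk0) h2
    have h4 : MvPolynomial.eval (Sum.elim (fun _ => 1) (fun _ => -1)) (-R) =
      (-1 : ℤ) ^ k * ((k + m - 1).descFactorial k : ℤ) := by exact_mod_cast h3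
    rw [h4, ← mul_assoc, ← mul_pow]
    simp
end
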